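/- There exists a constant C > 0 such that the Hankel determinants satisfy D_n = C · (1/2)^{n²} · (π D_∞²/2)^n · n^{(4α²−1)/8 + (4β²−1)/8} · (1 + O(1/n)) as n → ∞; that is, there are constants C > 0 and C' > 0 such that for all n ≥ 1, | D_n · 2^{n²} · (2/(π D_∞²))^n · n^{−((4α²−1)/8 + (4β²−1)/8)} − C | ≤ C'/n. -/

import Mathlib

open Complex Filter Set MeasureTheory

noncomputable section

/-- The segment [-1,1] regarded as a subset of the complex plane. -/
def seg : Set ℂ := Complex.ofReal '' Set.Icc (-1) 1

open Polynomial in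
/-- The first `N` orthonormal polynomials, viewed with complex coefficients, of a measure carried
by `[-1,1]`. -/
structure IsOrthoSystem (μ : Measure ℝ) (N : ℕ) (p : ℕ → ℂ[X]) : Prop where
  supp : μ.restrict (Icc (-1) 1) = μ
  degree_eq : ∀ i < N, (p i).degree = i
  conj_eval : ∀ i < N, ∀ x : ℝ, (starRingEnd ℂ) ((p i).eval (x : ℂ)) = (p i).eval (x : ℂ)
  orth : ∀ i < N, ∀ j < N,
    ∫ x, (p i).eval (x : ℂ) * (p j).eval (x : ℂ) ∂μ = if i = j then 1 else 0

theorem integrable_of_continuousOn_Icc {E : Type*} [NormedAddCommGroup E] {μ : Measure ℝ}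
    [IsFiniteMeasure μ] (hμ : μ.restrict (Icc (-1) 1) = μ) {f : ℝ → E}
    (hf : ContinuousOn f (Icc (-1) 1)) : Integrable f μ := by
  rw [← hμ]
  exact hf.integrableOn_compact isCompact_Icc

theorem integral_congr_Icc {E : Type*} [NormedAddCommGroup E] [NormedSpace ℝ E] {μ : Measure ℝ}
    (hμ : μ.restrict (Icc (-1) 1) = μ) {f g : ℝ → E}
    (hfg : ∀ x ∈ Icc (-1 : ℝ) 1, f x = g x) : ∫ x, f x ∂μ = ∫ x, g x ∂μ := by
  rw [← hμ]
  exact setIntegral_congr_fun measurableSet_Icc hfg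

theorem ae_mem_Icc {μ : Measure ℝ} (hμ : μ.restrict (Icc (-1) 1) = μ) :
    ∀ᵐ x ∂μ, x ∈ Icc (-1 : ℝ) 1 := by
  rw [← hμ]
  exact ae_restrict_mem measurableSet_Icc

namespace IsOrthoSystem

open Polynomial

variable {μ : Measure ℝ} {N : ℕ} {p : ℕ → ℂ[X]}

theorem exists_expansion (hp : IsOrthoSystem μ N p) :
    ∀ j ≤ N, ∀ Q : ℂ[X], Q.degree < j → ∃ c : ℕ → ℂ, Q = ∑ i ∈ Finset.range j, C (c i) * p i := by
  intro j
  induction j with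
  | zero =>
    intro _ Q hQ
    refine ⟨0, ?_⟩
    have : Q = 0 := by
      rw [← Polynomial.degree_eq_bot]
      simpa [Nat.WithBot.lt_zero_iff] using hQ
    simp [this]
  | succ j ih =>
    intro hj Q hQ
    have hdeg := hp.degree_eq j (by omega)
    have hne : p j ≠ 0 := by
      intro h0; rw [h0] at hdeg; simp at hdeg
    have hnat : (p j).natDegree = j := natDegree_eq_of_degree_eq_some hdeg
    have hlc : (p j).coeff j ≠ 0 := by
      have := leadingCoeff_ne_zero.mpr hne
      rwa [leadingCoeff, hnat] at this
    set a := Q.coeff j / (p j).coeff j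
    have hlt : (Q - C a * p j).degree < j := by
      rw [degree_lt_iff_coeff_zero]
      intro m hm
      rcases hm.eq_or_lt with h | h
      · subst h
        simp [a, hlc]
      · have h1 : Q.coeff m = 0 := by
          apply coeff_eq_zero_of_degree_lt
          refine hQ.trans_le ?_
          exact_mod_cast h
        have h2 : (p j).coeff m = 0 := by
          apply coeff_eq_zero_of_natDegree_lt
          omega
        simp [h1, h2]
    obtain ⟨c, hc⟩ := ih (by omega) _ hlt
    refine ⟨Function.update c j a, ?_⟩
    rw [Finset.sum_range_succ, Function.update_self]
    rw [Finset.sum_congr rfl (g := fun i => C (c i) * p i), ← hc]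
    · ring
    · intro i hi
      rw [Function.update_of_ne (by simpa using (Finset.mem_range.mp hi).ne)]

variable [IsFiniteMeasure μ]

theorem integrable_of_continuousOn (hp : IsOrthoSystem μ N p) {f : ℝ → ℂ}
    (hf : ContinuousOn f (Icc (-1) 1)) : Integrable f μ :=
  integrable_of_continuousOn_Icc hp.supp hf

theorem expansion (hp : IsOrthoSystem μ N p) {j : ℕ} (hj : j ≤ N) {Q : ℂ[X]}
    (hQ : Q.degree < j) :
    Q = ∑ i ∈ Finset.range j, C (∫ x, Q.eval (x : ℂ) * (p i).eval (x : ℂ) ∂μ) * p i := by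
  obtain ⟨c, hc⟩ := hp.exists_expansion j hj Q hQ
  conv_lhs => rw [hc]
  refine Finset.sum_congr rfl fun k hk => ?_
  congr 2
  have hk' := Finset.mem_range.mp hk
  have : ∀ x : ℝ, Q.eval (x : ℂ) * (p k).eval (x : ℂ)
      = ∑ i ∈ Finset.range j, c i * ((p i).eval (x : ℂ) * (p k).eval (x : ℂ)) := by
    intro x
    conv_lhs => rw [hc]
    simp [eval_finsetSum, Finset.sum_mul, mul_assoc]
  simp_rw [this]
  rw [integral_finsetSum]
  · simp_rw [integral_const_mul]
    rw [Finset.sum_congr rfl (g := fun i => if i = k then c i else 0)]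
    · simp [hk']
    · intro i hi
      have hi' := Finset.mem_range.mp hi
      rw [hp.orth i (by omega) k (by omega)]
      simp
  · intro i _
    apply hp.integrable_of_continuousOn
    fun_prop

theorem integral_mul_eq_zero (hp : IsOrthoSystem μ N p) {j : ℕ} (hj : j < N) {Q : ℂ[X]}
    (hQ : Q.degree < j) : ∫ x, Q.eval (x : ℂ) * (p j).eval (x : ℂ) ∂μ = 0 := by
  obtain ⟨c, hc⟩ := hp.exists_expansion j hj.le Q hQ
  have : ∀ x : ℝ, Q.eval (x : ℂ) * (p j).eval (x : ℂ)
      = ∑ i ∈ Finset.range j, c i * ((p i).eval (x : ℂ) * (p j).eval (x : ℂ)) := by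
    intro x
    conv_lhs => rw [hc]
    simp [eval_finsetSum, Finset.sum_mul, mul_assoc]
  simp_rw [this]
  rw [integral_finsetSum]
  · simp_rw [integral_const_mul]
    refine Finset.sum_eq_zero fun i hi => ?_
    have hi' := Finset.mem_range.mp hi
    rw [hp.orth i (by omega) j (by omega), if_neg (by omega), mul_zero]
  · intro i _
    apply hp.integrable_of_continuousOn
    fun_prop

end IsOrthoSystem

theorem eval_divByMonic_mul {Q : Polynomial ℂ} {z x : ℂ} :
    (Q /ₘ (Polynomial.X - Polynomial.C z)).eval x * (z - x) = Q.eval z - Q.eval x := by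
  have h := Polynomial.modByMonic_add_div Q (Polynomial.X - Polynomial.C z)
  have h2 := congrArg (Polynomial.eval x) h
  rw [Polynomial.modByMonic_X_sub_C_eq_C_eval] at h2
  simp at h2
  linear_combination -h2

theorem eval_divByMonic_self {Q : Polynomial ℂ} {z : ℂ} :
    (Q /ₘ (Polynomial.X - Polynomial.C z)).eval z = Q.derivative.eval z := by
  have h := Polynomial.modByMonic_add_div Q (Polynomial.X - Polynomial.C z)
  have h2 := congrArg (fun q => Polynomial.eval z (Polynomial.derivative q)) h
  rw [Polynomial.modByMonic_X_sub_C_eq_C_eval] at h2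
  simpa using h2

theorem degree_divByMonic_X_sub_C_lt {Q : Polynomial ℂ} {z : ℂ} {j : ℕ} (hQ : Q.degree ≤ j) :
    (Q /ₘ (Polynomial.X - Polynomial.C z)).degree < j := by
  by_cases h0 : Q = 0
  · subst h0; simp
  · exact (Polynomial.degree_divByMonic_lt _ (Polynomial.X - Polynomial.C z) h0
      (by simp)).trans_le hQ

namespace IsOrthoSystem

open Polynomial

variable {μ : Measure ℝ} {N : ℕ} {p : ℕ → ℂ[X]}

theorem degree_le (hp : IsOrthoSystem μ N p) {i j : ℕ} (hij : i ≤ j) (hj : j < N) :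
    (p i).degree ≤ j := by
  rw [hp.degree_eq i (by omega)]; exact_mod_cast hij

/-- The matrix of multiplication by `1 / (z - x)` compressed to polynomials. -/
def resolventEntry (μ : Measure ℝ) (p : ℕ → ℂ[X]) (z : ℂ) (i j : ℕ) : ℂ :=
  ∫ x, (p i).eval (x : ℂ) * (p j).eval (x : ℂ) * (z - (x : ℂ))⁻¹ ∂μ

theorem resolventEntry_comm (z : ℂ) (i j : ℕ) :
    resolventEntry μ p z i j = resolventEntry μ p z j i := by
  simp only [resolventEntry, mul_comm ((p i).eval _)]

variable [IsFiniteMeasure μ]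

/-- The function of the second kind `∫ p_j(x) / (z - x) dμ(x)`. -/
def secondKind (μ : Measure ℝ) (p : ℕ → ℂ[X]) (z : ℂ) (j : ℕ) : ℂ :=
  ∫ x, (p j).eval (x : ℂ) * (z - (x : ℂ))⁻¹ ∂μ

theorem continuousOn_inv_sub {z : ℂ} (hz : ∀ x ∈ Icc (-1 : ℝ) 1, z - (x : ℂ) ≠ 0) :
    ContinuousOn (fun x : ℝ => (z - (x : ℂ))⁻¹) (Icc (-1) 1) :=
  ContinuousOn.inv₀ (by fun_prop) hz

theorem integral_mul_mul_inv (hp : IsOrthoSystem μ N p) {z : ℂ}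
    (hz : ∀ x ∈ Icc (-1 : ℝ) 1, z - (x : ℂ) ≠ 0) {j : ℕ} (hj : j < N) {Q : ℂ[X]}
    (hQ : Q.degree ≤ j) :
    ∫ x, Q.eval (x : ℂ) * (p j).eval (x : ℂ) * (z - (x : ℂ))⁻¹ ∂μ
      = Q.eval z * secondKind μ p z j := by
  set D := Q /ₘ (X - C z)
  have hr := continuousOn_inv_sub hz
  have h1 : ∫ x, Q.eval (x : ℂ) * (p j).eval (x : ℂ) * (z - (x : ℂ))⁻¹ ∂μ
      = ∫ x, (Q.eval z * ((p j).eval (x : ℂ) * (z - (x : ℂ))⁻¹)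
          - D.eval (x : ℂ) * (p j).eval (x : ℂ)) ∂μ := by
    refine integral_congr_Icc hp.supp fun x hx => ?_
    have hD : D.eval (x : ℂ) * (z - x) = Q.eval z - Q.eval (x : ℂ) := eval_divByMonic_mul
    have hne := hz x hx
    field_simp
    linear_combination (p j).eval (x : ℂ) * hD
  rw [h1, integral_sub, integral_const_mul,
    hp.integral_mul_eq_zero hj (degree_divByMonic_X_sub_C_lt hQ), sub_zero, secondKind]
  · apply hp.integrable_of_continuousOn; fun_prop
  · apply hp.integrable_of_continuousOn; fun_prop

theorem derivative_eval_eq_sum (hp : IsOrthoSystem μ N p) {z : ℂ}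
    (hz : ∀ x ∈ Icc (-1 : ℝ) 1, z - (x : ℂ) ≠ 0) {j : ℕ} (hj : j < N) :
    (p j).derivative.eval z = ∑ i ∈ Finset.range j, (p i).eval z *
      (secondKind μ p z i * (p j).eval z - (p i).eval z * secondKind μ p z j) := by
  set D := p j /ₘ (X - C z) with hDdef
  have hr := continuousOn_inv_sub hz
  have hdeg : D.degree < j := degree_divByMonic_X_sub_C_lt (hp.degree_eq j hj).le
  have h1 := congrArg (eval z) (hp.expansion hj.le hdeg)
  rw [hDdef, eval_divByMonic_self] at h1
  rw [h1, eval_finsetSum]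
  refine Finset.sum_congr rfl fun i hi => ?_
  have hi' := Finset.mem_range.mp hi
  rw [eval_mul, eval_C, mul_comm]
  congr 1
  rw [← hp.integral_mul_mul_inv hz hj (hp.degree_le hi'.le hj), secondKind, mul_comm,
    ← integral_const_mul, ← integral_sub]
  · refine integral_congr_Icc hp.supp fun x hx => ?_
    have hD : D.eval (x : ℂ) * (z - x) = (p j).eval z - (p j).eval (x : ℂ) :=
      eval_divByMonic_mul
    have hne := hz x hx
    rw [← hDdef]
    field_simp
    linear_combination (p i).eval (x : ℂ) * hD
  · apply hp.integrable_of_continuousOn; fun_prop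
  · apply hp.integrable_of_continuousOn; fun_prop

theorem resolventEntry_of_le (hp : IsOrthoSystem μ N p) {z : ℂ}
    (hz : ∀ x ∈ Icc (-1 : ℝ) 1, z - (x : ℂ) ≠ 0) {i j : ℕ} (hij : i ≤ j) (hj : j < N) :
    resolventEntry μ p z i j = (p i).eval z * secondKind μ p z j :=
  hp.integral_mul_mul_inv hz hj (hp.degree_le hij hj)

theorem sq_trace_sub_sum_sq (hp : IsOrthoSystem μ N p) {z : ℂ}
    (hz : ∀ x ∈ Icc (-1 : ℝ) 1, z - (x : ℂ) ≠ 0) {n : ℕ} (hn : n ≤ N) :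
    (∑ i ∈ Finset.range n, resolventEntry μ p z i i) ^ 2
      - ∑ i ∈ Finset.range n, ∑ j ∈ Finset.range n, resolventEntry μ p z i j ^ 2
      = 2 * ∑ i ∈ Finset.range n, (p i).derivative.eval z * secondKind μ p z i := by
  induction n with
  | zero => simp
  | succ n ih =>
    have ih := ih (by omega)
    simp only [Finset.sum_range_succ, Finset.sum_add_distrib]
    have hcol : ∑ i ∈ Finset.range n, resolventEntry μ p z n i ^ 2
        = ∑ i ∈ Finset.range n, resolventEntry μ p z i n ^ 2 :=
      Finset.sum_congr rfl fun i _ => by rw [resolventEntry_comm]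
    rw [hcol]
    have hrow : ∑ i ∈ Finset.range n, resolventEntry μ p z i n ^ 2
        = ∑ i ∈ Finset.range n, ((p i).eval z * secondKind μ p z n) ^ 2 :=
      Finset.sum_congr rfl fun i hi => by
        rw [hp.resolventEntry_of_le hz (Finset.mem_range.mp hi).le (by omega)]
    have hder : (p n).derivative.eval z * secondKind μ p z n
        = (∑ i ∈ Finset.range n, resolventEntry μ p z i i) * resolventEntry μ p z n n
          - ∑ i ∈ Finset.range n, ((p i).eval z * secondKind μ p z n) ^ 2 := by
      rw [hp.derivative_eval_eq_sum hz (by omega), Finset.sum_mul, Finset.sum_mul,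
        ← Finset.sum_sub_distrib]
      refine Finset.sum_congr rfl fun i hi => ?_
      rw [hp.resolventEntry_of_le hz le_rfl (by have := Finset.mem_range.mp hi; omega),
        hp.resolventEntry_of_le hz le_rfl (by omega)]
      ring
    rw [hrow]
    linear_combination ih - 2 * hder

/-- The integration by parts identity satisfied by a weight with logarithmic derivative
`q / (1 - x²)`. -/
def HasPearson (μ : Measure ℝ) (q : ℝ → ℂ) : Prop :=
  ∀ f f' : ℝ → ℂ, (∀ x ∈ Icc (-1 : ℝ) 1, HasDerivAt f (f' x) x) →
    ContinuousOn f' (Icc (-1) 1) →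
    ∫ x : ℝ, ((1 - (x : ℂ) ^ 2) * f' x - 2 * x * f x + q x * f x) ∂μ = 0

theorem integral_sub_mul_derivative (hp : IsOrthoSystem μ N p) {z : ℂ} {j : ℕ} (hj : j < N) :
    ∫ x : ℝ, (z + x) * (p j).derivative.eval (x : ℂ) * (p j).eval (x : ℂ) ∂μ = j := by
  set Q : ℂ[X] := (X + C z) * (p j).derivative - C (j : ℂ) * p j
  have hnat : (p j).natDegree = j := natDegree_eq_of_degree_eq_some (hp.degree_eq j hj)
  have hQ : Q.degree < j := by
    rw [degree_lt_iff_coeff_zero]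
    intro m hm
    have h1 : (p j).coeff (m + 1) = 0 := coeff_eq_zero_of_natDegree_lt (by omega)
    have h2 : (X * (p j).derivative).coeff m = m * (p j).coeff m := by
      cases m with
      | zero => simp
      | succ m => rw [coeff_X_mul, coeff_derivative]; push_cast; ring
    simp only [Q, add_mul, coeff_sub, coeff_add, h2, coeff_C_mul, coeff_derivative, h1]
    rcases hm.eq_or_lt with h | h
    · subst h; ring
    · rw [coeff_eq_zero_of_natDegree_lt (by omega)]; ring
  have h0 := hp.integral_mul_eq_zero hj hQ
  have h1 : ∫ x : ℝ, (z + x) * (p j).derivative.eval (x : ℂ) * (p j).eval (x : ℂ) ∂μ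
      = ∫ x : ℝ, (Q.eval (x : ℂ) * (p j).eval (x : ℂ)
        + j * ((p j).eval (x : ℂ) * (p j).eval (x : ℂ))) ∂μ := by
    congr 1; ext x; simp [Q]; ring
  rw [h1, integral_add, h0, integral_const_mul, hp.orth j hj j hj]
  · simp
  · apply hp.integrable_of_continuousOn; fun_prop
  · apply hp.integrable_of_continuousOn; fun_prop

theorem loop_summand (hp : IsOrthoSystem μ N p) {q : ℝ → ℂ} (hq : ContinuousOn q (Icc (-1) 1))
    (hqμ : HasPearson μ q) {z : ℂ} (hz : ∀ x ∈ Icc (-1 : ℝ) 1, z - (x : ℂ) ≠ 0) {j : ℕ}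
    (hj : j < N) :
    (1 - z ^ 2) * (∫ x : ℝ, ((p j).eval (x : ℂ) * (z - (x : ℂ))⁻¹) ^ 2 ∂μ
        + 2 * ((p j).derivative.eval z * secondKind μ p z j)) + 1 + 2 * j
      + ∫ x : ℝ, q x * (p j).eval (x : ℂ) ^ 2 * (z - (x : ℂ))⁻¹ ∂μ = 0 := by
  have hr := continuousOn_inv_sub hz
  set P : ℝ → ℂ := fun x => (p j).eval (x : ℂ) with hP
  set P' : ℝ → ℂ := fun x => (p j).derivative.eval (x : ℂ) with hP'
  have hPc : Continuous P := by fun_prop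
  have hPc' : Continuous P' := by fun_prop
  have key := hqμ (fun x => P x ^ 2 * (z - (x : ℂ))⁻¹)
    (fun x => 2 * P x * P' x * (z - (x : ℂ))⁻¹ + P x ^ 2 * ((z - (x : ℂ))⁻¹) ^ 2) (by
      intro x hx
      have h1 : HasDerivAt P (P' x) x := ((p j).hasDerivAt (x : ℂ)).comp_ofReal
      have h2 : HasDerivAt (fun y : ℝ => (z - (y : ℂ))) (-1) x := by
        simpa using ((hasDerivAt_id (x : ℂ)).comp_ofReal).const_sub z
      have h3 := (h1.pow 2).mul (h2.inv (hz x hx))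
      refine h3.congr_deriv ?_
      have := hz x hx
      simp only [Pi.pow_apply, Pi.inv_apply]
      field_simp
      ring) (by fun_prop)
  have hdeg : (p j).derivative.degree ≤ j :=
    (degree_derivative_le).trans (hp.degree_eq j hj).le
  have e1 := hp.integral_mul_mul_inv hz hj hdeg
  have e2 := hp.integral_sub_mul_derivative (z := z) hj
  have e3 := hp.orth j hj j hj
  rw [if_pos rfl] at e3
  have hsplit : ∫ x : ℝ, ((1 - (x : ℂ) ^ 2) *
      (2 * P x * P' x * (z - (x : ℂ))⁻¹ + P x ^ 2 * ((z - (x : ℂ))⁻¹) ^ 2)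
        - 2 * x * (P x ^ 2 * (z - (x : ℂ))⁻¹) + q x * (P x ^ 2 * (z - (x : ℂ))⁻¹)) ∂μ
      = ∫ x : ℝ, ((1 - z ^ 2) * (P x * (z - (x : ℂ))⁻¹) ^ 2
          + (2 * (1 - z ^ 2) * (P' x * P x * (z - (x : ℂ))⁻¹)
          + (P x * P x + (2 * ((z + x) * P' x * P x)
          + q x * P x ^ 2 * (z - (x : ℂ))⁻¹)))) ∂μ := by
    refine integral_congr_Icc hp.supp fun x hx => ?_
    have := hz x hx
    field_simp
    ring
  rw [hsplit, integral_add, integral_add, integral_add, integral_add, integral_const_mul,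
    integral_const_mul, integral_const_mul, e1, e2, e3] at key
  · linear_combination key
  all_goals (apply hp.integrable_of_continuousOn; fun_prop)

end IsOrthoSystem

namespace IsOrthoSystem

open Polynomial

variable {μ : Measure ℝ} {N : ℕ} {p : ℕ → ℂ[X]}

/-- The part of `1 / (z - x)` orthogonal to polynomials of degree less than `N`. -/
def resolventTail (μ : Measure ℝ) (p : ℕ → ℂ[X]) (N : ℕ) (z : ℂ) (x : ℝ) : ℂ :=
  (z - (x : ℂ))⁻¹ - ∑ j ∈ Finset.range N, secondKind μ p z j * (p j).eval (x : ℂ)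

theorem continuousOn_resolventTail {z : ℂ} (hz : ∀ x ∈ Icc (-1 : ℝ) 1, z - (x : ℂ) ≠ 0) :
    ContinuousOn (resolventTail μ p N z) (Icc (-1) 1) := by
  have hr := continuousOn_inv_sub hz
  unfold resolventTail
  fun_prop

variable [IsFiniteMeasure μ]

theorem integral_sub_proj_mul (hp : IsOrthoSystem μ N p) {f : ℝ → ℂ}
    (hf : ContinuousOn f (Icc (-1) 1)) {i : ℕ} (hi : i < N) :
    ∫ x : ℝ, (f x - ∑ j ∈ Finset.range N,
      (∫ y : ℝ, f y * (p j).eval (y : ℂ) ∂μ) * (p j).eval (x : ℂ)) * (p i).eval (x : ℂ) ∂μ = 0 := by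
  simp_rw [sub_mul, Finset.sum_mul, mul_assoc]
  rw [integral_sub, integral_finsetSum, Finset.sum_congr rfl
    (g := fun j => if j = i then ∫ y : ℝ, f y * (p j).eval (y : ℂ) ∂μ else 0)]
  · simp [hi]
  · intro j hj
    rw [integral_const_mul, hp.orth j (Finset.mem_range.mp hj) i hi]
    simp
  · intro j _
    apply hp.integrable_of_continuousOn; fun_prop
  · apply hp.integrable_of_continuousOn; fun_prop
  · apply hp.integrable_of_continuousOn; fun_prop

theorem integral_sub_proj_sq (hp : IsOrthoSystem μ N p) {f : ℝ → ℂ}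
    (hf : ContinuousOn f (Icc (-1) 1)) :
    ∫ x : ℝ, (f x - ∑ j ∈ Finset.range N,
      (∫ y : ℝ, f y * (p j).eval (y : ℂ) ∂μ) * (p j).eval (x : ℂ)) ^ 2 ∂μ
      = ∫ x : ℝ, f x ^ 2 ∂μ
        - ∑ j ∈ Finset.range N, (∫ y : ℝ, f y * (p j).eval (y : ℂ) ∂μ) ^ 2 := by
  set c : ℕ → ℂ := fun j => ∫ y : ℝ, f y * (p j).eval (y : ℂ) ∂μ with hc
  set e : ℝ → ℂ := fun x => f x - ∑ j ∈ Finset.range N, c j * (p j).eval (x : ℂ) with he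
  have hec : ContinuousOn e (Icc (-1) 1) := by fun_prop
  have h1 : ∫ x : ℝ, e x ^ 2 ∂μ = ∫ x : ℝ, (f x ^ 2 -
      (∑ j ∈ Finset.range N, c j * (f x * (p j).eval (x : ℂ))
      + ∑ j ∈ Finset.range N, c j * (e x * (p j).eval (x : ℂ)))) ∂μ := by
    congr 1; ext x
    have h2 : ∑ j ∈ Finset.range N, c j * (f x * (p j).eval (x : ℂ))
        = f x * ∑ j ∈ Finset.range N, c j * (p j).eval (x : ℂ) := by
      rw [Finset.mul_sum]; exact Finset.sum_congr rfl fun j _ => by ring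
    have h3 : ∑ j ∈ Finset.range N, c j * (e x * (p j).eval (x : ℂ))
        = e x * ∑ j ∈ Finset.range N, c j * (p j).eval (x : ℂ) := by
      rw [Finset.mul_sum]; exact Finset.sum_congr rfl fun j _ => by ring
    rw [h2, h3]
    simp only [he]; ring
  have h4 : ∀ j ∈ Finset.range N, ∫ x : ℝ, c j * (e x * (p j).eval (x : ℂ)) ∂μ = 0 := by
    intro j hj
    rw [integral_const_mul, hp.integral_sub_proj_mul hf (Finset.mem_range.mp hj), mul_zero]
  rw [h1, integral_sub, integral_add, integral_finsetSum, integral_finsetSum,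
    Finset.sum_eq_zero h4, add_zero]
  · congr 1
    refine Finset.sum_congr rfl fun j _ => ?_
    rw [integral_const_mul, sq]
  all_goals first
    | (apply hp.integrable_of_continuousOn; fun_prop)
    | (intro j _; apply hp.integrable_of_continuousOn; fun_prop)

theorem integral_resolventTail_mul (hp : IsOrthoSystem μ N p) {z : ℂ}
    (hz : ∀ x ∈ Icc (-1 : ℝ) 1, z - (x : ℂ) ≠ 0) {i : ℕ} (hi : i < N) :
    ∫ x : ℝ, resolventTail μ p N z x * (p i).eval (x : ℂ) ∂μ = 0 := by
  have := hp.integral_sub_proj_mul (continuousOn_inv_sub hz) hi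
  simpa only [resolventTail, secondKind, mul_comm ((z - _)⁻¹)] using this

theorem variance_row (hp : IsOrthoSystem μ N p) {z : ℂ}
    (hz : ∀ x ∈ Icc (-1 : ℝ) 1, z - (x : ℂ) ≠ 0) {i : ℕ} (hi : i < N) :
    ∫ x : ℝ, ((p i).eval (x : ℂ) * (z - (x : ℂ))⁻¹) ^ 2 ∂μ
      - ∑ j ∈ Finset.range N, resolventEntry μ p z i j ^ 2
      = (p i).eval z ^ 2 * ∫ x : ℝ, resolventTail μ p N z x ^ 2 ∂μ := by
  have hr := continuousOn_inv_sub hz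
  set D := p i /ₘ (X - C z) with hDdef
  have hdeg : D.degree < N := (degree_divByMonic_X_sub_C_lt (hp.degree_eq i hi).le).trans
    (by exact_mod_cast hi)
  have hf : ContinuousOn (fun x : ℝ => (p i).eval (x : ℂ) * (z - (x : ℂ))⁻¹) (Icc (-1) 1) := by
    fun_prop
  have h0 := hp.integral_sub_proj_sq hf
  have hcoef : ∀ j, ∫ y : ℝ, (p i).eval (y : ℂ) * (z - (y : ℂ))⁻¹ * (p j).eval (y : ℂ) ∂μ
      = resolventEntry μ p z i j := by
    intro j; unfold resolventEntry; congr 1; ext y; ring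
  simp_rw [hcoef] at h0
  rw [← h0, ← integral_const_mul]
  refine integral_congr_Icc hp.supp fun x hx => ?_
  rw [← mul_pow]
  congr 1
  have hDx : ∀ x ∈ Icc (-1 : ℝ) 1, (p i).eval (x : ℂ) * (z - (x : ℂ))⁻¹
      = (p i).eval z * (z - (x : ℂ))⁻¹ - D.eval (x : ℂ) := by
    intro x hx
    have hD : D.eval (x : ℂ) * (z - x) = (p i).eval z - (p i).eval (x : ℂ) :=
      eval_divByMonic_mul
    have hne := hz x hx
    field_simp
    linear_combination hD
  have hR : ∀ j ∈ Finset.range N, resolventEntry μ p z i j * (p j).eval (x : ℂ)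
      = (p i).eval z * (secondKind μ p z j * (p j).eval (x : ℂ))
        - (∫ y : ℝ, D.eval (y : ℂ) * (p j).eval (y : ℂ) ∂μ) * (p j).eval (x : ℂ) := by
    intro j _
    have : resolventEntry μ p z i j = (p i).eval z * secondKind μ p z j
        - ∫ y : ℝ, D.eval (y : ℂ) * (p j).eval (y : ℂ) ∂μ := by
      rw [secondKind, ← integral_const_mul, ← integral_sub, resolventEntry]
      · refine integral_congr_Icc hp.supp fun y hy => ?_
        linear_combination (p j).eval (y : ℂ) * hDx y hy
      · apply hp.integrable_of_continuousOn; fun_prop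
      · apply hp.integrable_of_continuousOn; fun_prop
    rw [this]; ring
  have hexp := congrArg (eval (x : ℂ)) (hp.expansion le_rfl hdeg)
  simp only [eval_finsetSum, eval_mul, eval_C] at hexp
  rw [Finset.sum_congr rfl hR, Finset.sum_sub_distrib, ← hexp, ← Finset.mul_sum, hDx x hx,
    resolventTail]
  ring

theorem integral_norm_tail_le (hp : IsOrthoSystem μ N p) {z : ℂ}
    (hz : ∀ x ∈ Icc (-1 : ℝ) 1, z - (x : ℂ) ≠ 0) (c : ℕ → ℂ) :
    ∫ x : ℝ, ‖resolventTail μ p N z x‖ ^ 2 ∂μ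
      ≤ ∫ x : ℝ, ‖resolventTail μ p N z x
          + ∑ i ∈ Finset.range N, c i * (p i).eval (x : ℂ)‖ ^ 2 ∂μ := by
  have hE := continuousOn_resolventTail (μ := μ) (p := p) (N := N) hz
  set E := resolventTail μ p N z with hEdef
  set T : ℝ → ℂ := fun x => ∑ i ∈ Finset.range N, c i * (p i).eval (x : ℂ) with hT
  have hTc : Continuous T := by fun_prop
  have hzero : ∫ x : ℝ, ∑ i ∈ Finset.range N,
      (starRingEnd ℂ) (c i) * (E x * (p i).eval (x : ℂ)) ∂μ = 0 := by
    rw [integral_finsetSum]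
    · refine Finset.sum_eq_zero fun i hi => ?_
      rw [integral_const_mul, hp.integral_resolventTail_mul hz (Finset.mem_range.mp hi), mul_zero]
    · intro i _; apply hp.integrable_of_continuousOn; fun_prop
  have hzero' : ∫ x : ℝ, 2 * (E x * (starRingEnd ℂ) (T x)).re ∂μ = 0 := by
    have hInt : Integrable (fun x : ℝ => E x * (starRingEnd ℂ) (T x)) μ := by
      apply hp.integrable_of_continuousOn
      exact hE.mul (Complex.continuous_conj.comp hTc).continuousOn
    have h1 : ∫ x : ℝ, E x * (starRingEnd ℂ) (T x) ∂μ = 0 := by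
      rw [← hzero]
      congr 1; ext x
      simp only [hT, map_sum, map_mul, Finset.mul_sum]
      refine Finset.sum_congr rfl fun i hi => ?_
      rw [hp.conj_eval i (Finset.mem_range.mp hi)]; ring
    rw [integral_const_mul]
    have h2 := integral_re hInt
    simp only [RCLike.re_to_complex] at h2
    rw [h2, h1]; simp
  calc ∫ x : ℝ, ‖E x‖ ^ 2 ∂μ
      = ∫ x : ℝ, (‖E x‖ ^ 2 + 2 * (E x * (starRingEnd ℂ) (T x)).re) ∂μ := by
        rw [integral_add, hzero', add_zero]
        · apply integrable_of_continuousOn_Icc hp.supp; fun_prop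
        · apply integrable_of_continuousOn_Icc hp.supp
          exact continuousOn_const.mul (Complex.continuous_re.comp_continuousOn
            (hE.mul (Complex.continuous_conj.comp hTc).continuousOn))
    _ ≤ _ := by
        apply integral_mono
        · apply integrable_of_continuousOn_Icc hp.supp
          exact (hE.norm.pow 2).add (continuousOn_const.mul (Complex.continuous_re.comp_continuousOn
            (hE.mul (Complex.continuous_conj.comp hTc).continuousOn)))
        · apply integrable_of_continuousOn_Icc hp.supp; fun_prop
        · intro x
          have : ‖E x + T x‖ ^ 2 = ‖E x‖ ^ 2 + ‖T x‖ ^ 2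
              + 2 * (E x * (starRingEnd ℂ) (T x)).re := by
            simp only [← Complex.normSq_eq_norm_sq, Complex.normSq_add]
          simp only [hT] at this ⊢
          rw [this]
          nlinarith [sq_nonneg ‖∑ i ∈ Finset.range N, c i * (p i).eval (x : ℂ)‖]

theorem kernel_mul_integral_tail_le (hp : IsOrthoSystem μ N p) {z : ℂ} {d : ℝ} (hd : 0 < d)
    (hz : ∀ x ∈ Icc (-1 : ℝ) 1, d ≤ ‖z - (x : ℂ)‖) :
    (∑ i ∈ Finset.range N, ‖(p i).eval z‖ ^ 2) * ∫ x : ℝ, ‖resolventTail μ p N z x‖ ^ 2 ∂μ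
      ≤ 1 / d ^ 2 := by
  have hz0 : ∀ x ∈ Icc (-1 : ℝ) 1, z - (x : ℂ) ≠ 0 := fun x hx =>
    norm_pos_iff.mp (hd.trans_le (hz x hx))
  have hr := continuousOn_inv_sub hz0
  set k := ∑ i ∈ Finset.range N, ‖(p i).eval z‖ ^ 2 with hk
  have hk0 : 0 ≤ k := Finset.sum_nonneg fun i _ => by positivity
  rcases hk0.eq_or_lt with h0 | hkpos
  · rw [← h0]; simp; positivity
  set s : ℂ[X] := ∑ i ∈ Finset.range N, C ((starRingEnd ℂ) ((p i).eval z)) * p i with hs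
  have hsz : s.eval z = k := by
    simp only [hs, hk, eval_finsetSum, eval_mul, eval_C, Complex.ofReal_sum]
    refine Finset.sum_congr rfl fun i _ => ?_
    rw [← Complex.normSq_eq_conj_mul_self, Complex.normSq_eq_norm_sq]
  have hsdeg : s.degree ≤ N := by
    refine (degree_sum_le _ _).trans (Finset.sup_le fun i hi => ?_)
    have hi' := Finset.mem_range.mp hi
    refine (degree_mul_le _ _).trans ((add_le_add degree_C_le le_rfl).trans ?_)
    rw [zero_add, hp.degree_eq i hi']; exact_mod_cast hi'.le
  have hsnorm : ∫ x : ℝ, ‖s.eval (x : ℂ)‖ ^ 2 ∂μ = k := by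
    have hc : ∀ x : ℝ, ((‖s.eval (x : ℂ)‖ ^ 2 : ℝ) : ℂ) = ∑ i ∈ Finset.range N,
        ∑ j ∈ Finset.range N, ((p i).eval z * (starRingEnd ℂ) ((p j).eval z)) *
          ((p i).eval (x : ℂ) * (p j).eval (x : ℂ)) := by
      intro x
      rw [← Complex.normSq_eq_norm_sq, Complex.normSq_eq_conj_mul_self]
      simp only [hs, eval_finsetSum, eval_mul, eval_C, map_sum, map_mul, Complex.conj_conj]
      rw [Finset.sum_mul_sum]
      refine Finset.sum_congr rfl fun i hi => Finset.sum_congr rfl fun j hj => ?_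
      rw [hp.conj_eval i (Finset.mem_range.mp hi)]
      ring
    have h1 : ((∫ x : ℝ, ‖s.eval (x : ℂ)‖ ^ 2 ∂μ : ℝ) : ℂ) = (k : ℂ) := by
      rw [← integral_complex_ofReal]
      simp_rw [hc]
      rw [integral_finsetSum]
      · simp only [hk, Complex.ofReal_sum]
        refine Finset.sum_congr rfl fun i hi => ?_
        rw [integral_finsetSum]
        · simp_rw [integral_const_mul]
          rw [Finset.sum_congr rfl (g := fun j => if i = j then
            (p i).eval z * (starRingEnd ℂ) ((p j).eval z) else 0)]
          · rw [Finset.sum_ite_eq, if_pos hi, mul_comm, ← Complex.normSq_eq_conj_mul_self,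
              Complex.normSq_eq_norm_sq]
          · intro j hj
            rw [hp.orth i (Finset.mem_range.mp hi) j (Finset.mem_range.mp hj)]
            simp
        · intro j _; apply hp.integrable_of_continuousOn; fun_prop
      · intro i _; apply hp.integrable_of_continuousOn; fun_prop
    exact_mod_cast h1
  set D := s /ₘ (X - C z) with hDdef
  have hDdeg : D.degree < N := degree_divByMonic_X_sub_C_lt hsdeg
  have hle := hp.integral_norm_tail_le hz0 (fun j => secondKind μ p z j
    - (k : ℂ)⁻¹ * ∫ y : ℝ, D.eval (y : ℂ) * (p j).eval (y : ℂ) ∂μ)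
  have hkc : (k : ℂ) ≠ 0 := by exact_mod_cast hkpos.ne'
  have heq : ∀ x ∈ Icc (-1 : ℝ) 1, resolventTail μ p N z x
      + ∑ i ∈ Finset.range N, (secondKind μ p z i
        - (k : ℂ)⁻¹ * ∫ y : ℝ, D.eval (y : ℂ) * (p i).eval (y : ℂ) ∂μ) * (p i).eval (x : ℂ)
      = (k : ℂ)⁻¹ * (s.eval (x : ℂ) * (z - (x : ℂ))⁻¹) := by
    intro x hx
    have hexp := congrArg (eval (x : ℂ)) (hp.expansion le_rfl hDdeg)
    simp only [eval_finsetSum, eval_mul, eval_C] at hexp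
    have hD : D.eval (x : ℂ) * (z - x) = s.eval z - s.eval (x : ℂ) := eval_divByMonic_mul
    simp only [sub_mul, Finset.sum_sub_distrib, mul_assoc, ← Finset.mul_sum]
    rw [← hexp, resolventTail]
    have hne := hz0 x hx
    rw [hsz] at hD
    field_simp
    linear_combination -hD
  have hbound : ∫ x : ℝ, ‖resolventTail μ p N z x‖ ^ 2 ∂μ ≤ (1 / (k ^ 2 * d ^ 2)) * k := by
    refine hle.trans ?_
    rw [integral_congr_Icc hp.supp (fun x hx => by rw [heq x hx])]
    calc _ ≤ ∫ x : ℝ, (1 / (k ^ 2 * d ^ 2)) * ‖s.eval (x : ℂ)‖ ^ 2 ∂μ := by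
          apply integral_mono_ae
          · apply integrable_of_continuousOn_Icc hp.supp; fun_prop
          · apply integrable_of_continuousOn_Icc hp.supp; fun_prop
          · filter_upwards [ae_mem_Icc hp.supp] with x hx
            have h1 := hz x hx
            have h2 : ‖z - (x : ℂ)‖⁻¹ ≤ d⁻¹ := inv_anti₀ hd h1
            have h3 : ‖(k : ℂ)‖ = k := by simp [abs_of_pos hkpos]
            rw [norm_mul, norm_mul, norm_inv, norm_inv, h3, mul_pow, mul_pow]
            calc _ ≤ (k⁻¹) ^ 2 * (‖s.eval (x : ℂ)‖ ^ 2 * (d⁻¹) ^ 2) := by gcongr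
              _ = _ := by field_simp
      _ = _ := by rw [integral_const_mul, hsnorm]
  calc _ ≤ k * ((1 / (k ^ 2 * d ^ 2)) * k) := by gcongr
    _ = _ := by field_simp

/-- The loop equation with its error term. -/
theorem norm_loop_le (hp : IsOrthoSystem μ N p) {q : ℝ → ℂ} (hq : ContinuousOn q (Icc (-1) 1))
    (hqμ : HasPearson μ q) {z : ℂ} {d : ℝ} (hd : 0 < d)
    (hz : ∀ x ∈ Icc (-1 : ℝ) 1, d ≤ ‖z - (x : ℂ)‖) :
    ‖(z ^ 2 - 1) * (∑ i ∈ Finset.range N,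
          ∫ x : ℝ, (p i).eval (x : ℂ) ^ 2 * (z - (x : ℂ))⁻¹ ∂μ) ^ 2 - (N : ℂ) ^ 2
        - ∑ i ∈ Finset.range N, ∫ x : ℝ, q x * (p i).eval (x : ℂ) ^ 2 * (z - (x : ℂ))⁻¹ ∂μ‖
      ≤ ‖z ^ 2 - 1‖ / d ^ 2 := by
  have hz0 : ∀ x ∈ Icc (-1 : ℝ) 1, z - (x : ℂ) ≠ 0 := fun x hx =>
    norm_pos_iff.mp (hd.trans_le (hz x hx))
  have hW : ∀ i, ∫ x : ℝ, (p i).eval (x : ℂ) ^ 2 * (z - (x : ℂ))⁻¹ ∂μ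
      = resolventEntry μ p z i i := by
    intro i; unfold resolventEntry; simp only [sq]
  simp_rw [hW]
  have h1 := hp.sq_trace_sub_sum_sq hz0 le_rfl
  have h2 := Finset.sum_eq_zero fun i (hi : i ∈ Finset.range N) =>
    hp.loop_summand hq hqμ hz0 (Finset.mem_range.mp hi)
  have h3 := Finset.sum_congr rfl fun i (hi : i ∈ Finset.range N) =>
    hp.variance_row hz0 (Finset.mem_range.mp hi)
  rw [Finset.sum_sub_distrib, ← Finset.sum_mul] at h3
  have hG : ∑ i ∈ Finset.range N, (2 * (i : ℂ)) = (N : ℂ) ^ 2 - N := by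
    rw [← Finset.mul_sum]
    clear h1 h2 h3
    induction N with
    | zero => simp
    | succ n ih =>
      rw [Finset.sum_range_succ, mul_add]
      have := ih (hp := ⟨hp.supp, fun i hi => hp.degree_eq i (by omega),
        fun i hi => hp.conj_eval i (by omega),
        fun i hi j hj => hp.orth i (by omega) j (by omega)⟩)
      rw [this]; push_cast; ring
  simp only [Finset.sum_add_distrib, ← Finset.mul_sum] at h2
  rw [← Finset.mul_sum] at hG
  simp only [Finset.sum_const, Finset.card_range, nsmul_eq_mul, mul_one] at h2
  set E2 := ∫ x : ℝ, resolventTail μ p N z x ^ 2 ∂μ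
  have hkey : (z ^ 2 - 1) * (∑ i ∈ Finset.range N, resolventEntry μ p z i i) ^ 2 - (N : ℂ) ^ 2
        - ∑ i ∈ Finset.range N, ∫ x : ℝ, q x * (p i).eval (x : ℂ) ^ 2 * (z - (x : ℂ))⁻¹ ∂μ
      = -(z ^ 2 - 1) * ((∑ i ∈ Finset.range N, (p i).eval z ^ 2) * E2) := by
    linear_combination (z ^ 2 - 1) * h1 - h2 - (z ^ 2 - 1) * h3 + hG
  rw [hkey, norm_mul, norm_neg, div_eq_mul_one_div]
  refine mul_le_mul_of_nonneg_left ?_ (norm_nonneg _)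
  refine le_trans ?_ (hp.kernel_mul_integral_tail_le hd hz)
  rw [norm_mul]
  gcongr
  · refine (norm_sum_le _ _).trans (le_of_eq ?_)
    simp
  · refine (norm_integral_le_integral_norm _).trans (le_of_eq ?_)
    simp

end IsOrthoSystem

open Real (circleAverage)

/-- The Joukowski map. -/
def joukowski (ζ : ℂ) : ℂ := (ζ + ζ⁻¹) / 2

theorem circleAverage_eq_of_differentiableAt_annulus {F : ℂ → ℂ} {a b : ℝ} (ha : 0 < a)
    (hab : a ≤ b) (hF : ∀ ζ : ℂ, a ≤ ‖ζ‖ → ‖ζ‖ ≤ b → DifferentiableAt ℂ F ζ) :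
    circleAverage F 0 b = circleAverage F 0 a := by
  rw [Real.circleAverage_eq_circleIntegral (by linarith : b ≠ 0),
    Real.circleAverage_eq_circleIntegral ha.ne']
  congr 1
  refine circleIntegral_sub_center_inv_smul_eq_of_differentiable_on_annulus_off_countable ha hab
    countable_empty (fun ζ hζ => ?_) (fun ζ hζ => ?_)
  · simp only [Set.mem_sdiff, Metric.mem_closedBall, Metric.mem_ball, dist_zero_right, not_lt] at hζ
    exact (hF ζ hζ.2 hζ.1).continuousAt.continuousWithinAt
  · simp only [Set.mem_sdiff, Metric.mem_closedBall, Metric.mem_ball, dist_zero_right, not_le,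
      mem_empty_iff_false, not_false_eq_true, and_true] at hζ
    exact hF ζ hζ.2.le hζ.1.le

theorem circleAverage_eq_zero_of_odd {F : ℂ → ℂ} (hF : ∀ ζ : ℂ, ‖ζ‖ = 1 → F ζ⁻¹ = -F ζ) :
    circleAverage F 0 1 = 0 := by
  have h1 : circleAverage (fun ζ => F ζ⁻¹) 0 1 = circleAverage (fun ζ => -F ζ) 0 1 := by
    refine Real.circleAverage_congr_sphere fun ζ hζ => ?_
    simpa using hF ζ (by simpa using hζ)
  rw [Real.circleAverage_zero_one_congr_inv] at h1
  have h2 : circleAverage (fun ζ => -F ζ) 0 1 = -circleAverage F 0 1 := by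
    simp [Real.circleAverage_def, intervalIntegral.integral_neg]
  rw [h2] at h1
  exact self_eq_neg.mp h1

theorem circleAverage_comp_inv {F : ℂ → ℂ} {ρ : ℝ} :
    circleAverage (fun w => F w⁻¹) 0 ρ⁻¹ = circleAverage F 0 ρ := by
  rw [Real.circleAverage_eq_circleAverage_zero_one, ← Real.circleAverage_zero_one_congr_inv,
    Real.circleAverage_eq_circleAverage_zero_one (R := ρ)]
  congr 1
  ext z
  simp [mul_comm]

theorem norm_circleAverage_le {F : ℂ → ℂ} {ρ C : ℝ} (hρ : 0 < ρ)
    (hF : ∀ ζ : ℂ, ‖ζ‖ = ρ → ‖F ζ‖ ≤ C) : ‖circleAverage F 0 ρ‖ ≤ C := by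
  rw [Real.circleAverage_def, norm_smul]
  have h1 := intervalIntegral.norm_integral_le_of_norm_le_const (a := 0) (b := 2 * Real.pi)
    (f := fun θ => F (circleMap 0 ρ θ)) (C := C)
    (fun θ _ => hF _ (by simp [hρ.le]))
  have hpi := Real.pi_pos
  rw [sub_zero, abs_of_pos (by positivity)] at h1
  rw [norm_inv, Real.norm_of_nonneg (by positivity : (0 : ℝ) ≤ 2 * Real.pi),
    inv_mul_le_iff₀ (by positivity)]
  linarith

theorem joukowski_inv (ζ : ℂ) : joukowski ζ⁻¹ = joukowski ζ := by
  simp [joukowski, add_comm]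

theorem differentiableAt_joukowski {ζ : ℂ} (hζ : ζ ≠ 0) : DifferentiableAt ℂ joukowski ζ := by
  unfold joukowski
  fun_prop (disch := assumption)

theorem joukowski_circleMap (θ : ℝ) : joukowski (circleMap 0 1 θ) = (Real.cos θ : ℂ) := by
  rw [joukowski, circleMap_zero_inv, circleMap_zero, circleMap_zero, Complex.ofReal_cos, Complex.cos]
  push_cast
  simp

theorem exists_joukowski_eq {x : ℝ} (hx : x ∈ Icc (-1 : ℝ) 1) :
    ∃ u : ℂ, ‖u‖ = 1 ∧ joukowski u = x :=
  ⟨circleMap 0 1 (Real.arccos x), by simp, by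
    rw [joukowski_circleMap, Real.cos_arccos hx.1 hx.2]⟩

theorem joukowski_sub {ζ u : ℂ} (hζ : ζ ≠ 0) (hu : u ≠ 0) :
    joukowski ζ - joukowski u = (ζ - u) * (ζ - u⁻¹) / (2 * ζ) := by
  unfold joukowski
  field_simp
  ring

theorem le_norm_joukowski_sub {ζ ξ : ℂ} {r ρ : ℝ} (hζ : ‖ζ‖ = r) (hξ : ‖ξ‖ = ρ) (hρ : 1 ≤ ρ)
    (hr : ρ < r) : (r - ρ) ^ 2 / (2 * r) ≤ ‖joukowski ζ - joukowski ξ‖ := by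
  have hζ0 : ζ ≠ 0 := by rw [← norm_pos_iff, hζ]; linarith
  have hξ0 : ξ ≠ 0 := by rw [← norm_pos_iff, hξ]; linarith
  have hr0 : 0 < r := by linarith
  rw [joukowski_sub hζ0 hξ0, norm_div, norm_mul, norm_mul, hζ, Complex.norm_ofNat, sq]
  have h1 : r - ρ ≤ ‖ζ - ξ‖ := by rw [← hζ, ← hξ]; exact norm_sub_norm_le _ _
  have h2 : r - ρ ≤ ‖ζ - ξ⁻¹‖ := by
    have := norm_sub_norm_le ζ ξ⁻¹
    rw [norm_inv, hζ, hξ] at this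
    have h3 : ρ⁻¹ ≤ 1 := inv_le_one_of_one_le₀ hρ
    linarith
  gcongr

theorem le_norm_joukowski_sub_ofReal {ζ : ℂ} {ρ x : ℝ} (hζ : ‖ζ‖ = ρ) (hρ : 1 < ρ)
    (hx : x ∈ Icc (-1 : ℝ) 1) : (ρ - 1) ^ 2 / (2 * ρ) ≤ ‖joukowski ζ - x‖ := by
  obtain ⟨u, hu, hux⟩ := exists_joukowski_eq hx
  rw [← hux]
  exact le_norm_joukowski_sub hζ hu le_rfl hρ

theorem joukowski_sub_ne_zero {ζ : ℂ} {x : ℝ} (hζ : 1 < ‖ζ‖)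
    (hx : x ∈ Icc (-1 : ℝ) 1) : joukowski ζ - x ≠ 0 := by
  have h := le_norm_joukowski_sub_ofReal rfl hζ hx
  rw [← norm_pos_iff]
  refine lt_of_lt_of_le ?_ h
  have : 0 < ‖ζ‖ - 1 := by linarith
  positivity

/-- The kernel representing point evaluation on `[-1,1]` by a circle average. -/
def evalKernel (ζ : ℂ) (x : ℝ) : ℂ := (ζ - ζ⁻¹) / 2 * (joukowski ζ - x)⁻¹

theorem circleAverage_evalKernel {ρ x : ℝ} (hρ : 1 < ρ) (hx : x ∈ Icc (-1 : ℝ) 1) :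
    circleAverage (fun ζ => evalKernel ζ x) 0 ρ = 1 := by
  have hne : ∀ w : ℂ, ‖w‖ < 1 → 1 - 2 * x * w + w ^ 2 ≠ 0 := by
    intro w hw h0
    by_cases hw0 : w = 0
    · simp [hw0] at h0
    · have h1 : 1 < ‖w⁻¹‖ := by
        rw [norm_inv]; exact (one_lt_inv₀ (norm_pos_iff.mpr hw0)).mpr hw
      refine joukowski_sub_ne_zero h1 hx ?_
      rw [joukowski]
      field_simp
      linear_combination h0
  have hρ1 : ρ⁻¹ < 1 := inv_lt_one_of_one_lt₀ hρ
  have hρ0 : 0 < ρ⁻¹ := by positivity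
  have h1 : circleAverage (fun w : ℂ => (1 - w ^ 2) / (1 - 2 * x * w + w ^ 2)) 0 ρ⁻¹ = 1 := by
    have hd : ∀ w ∈ Metric.closedBall (0 : ℂ) |ρ⁻¹|,
        DifferentiableAt ℂ (fun w : ℂ => (1 - w ^ 2) / (1 - 2 * x * w + w ^ 2)) w := by
      intro w hw
      rw [abs_of_pos hρ0, mem_closedBall_zero_iff] at hw
      have := hne w (by linarith)
      fun_prop (disch := assumption)
    rw [circleAverage_of_differentiable_on_off_countable countable_empty
      (fun w hw => (hd w hw).continuousAt.continuousWithinAt)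
      (fun w hw => hd w (Metric.ball_subset_closedBall hw.1))]
    simp
  rw [← h1, ← circleAverage_comp_inv]
  refine Real.circleAverage_congr_sphere fun w hw => ?_
  rw [abs_of_pos hρ0, mem_sphere_zero_iff_norm] at hw
  have hw0 : w ≠ 0 := by rw [← norm_pos_iff, hw]; exact hρ0
  have := hne w (by linarith)
  have h2 : joukowski w⁻¹ - x = (1 - 2 * x * w + w ^ 2) / (2 * w) := by
    rw [joukowski]; field_simp; ring
  simp only [evalKernel, h2]
  field_simp

theorem circleAverage_mul_evalKernel {V : Set ℂ} (hV : IsOpen V) {f : ℂ → ℂ}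
    (hf : DifferentiableOn ℂ f V) {ρ x : ℝ} (hρ : 1 < ρ)
    (hρV : ∀ ζ : ℂ, 1 ≤ ‖ζ‖ → ‖ζ‖ ≤ ρ → joukowski ζ ∈ V) (hx : x ∈ Icc (-1 : ℝ) 1) :
    circleAverage (fun ζ => f (joukowski ζ) * evalKernel ζ x) 0 ρ = f x := by
  have hxV : (x : ℂ) ∈ V := by
    obtain ⟨u, hu, hux⟩ := exists_joukowski_eq hx
    rw [← hux]
    exact hρV u hu.ge (by linarith)
  have hk : DifferentiableOn ℂ (dslope f x) V :=
    (Complex.differentiableOn_dslope (hV.mem_nhds hxV)).mpr hf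
  set G : ℂ → ℂ := fun ζ => dslope f x (joukowski ζ) * ((ζ - ζ⁻¹) / 2) with hG
  have hGd : ∀ ζ : ℂ, 1 ≤ ‖ζ‖ → ‖ζ‖ ≤ ρ → DifferentiableAt ℂ G ζ := by
    intro ζ h1 h2
    have hζ : ζ ≠ 0 := by rw [← norm_pos_iff]; linarith
    have h3 : DifferentiableAt ℂ (dslope f x) (joukowski ζ) :=
      hk.differentiableAt (hV.mem_nhds (hρV ζ h1 h2))
    have h4 : DifferentiableAt ℂ (fun ζ => dslope f x (joukowski ζ)) ζ :=
      h3.comp ζ (differentiableAt_joukowski hζ)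
    exact h4.mul (by fun_prop (disch := assumption))
  have hGavg : circleAverage G 0 ρ = 0 := by
    rw [circleAverage_eq_of_differentiableAt_annulus one_pos hρ.le hGd]
    refine circleAverage_eq_zero_of_odd fun ζ _ => ?_
    simp only [hG, joukowski_inv, inv_inv]
    ring
  have hsplit : circleAverage (fun ζ => f (joukowski ζ) * evalKernel ζ x) 0 ρ
      = circleAverage (fun ζ => f x • evalKernel ζ x + G ζ) 0 ρ := by
    refine Real.circleAverage_congr_sphere fun ζ hζ => ?_
    rw [abs_of_pos (by linarith), mem_sphere_zero_iff_norm] at hζ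
    have h1 := joukowski_sub_ne_zero (hζ ▸ hρ) hx
    have h2 := sub_smul_dslope f (x : ℂ) (joukowski ζ)
    simp only [smul_eq_mul] at h2
    have h3 : f (joukowski ζ) = f x + (joukowski ζ - x) * dslope f x (joukowski ζ) := by
      rw [h2]; ring
    simp only [h3, hG, evalKernel, smul_eq_mul]
    field_simp
  have hcK : CircleIntegrable (fun ζ => evalKernel ζ x) 0 ρ := by
    refine ContinuousOn.circleIntegrable (by linarith) fun ζ hζ => ?_
    rw [mem_sphere_zero_iff_norm] at hζ
    have h1 := joukowski_sub_ne_zero (hζ ▸ hρ) hx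
    have hζ0 : ζ ≠ 0 := by rw [← norm_pos_iff]; linarith
    have h2 := differentiableAt_joukowski hζ0
    refine ContinuousAt.continuousWithinAt (DifferentiableAt.continuousAt (𝕜 := ℂ) ?_)
    unfold evalKernel
    fun_prop (disch := assumption)
  have hcG : CircleIntegrable G 0 ρ := by
    refine ContinuousOn.circleIntegrable (by linarith) fun ζ hζ => ?_
    rw [mem_sphere_zero_iff_norm] at hζ
    exact (hGd ζ (by linarith) hζ.le).continuousAt.continuousWithinAt
  rw [hsplit, Real.circleAverage_fun_add (hcK.const_fun_smul) hcG, hGavg,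
    Real.circleAverage_fun_smul, circleAverage_evalKernel hρ hx]
  simp

open Real (circleAverage)

/-- The resolvent of a measure in the Joukowski variable, multiplied by `√(z²-1)`. -/
def joukowskiResolvent (M : Measure ℝ) (ζ : ℂ) : ℂ :=
  (ζ - ζ⁻¹) / 2 * ∫ x : ℝ, (joukowski ζ - x)⁻¹ ∂M

section

variable {M : Measure ℝ}

theorem continuous_joukowski_circleMap {ρ : ℝ} (hρ : 0 < ρ) :
    Continuous fun θ : ℝ => joukowski (circleMap 0 ρ θ) := by
  unfold joukowski
  have h (θ : ℝ) : circleMap 0 ρ θ ≠ 0 := circleMap_ne_center hρ.ne'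
  fun_prop (disch := assumption)

theorem continuousOn_evalKernel {ρ : ℝ} (hρ : 1 < ρ) :
    ContinuousOn (fun y : ℝ × ℝ => evalKernel (circleMap 0 ρ y.1) y.2)
      (univ ×ˢ Icc (-1 : ℝ) 1) := by
  have h (θ : ℝ) : circleMap 0 ρ θ ≠ 0 := circleMap_ne_center (by linarith)
  have h1 := continuous_joukowski_circleMap (by linarith : 0 < ρ)
  unfold evalKernel
  refine ContinuousOn.mul (Continuous.continuousOn (by fun_prop (disch := simp [h])))
    (ContinuousOn.inv₀ (Continuous.continuousOn
      ((h1.comp continuous_fst).sub (by fun_prop))) ?_)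
  intro y hy
  exact joukowski_sub_ne_zero (by simpa [abs_of_pos (by linarith : 0 < ρ)] using hρ) hy.2

theorem integral_eq_circleAverage [IsFiniteMeasure M]
    (hM : M.restrict (Icc (-1) 1) = M) {V : Set ℂ} (hV : IsOpen V)
    {f : ℂ → ℂ} (hf : DifferentiableOn ℂ f V) {ρ : ℝ} (hρ : 1 < ρ)
    (hρV : ∀ ζ : ℂ, 1 ≤ ‖ζ‖ → ‖ζ‖ ≤ ρ → joukowski ζ ∈ V) :
    ∫ x : ℝ, f x ∂M =
      circleAverage (fun ζ => f (joukowski ζ) * joukowskiResolvent M ζ) 0 ρ := by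
  have hρ0 : 0 < ρ := by linarith
  have hfc : Continuous fun θ : ℝ => f (joukowski (circleMap 0 ρ θ)) :=
    hf.continuousOn.comp_continuous (continuous_joukowski_circleMap hρ0)
      fun θ => hρV _ (by simpa [abs_of_pos hρ0] using hρ.le) (by simp [abs_of_pos hρ0])
  have hInt : Integrable (Function.uncurry fun (θ x : ℝ) =>
      f (joukowski (circleMap 0 ρ θ)) * evalKernel (circleMap 0 ρ θ) x)
      ((volume.restrict (Ioc 0 (2 * Real.pi))).prod M) := by
    rw [← hM, Measure.prod_restrict]
    have hcont : ContinuousOn (Function.uncurry fun (θ x : ℝ) =>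
        f (joukowski (circleMap 0 ρ θ)) * evalKernel (circleMap 0 ρ θ) x)
        (Icc 0 (2 * Real.pi) ×ˢ Icc (-1 : ℝ) 1) :=
      ContinuousOn.mul (Continuous.continuousOn (hfc.comp continuous_fst))
        ((continuousOn_evalKernel hρ).mono (by gcongr; exact subset_univ _))
    refine IntegrableOn.mono_set (hcont.integrableOn_compact (isCompact_Icc.prod isCompact_Icc)) ?_
    gcongr
    exact Ioc_subset_Icc_self
  have h1 : ∫ x : ℝ, f x ∂M = ∫ x : ℝ, ((2 * Real.pi)⁻¹ • ∫ θ in Ioc 0 (2 * Real.pi),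
      f (joukowski (circleMap 0 ρ θ)) * evalKernel (circleMap 0 ρ θ) x) ∂M := by
    refine integral_congr_Icc hM fun x hx => ?_
    rw [← circleAverage_mul_evalKernel hV hf hρ hρV hx, Real.circleAverage_def,
      intervalIntegral.integral_of_le Real.two_pi_pos.le]
  have hswap := integral_integral_swap hInt
  rw [h1, integral_smul, ← hswap, Real.circleAverage_def,
    intervalIntegral.integral_of_le Real.two_pi_pos.le]
  simp only [evalKernel, joukowskiResolvent, integral_const_mul]

theorem re_mul_inv_nonneg {a b : ℂ} (h : 0 ≤ (a * (starRingEnd ℂ) b).re) : 0 ≤ (a * b⁻¹).re := by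
  rw [Complex.inv_def, ← mul_assoc, Complex.re_mul_ofReal]
  exact mul_nonneg h (inv_nonneg.mpr (Complex.normSq_nonneg _))

theorem evalKernel_re_nonneg {ζ : ℂ} {x : ℝ} (hζ : 1 < ‖ζ‖) (hx : x ∈ Icc (-1 : ℝ) 1) :
    0 ≤ (evalKernel ζ x).re := by
  refine re_mul_inv_nonneg ?_
  set ρ := ‖ζ‖ with hρ
  have hρ0 : 0 < ρ := by linarith
  have hsq : ρ ^ 2 = ζ.re ^ 2 + ζ.im ^ 2 := by
    rw [hρ, ← Complex.normSq_eq_norm_sq, Complex.normSq_apply]; ring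
  have hi : ζ⁻¹ = (starRingEnd ℂ) ζ * ((ρ ^ 2)⁻¹ : ℝ) := by
    rw [Complex.inv_def, Complex.normSq_eq_norm_sq]
  have hre : ζ⁻¹.re = ζ.re * (ρ ^ 2)⁻¹ := by rw [hi, Complex.re_mul_ofReal, Complex.conj_re]
  have him : ζ⁻¹.im = -(ζ.im * (ρ ^ 2)⁻¹) := by
    rw [hi, Complex.im_mul_ofReal, Complex.conj_im, neg_mul]
  have key : ((ζ - ζ⁻¹) / 2 * (starRingEnd ℂ) (joukowski ζ - x)).re
      = (1 - (ρ ^ 2)⁻¹) * (ρ ^ 2 + 1 - 2 * x * ζ.re) / 4 := by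
    have : ρ ^ 2 * (ρ ^ 2)⁻¹ = 1 := by field_simp
    simp only [joukowski, Complex.mul_re, map_sub, Complex.sub_re, Complex.conj_re, Complex.sub_im,
      Complex.conj_im, Complex.div_ofNat_re, Complex.div_ofNat_im, Complex.add_re, Complex.add_im,
      Complex.conj_ofReal, Complex.ofReal_re, Complex.ofReal_im, hre, him]
    linear_combination (-(1 - ((ρ ^ 2)⁻¹) ^ 2) / 4) * hsq + (1 - (ρ ^ 2)⁻¹) / 4 * this
  rw [key]
  have hr : |ζ.re| ≤ ρ := Complex.abs_re_le_norm ζ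
  have hxr : x * ζ.re ≤ ρ := by
    have h1 : |x * ζ.re| ≤ 1 * ρ := by
      rw [abs_mul]; exact mul_le_mul (abs_le.mpr hx) hr (abs_nonneg _) zero_le_one
    linarith [le_abs_self (x * ζ.re)]
  have h1 : (ρ ^ 2)⁻¹ ≤ 1 := inv_le_one_of_one_le₀ (by nlinarith)
  have h2 : 0 ≤ ρ ^ 2 + 1 - 2 * x * ζ.re := by nlinarith [sq_nonneg (ρ - 1)]
  have h3 : 0 ≤ 1 - (ρ ^ 2)⁻¹ := by linarith
  positivity

theorem joukowskiResolvent_re_nonneg [IsFiniteMeasure M]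
    (hM : M.restrict (Icc (-1) 1) = M) {ζ : ℂ} (hζ : 1 < ‖ζ‖) :
    0 ≤ (joukowskiResolvent M ζ).re := by
  have hi : Integrable (fun x : ℝ => evalKernel ζ x) M := by
    refine integrable_of_continuousOn_Icc hM ?_
    unfold evalKernel
    exact continuousOn_const.mul (ContinuousOn.inv₀ (by fun_prop)
      fun x hx => joukowski_sub_ne_zero hζ hx)
  have h1 : joukowskiResolvent M ζ = ∫ x : ℝ, evalKernel ζ x ∂M := by
    simp only [joukowskiResolvent, evalKernel, integral_const_mul]
  have h2 : (∫ x : ℝ, evalKernel ζ x ∂M).re = ∫ x : ℝ, (evalKernel ζ x).re ∂M :=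
    (integral_re hi).symm
  rw [h1, h2]
  refine integral_nonneg_of_ae ?_
  filter_upwards [ae_mem_Icc hM] with x hx
  exact evalKernel_re_nonneg hζ hx

theorem le_norm_joukowskiResolvent_add [IsFiniteMeasure M]
    (hM : M.restrict (Icc (-1) 1) = M) {ζ : ℂ} (hζ : 1 < ‖ζ‖)
    (N : ℕ) : (N : ℝ) ≤ ‖joukowskiResolvent M ζ + N‖ := by
  refine le_trans ?_ (Complex.re_le_norm _)
  have := joukowskiResolvent_re_nonneg hM hζ
  simp
  linarith

theorem joukowski_sq_sub_one {ζ : ℂ} (hζ : ζ ≠ 0) :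
    joukowski ζ ^ 2 - 1 = ((ζ - ζ⁻¹) / 2) ^ 2 := by
  rw [joukowski]; field_simp; ring

theorem joukowskiResolvent_sq {ζ : ℂ} (hζ : ζ ≠ 0) :
    joukowskiResolvent M ζ ^ 2
      = (joukowski ζ ^ 2 - 1) * (∫ x : ℝ, (joukowski ζ - x)⁻¹ ∂M) ^ 2 := by
  rw [joukowski_sq_sub_one hζ, joukowskiResolvent, mul_pow]

theorem norm_joukowski_sq_sub_one_le {ζ : ℂ} (hζ : 1 ≤ ‖ζ‖) :
    ‖joukowski ζ ^ 2 - 1‖ ≤ ‖ζ‖ ^ 2 := by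
  rw [joukowski_sq_sub_one (by rw [← norm_pos_iff]; linarith), norm_pow]
  gcongr
  rw [norm_div, Complex.norm_ofNat, div_le_iff₀ (by norm_num)]
  have h1 := norm_sub_le ζ ζ⁻¹
  rw [norm_inv] at h1
  have h2 : ‖ζ‖⁻¹ ≤ 1 := inv_le_one_of_one_le₀ hζ
  linarith

theorem norm_integral_mul_inv_le [IsFiniteMeasure M]
    (hM : M.restrict (Icc (-1) 1) = M) {N : ℕ}
    (hmass : M.real univ = N) {F : ℝ → ℂ} {K : ℝ} (hF : ∀ x ∈ Icc (-1 : ℝ) 1, ‖F x‖ ≤ K) :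
    ‖∫ x : ℝ, F x ∂M‖ ≤ K * N := by
  rw [← hmass]
  refine norm_integral_le_of_norm_le_const ?_
  filter_upwards [ae_mem_Icc hM] with x hx using hF x hx

/-- The loop equation with controlled error for a measure of mass `N`. -/
def LoopBound (M : Measure ℝ) (N : ℕ) (q : ℂ → ℂ) : Prop :=
  ∀ (z : ℂ) (d : ℝ), 0 < d → (∀ x ∈ Icc (-1 : ℝ) 1, d ≤ ‖z - (x : ℂ)‖) →
    ‖(z ^ 2 - 1) * (∫ x : ℝ, (z - x)⁻¹ ∂M) ^ 2 - (N : ℂ) ^ 2 - ∫ x : ℝ, q x * (z - x)⁻¹ ∂M‖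
      ≤ ‖z ^ 2 - 1‖ / d ^ 2

theorem LoopBound.norm_sq_sub_le {N : ℕ} {q : ℂ → ℂ} (h : LoopBound M N q) {ζ : ℂ} {ρ : ℝ}
    (hρ : 1 < ρ) (hζ : ‖ζ‖ = ρ) :
    ‖joukowskiResolvent M ζ ^ 2 - (N : ℂ) ^ 2 - ∫ x : ℝ, q x * (joukowski ζ - x)⁻¹ ∂M‖
      ≤ ρ ^ 2 / ((ρ - 1) ^ 2 / (2 * ρ)) ^ 2 := by
  have hρ1 : 0 < ρ - 1 := by linarith
  have hd : 0 < (ρ - 1) ^ 2 / (2 * ρ) := by positivity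
  have h1 := h (joukowski ζ) _ hd fun x hx => le_norm_joukowski_sub_ofReal hζ hρ hx
  rw [← joukowskiResolvent_sq (by rw [← norm_pos_iff]; linarith)] at h1
  refine h1.trans ?_
  gcongr
  rw [← hζ]
  exact norm_joukowski_sq_sub_one_le (by linarith)

theorem LoopBound.norm_sub_le [IsFiniteMeasure M]
    (hM : M.restrict (Icc (-1) 1) = M) {N : ℕ} (hN : 1 ≤ N)
    (hmass : M.real univ = N) {q : ℂ → ℂ} (h : LoopBound M N q) {K : ℝ}
    (hK : ∀ x ∈ Icc (-1 : ℝ) 1, ‖q x‖ ≤ K) {ζ : ℂ} {ρ : ℝ} (hρ : 1 < ρ) (hζ : ‖ζ‖ = ρ) :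
    ‖joukowskiResolvent M ζ - N‖
      ≤ K / ((ρ - 1) ^ 2 / (2 * ρ)) + ρ ^ 2 / ((ρ - 1) ^ 2 / (2 * ρ)) ^ 2 := by
  have hρ1 : 0 < ρ - 1 := by linarith
  set d := (ρ - 1) ^ 2 / (2 * ρ) with hd'
  have hd : 0 < d := by positivity
  have h1 := h.norm_sq_sub_le hρ hζ
  have hK0 : 0 ≤ K := (norm_nonneg _).trans (hK 0 (by simp))
  have h2 : ‖∫ x : ℝ, q x * (joukowski ζ - x)⁻¹ ∂M‖ ≤ K / d * N := by
    refine norm_integral_mul_inv_le hM hmass fun x hx => ?_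
    rw [norm_mul, norm_inv, div_eq_mul_inv]
    gcongr
    · exact hK x hx
    · exact le_norm_joukowski_sub_ofReal hζ hρ hx
  have h3 : ‖joukowskiResolvent M ζ ^ 2 - (N : ℂ) ^ 2‖ ≤ K / d * N + ρ ^ 2 / d ^ 2 := by
    have := norm_add_le (joukowskiResolvent M ζ ^ 2 - (N : ℂ) ^ 2 -
      ∫ x : ℝ, q x * (joukowski ζ - x)⁻¹ ∂M) (∫ x : ℝ, q x * (joukowski ζ - x)⁻¹ ∂M)
    rw [sub_add_cancel] at this
    linarith
  have h4 := le_norm_joukowskiResolvent_add hM (hζ ▸ hρ) N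
  rw [sq_sub_sq, norm_mul] at h3
  have hN' : (1 : ℝ) ≤ N := by exact_mod_cast hN
  have h5 : (N : ℝ) * ‖joukowskiResolvent M ζ - N‖ ≤ N * (K / d + ρ ^ 2 / d ^ 2) := by
    calc (N : ℝ) * ‖joukowskiResolvent M ζ - N‖
        ≤ ‖joukowskiResolvent M ζ + N‖ * ‖joukowskiResolvent M ζ - N‖ := by gcongr
      _ ≤ K / d * N + ρ ^ 2 / d ^ 2 * 1 := by linarith
      _ ≤ K / d * N + ρ ^ 2 / d ^ 2 * N := by gcongr
      _ = _ := by ring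
  exact le_of_mul_le_mul_left h5 (by linarith)

end

open Real (circleAverage)

section

variable {M : Measure ℝ}

theorem continuousOn_joukowski_sphere {ρ : ℝ} (hρ : 0 < ρ) :
    ContinuousOn joukowski (Metric.sphere 0 ρ) := by
  intro ζ hζ
  rw [mem_sphere_zero_iff_norm] at hζ
  exact (differentiableAt_joukowski
    (by rw [← norm_pos_iff, hζ]; exact hρ)).continuousAt.continuousWithinAt

theorem continuousOn_joukowskiResolvent [IsFiniteMeasure M]
    (hM : M.restrict (Icc (-1) 1) = M) {ρ : ℝ} (hρ : 1 < ρ) :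
    ContinuousOn (joukowskiResolvent M) (Metric.sphere 0 ρ) := by
  have hρ1 : 0 < ρ - 1 := by linarith
  have hne : ∀ ζ ∈ Metric.sphere (0 : ℂ) ρ, ζ ≠ 0 := by
    intro ζ hζ
    rw [mem_sphere_zero_iff_norm] at hζ
    rw [← norm_pos_iff]; linarith
  have h1 : ContinuousOn (fun ζ : ℂ => (ζ - ζ⁻¹) / 2) (Metric.sphere 0 ρ) :=
    (continuousOn_id.sub (continuousOn_id.inv₀ hne)).div_const _
  refine h1.mul (continuousOn_of_dominated (bound := fun _ => ((ρ - 1) ^ 2 / (2 * ρ))⁻¹)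
    ?_ ?_ (integrable_const _) ?_)
  · intro ζ hζ
    rw [mem_sphere_zero_iff_norm] at hζ
    refine (integrable_of_continuousOn_Icc hM ?_).aestronglyMeasurable
    exact ContinuousOn.inv₀ (by fun_prop) fun x hx => joukowski_sub_ne_zero (hζ ▸ hρ) hx
  · intro ζ hζ
    rw [mem_sphere_zero_iff_norm] at hζ
    filter_upwards [ae_mem_Icc hM] with x hx
    rw [norm_inv]
    gcongr
    exact le_norm_joukowski_sub_ofReal hζ hρ hx
  · filter_upwards [ae_mem_Icc hM] with x hx
    refine ContinuousOn.inv₀ ((continuousOn_joukowski_sphere (by linarith)).sub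
      continuousOn_const) fun ζ hζ => ?_
    rw [mem_sphere_zero_iff_norm] at hζ
    exact joukowski_sub_ne_zero (hζ ▸ hρ) hx

theorem continuousOn_comp_joukowski {V : Set ℂ} {f : ℂ → ℂ}
    (hf : DifferentiableOn ℂ f V) {ρ : ℝ} (hρ : 1 < ρ)
    (hρV : ∀ ζ : ℂ, 1 ≤ ‖ζ‖ → ‖ζ‖ ≤ ρ → joukowski ζ ∈ V) :
    ContinuousOn (fun ζ => f (joukowski ζ)) (Metric.sphere 0 ρ) := by
  refine hf.continuousOn.comp (continuousOn_joukowski_sphere (by linarith)) fun ζ hζ => ?_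
  rw [mem_sphere_zero_iff_norm] at hζ
  exact hρV ζ (by linarith) hζ.le

theorem circleAverage_const_mul' {F : ℂ → ℂ} {ρ : ℝ} (a : ℂ) :
    circleAverage (fun ζ => a * F ζ) 0 ρ = a * circleAverage F 0 ρ := by
  simpa using Real.circleAverage_fun_smul (a := a) (f := F) (c := 0) (R := ρ)

theorem norm_integral_sub_le [IsFiniteMeasure M] (hM : M.restrict (Icc (-1) 1) = M)
    {V : Set ℂ} (hV : IsOpen V) {f : ℂ → ℂ} (hf : DifferentiableOn ℂ f V) {ρ : ℝ} (hρ : 1 < ρ)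
    (hρV : ∀ ζ : ℂ, 1 ≤ ‖ζ‖ → ‖ζ‖ ≤ ρ → joukowski ζ ∈ V) {N : ℕ} {S C : ℝ}
    (hS : ∀ ζ : ℂ, ‖ζ‖ = ρ → ‖f (joukowski ζ)‖ ≤ S)
    (hC : ∀ ζ : ℂ, ‖ζ‖ = ρ → ‖joukowskiResolvent M ζ - N‖ ≤ C) :
    ‖∫ x : ℝ, f x ∂M - N * circleAverage (fun ζ => f (joukowski ζ)) 0 ρ‖ ≤ S * C := by
  have hρ0 : 0 ≤ ρ := by linarith
  have h1 := continuousOn_comp_joukowski hf hρ hρV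
  have h2 : CircleIntegrable (fun ζ => f (joukowski ζ) * joukowskiResolvent M ζ) 0 ρ :=
    ContinuousOn.circleIntegrable hρ0 (h1.mul (continuousOn_joukowskiResolvent hM hρ))
  have h3 : CircleIntegrable (fun ζ => (N : ℂ) * f (joukowski ζ)) 0 ρ :=
    ContinuousOn.circleIntegrable hρ0 (continuousOn_const.mul h1)
  rw [integral_eq_circleAverage hM hV hf hρ hρV, ← circleAverage_const_mul',
    ← Real.circleAverage_fun_sub h2 h3]
  refine norm_circleAverage_le (by linarith) fun ζ hζ => ?_
  have : f (joukowski ζ) * joukowskiResolvent M ζ - N * f (joukowski ζ)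
      = f (joukowski ζ) * (joukowskiResolvent M ζ - N) := by ring
  rw [this, norm_mul]
  have hS0 : 0 ≤ S := (norm_nonneg _).trans (hS ζ hζ)
  gcongr
  · exact hS ζ hζ
  · exact hC ζ hζ

/-- The equilibrium average of `q(x)/(z-x)` in the Joukowski variable. -/
def equilibriumTransform (q : ℂ → ℂ) (ρ : ℝ) (ζ : ℂ) : ℂ :=
  circleAverage (fun ξ => q (joukowski ξ) * (joukowski ζ - joukowski ξ)⁻¹) 0 ρ

theorem joukowski_sub_joukowski_ne_zero {ζ ξ : ℂ} (hξ : 1 ≤ ‖ξ‖) (h : ‖ξ‖ < ‖ζ‖) :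
    joukowski ζ - joukowski ξ ≠ 0 := by
  have h1 := le_norm_joukowski_sub rfl rfl hξ h
  rw [← norm_pos_iff]
  refine lt_of_lt_of_le ?_ h1
  have : 0 < ‖ζ‖ - ‖ξ‖ := by linarith
  have : 0 < ‖ζ‖ := by linarith
  positivity

theorem circleIntegrable_equilibriumTransform {V : Set ℂ} {g q : ℂ → ℂ}
    (hg : DifferentiableOn ℂ g V) (hq : DifferentiableOn ℂ q V) {ρ r : ℝ} (hρ : 1 < ρ)
    (hr : ρ < r) (hrV : ∀ ζ : ℂ, 1 ≤ ‖ζ‖ → ‖ζ‖ ≤ r → joukowski ζ ∈ V) :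
    CircleIntegrable (fun ζ => g (joukowski ζ) * equilibriumTransform q ρ ζ) 0 r := by
  have hρ0 : 0 < ρ := by linarith
  have hr0 : 0 < r := by linarith
  have hgc : Continuous fun θ : ℝ => g (joukowski (circleMap 0 r θ)) :=
    hg.continuousOn.comp_continuous (continuous_joukowski_circleMap hr0)
      fun θ => hrV _ (by rw [norm_circleMap_zero, abs_of_pos hr0]; linarith)
        (by rw [norm_circleMap_zero, abs_of_pos hr0])
  have hqc : Continuous fun θ : ℝ => q (joukowski (circleMap 0 ρ θ)) :=
    hq.continuousOn.comp_continuous (continuous_joukowski_circleMap hρ0)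
      fun θ => hrV _ (by rw [norm_circleMap_zero, abs_of_pos hρ0]; linarith)
        (by rw [norm_circleMap_zero, abs_of_pos hρ0]; linarith)
  refine Continuous.intervalIntegrable (hgc.mul (Continuous.const_smul
    (intervalIntegral.continuous_parametric_intervalIntegral_of_continuous' ?_ _ _) _)) _ _
  refine Continuous.mul (hqc.comp continuous_snd) (Continuous.inv₀
    (((continuous_joukowski_circleMap hr0).comp continuous_fst).sub
      ((continuous_joukowski_circleMap hρ0).comp continuous_snd)) fun y => ?_)
  refine joukowski_sub_joukowski_ne_zero ?_ ?_ <;>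
  simp only [norm_circleMap_zero, abs_of_pos hρ0, abs_of_pos hr0] <;> linarith

theorem equilibriumTransform_add_mul {V : Set ℂ} {q₀ q₁ : ℂ → ℂ}
    (hq₀ : DifferentiableOn ℂ q₀ V) (hq₁ : DifferentiableOn ℂ q₁ V) {ρ r : ℝ} (hρ : 1 < ρ)
    (hr : ρ < r) (hrV : ∀ ζ : ℂ, 1 ≤ ‖ζ‖ → ‖ζ‖ ≤ r → joukowski ζ ∈ V) (t : ℂ) {ζ : ℂ}
    (hζ : ‖ζ‖ = r) :
    equilibriumTransform (fun z => q₀ z + t * q₁ z) ρ ζ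
      = equilibriumTransform q₀ ρ ζ + t * equilibriumTransform q₁ ρ ζ := by
  have hρ0 : 0 ≤ ρ := by linarith
  have hinv : ContinuousOn (fun ξ => (joukowski ζ - joukowski ξ)⁻¹) (Metric.sphere 0 ρ) := by
    refine ContinuousOn.inv₀ (continuousOn_const.sub
      (continuousOn_joukowski_sphere (by linarith))) fun ξ hξ => ?_
    rw [mem_sphere_zero_iff_norm] at hξ
    exact joukowski_sub_joukowski_ne_zero (by linarith) (by linarith)
  have hci {q : ℂ → ℂ} (hq : DifferentiableOn ℂ q V) : CircleIntegrable
      (fun ξ => q (joukowski ξ) * (joukowski ζ - joukowski ξ)⁻¹) 0 ρ :=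
    ContinuousOn.circleIntegrable hρ0 ((continuousOn_comp_joukowski hq hρ
      fun ξ h1 h2 => hrV ξ h1 (by linarith)).mul hinv)
  have h2 : CircleIntegrable
      (fun ξ => t * (q₁ (joukowski ξ) * (joukowski ζ - joukowski ξ)⁻¹)) 0 ρ := by
    simpa using (hci hq₁).const_fun_smul (a := t)
  simp only [equilibriumTransform]
  rw [← circleAverage_const_mul', ← Real.circleAverage_fun_add (hci hq₀) h2]
  congr 1
  ext ξ
  ring

theorem norm_sub_half_le {Ω m I : ℂ} {N : ℕ} (hN : 1 ≤ N) {A B E F : ℝ}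
    (hΩ : (N : ℝ) ≤ ‖Ω + N‖) (hm : ‖m‖ ≤ A) (hε : ‖Ω - N‖ ≤ B) (hI : ‖I - N * m‖ ≤ E)
    (hloop : ‖Ω ^ 2 - (N : ℂ) ^ 2 - I‖ ≤ F) :
    ‖Ω - N - m / 2‖ ≤ (A * B / 2 + E + F) / N := by
  have hN0 : (0 : ℝ) < N := by exact_mod_cast hN
  have key : (Ω - N - m / 2) * (Ω + N)
      = -(m * (Ω - N)) / 2 + (I - N * m) + (Ω ^ 2 - (N : ℂ) ^ 2 - I) := by ring
  have h1 : ‖(Ω - N - m / 2) * (Ω + N)‖ ≤ A * B / 2 + E + F := by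
    rw [key]
    refine (norm_add_le _ _).trans (add_le_add ((norm_add_le _ _).trans (add_le_add ?_ hI)) hloop)
    rw [norm_div, norm_neg, norm_mul, Complex.norm_ofNat]
    have hA : 0 ≤ A := (norm_nonneg _).trans hm
    gcongr
  rw [norm_mul] at h1
  rw [le_div_iff₀ hN0]
  exact (mul_le_mul_of_nonneg_left hΩ (norm_nonneg _)).trans h1

theorem exists_linear_statistic_expansion {U : Set ℂ} (hU : IsOpen U) {r : ℝ} (hr : 1 < r)
    (hrU : ∀ ζ : ℂ, 1 ≤ ‖ζ‖ → ‖ζ‖ ≤ r → joukowski ζ ∈ U) {g q₀ q₁ : ℂ → ℂ}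
    (hg : DifferentiableOn ℂ g U) (hq₀ : DifferentiableOn ℂ q₀ U)
    (hq₁ : DifferentiableOn ℂ q₁ U) :
    ∃ b₀ b₁ : ℂ, ∃ C : ℝ, ∀ N : ℕ, 1 ≤ N → ∀ t ∈ Icc (0 : ℝ) 1, ∀ (M : Measure ℝ),
      IsFiniteMeasure M → M.restrict (Icc (-1) 1) = M → M.real univ = N →
      LoopBound M N (fun z => q₀ z + t * q₁ z) →
      ‖∫ x : ℝ, g x ∂M - N * circleAverage (fun ζ => g (joukowski ζ)) 0 1 - (b₀ + t * b₁)‖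
        ≤ C / N := by
  obtain ⟨ρ, hρ, hρr⟩ := exists_between hr
  have hρU : ∀ ζ : ℂ, 1 ≤ ‖ζ‖ → ‖ζ‖ ≤ ρ → joukowski ζ ∈ U :=
    fun ζ h1 h2 => hrU ζ h1 (by linarith)
  have hcomp : IsCompact {ζ : ℂ | 1 ≤ ‖ζ‖ ∧ ‖ζ‖ ≤ r} := by
    refine (isCompact_closedBall (0 : ℂ) r).of_isClosed_subset ?_ fun ζ hζ => by
      simpa using hζ.2
    exact (isClosed_le continuous_const continuous_norm).inter
      (isClosed_le continuous_norm continuous_const)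
  have hbdd {q : ℂ → ℂ} (hq : DifferentiableOn ℂ q U) :
      ∃ K, ∀ ζ : ℂ, 1 ≤ ‖ζ‖ → ‖ζ‖ ≤ r → ‖q (joukowski ζ)‖ ≤ K := by
    obtain ⟨K, hK⟩ := hcomp.exists_bound_of_continuousOn (f := fun ζ => q (joukowski ζ))
      (hq.continuousOn.comp (fun ζ hζ => (differentiableAt_joukowski
        (by rw [← norm_pos_iff]; linarith [hζ.1])).continuousAt.continuousWithinAt)
        fun ζ hζ => hrU ζ hζ.1 hζ.2)
    exact ⟨K, fun ζ h1 h2 => hK ζ ⟨h1, h2⟩⟩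
  obtain ⟨Kg, hKg⟩ := hbdd hg
  obtain ⟨K₀, hK₀⟩ := hbdd hq₀
  obtain ⟨K₁, hK₁⟩ := hbdd hq₁
  set K := K₀ + K₁ with hKdef
  set B : ℝ → ℝ := fun ρ => K / ((ρ - 1) ^ 2 / (2 * ρ)) + ρ ^ 2 / ((ρ - 1) ^ 2 / (2 * ρ)) ^ 2
  set δ := (r - ρ) ^ 2 / (2 * r) with hδdef
  have hδ : 0 < δ := by
    have : 0 < r - ρ := by linarith
    positivity
  refine ⟨circleAverage (fun ζ => g (joukowski ζ) * equilibriumTransform q₀ ρ ζ) 0 r / 2,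
    circleAverage (fun ζ => g (joukowski ζ) * equilibriumTransform q₁ ρ ζ) 0 r / 2,
    Kg * (K / δ * B r / 2 + K / δ * B ρ + r ^ 2 / ((r - 1) ^ 2 / (2 * r)) ^ 2), ?_⟩
  intro N hN t ht M hMfin hM hmass hloop
  have hN0 : (0 : ℝ) < N := by exact_mod_cast hN
  set q : ℂ → ℂ := fun z => q₀ z + t * q₁ z with hqdef
  have hq : DifferentiableOn ℂ q U := hq₀.add (hq₁.const_mul _)
  have hKq : ∀ ζ : ℂ, 1 ≤ ‖ζ‖ → ‖ζ‖ ≤ r → ‖q (joukowski ζ)‖ ≤ K := by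
    intro ζ h1 h2
    refine (norm_add_le _ _).trans (add_le_add (hK₀ ζ h1 h2) ?_)
    rw [norm_mul, Complex.norm_of_nonneg ht.1]
    have := mul_le_mul_of_nonneg_right ht.2 (norm_nonneg (q₁ (joukowski ζ)))
    linarith [hK₁ ζ h1 h2]
  have hKx : ∀ x ∈ Icc (-1 : ℝ) 1, ‖q x‖ ≤ K := by
    intro x hx
    obtain ⟨u, hu, hux⟩ := exists_joukowski_eq hx
    rw [← hux]
    exact hKq u hu.ge (by linarith)
  have hBρ : ∀ ζ : ℂ, ‖ζ‖ = ρ → ‖joukowskiResolvent M ζ - N‖ ≤ B ρ := fun ζ hζ =>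
    hloop.norm_sub_le hM hN hmass hKx hρ hζ
  have hBr : ∀ ζ : ℂ, ‖ζ‖ = r → ‖joukowskiResolvent M ζ - N‖ ≤ B r := fun ζ hζ =>
    hloop.norm_sub_le hM hN hmass hKx hr hζ
  have hquot : ∀ ζ ξ : ℂ, ‖ζ‖ = r → ‖ξ‖ = ρ →
      ‖q (joukowski ξ) * (joukowski ζ - joukowski ξ)⁻¹‖ ≤ K / δ := by
    intro ζ ξ hζ hξ
    have h1 := hKq ξ (by linarith) (by linarith)
    rw [norm_mul, norm_inv, div_eq_mul_inv]
    have hK0 : 0 ≤ K := (norm_nonneg _).trans h1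
    gcongr
    exact le_norm_joukowski_sub hζ hξ hρ.le hρr
  have hpt : ∀ ζ : ℂ, ‖ζ‖ = r → ‖joukowskiResolvent M ζ - N - equilibriumTransform q ρ ζ / 2‖
      ≤ (K / δ * B r / 2 + K / δ * B ρ + r ^ 2 / ((r - 1) ^ 2 / (2 * r)) ^ 2) / N := by
    intro ζ hζ
    refine norm_sub_half_le hN (le_norm_joukowskiResolvent_add hM (hζ ▸ hr) N) ?_ (hBr ζ hζ) ?_
      (hloop.norm_sq_sub_le hr hζ)
    · exact norm_circleAverage_le (by linarith) fun ξ hξ => hquot ζ ξ hζ hξ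
    · have hVo : IsOpen (U \ {joukowski ζ}) := hU.sdiff isClosed_singleton
      refine norm_integral_sub_le hM hVo (f := fun x => q x * (joukowski ζ - x)⁻¹) ?_ hρ ?_
        (fun ξ hξ => hquot ζ ξ hζ hξ) hBρ
      · refine (hq.mono sdiff_subset).mul (DifferentiableOn.inv (by fun_prop) fun x hx => ?_)
        exact sub_ne_zero.mpr fun h => hx.2 h.symm
      · intro ξ h1 h2
        refine ⟨hρU ξ h1 h2, fun h => ?_⟩
        exact joukowski_sub_joukowski_ne_zero h1 (by linarith) (sub_eq_zero.mpr h.symm)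
  have hAr : circleAverage (fun ζ => g (joukowski ζ)) 0 r
      = circleAverage (fun ζ => g (joukowski ζ)) 0 1 := by
    refine circleAverage_eq_of_differentiableAt_annulus one_pos hr.le fun ζ h1 h2 => ?_
    exact (hg.differentiableAt (hU.mem_nhds (hrU ζ h1 h2))).comp ζ
      (differentiableAt_joukowski (by rw [← norm_pos_iff]; linarith))
  have hr0 : 0 ≤ r := by linarith
  have hgc := continuousOn_comp_joukowski hg hr hrU
  have hI₀ := circleIntegrable_equilibriumTransform hg hq₀ hρ hρr hrU
  have hI₁ := circleIntegrable_equilibriumTransform hg hq₁ hρ hρr hrU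
  have hI := circleIntegrable_equilibriumTransform hg hq hρ hρr hrU
  have hlin : circleAverage (fun ζ => g (joukowski ζ) * equilibriumTransform q ρ ζ) 0 r
      = circleAverage (fun ζ => g (joukowski ζ) * equilibriumTransform q₀ ρ ζ) 0 r
        + t * circleAverage (fun ζ => g (joukowski ζ) * equilibriumTransform q₁ ρ ζ) 0 r := by
    rw [← circleAverage_const_mul', ← Real.circleAverage_fun_add hI₀
      (by simpa using hI₁.const_fun_smul (a := (t : ℂ)))]
    refine Real.circleAverage_congr_sphere fun ζ hζ => ?_
    rw [abs_of_nonneg hr0, mem_sphere_zero_iff_norm] at hζ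
    simp only [hqdef, equilibriumTransform_add_mul hq₀ hq₁ hρ hρr hrU t hζ]
    ring
  have hmain : ∫ x : ℝ, g x ∂M - N * circleAverage (fun ζ => g (joukowski ζ)) 0 1
      - (circleAverage (fun ζ => g (joukowski ζ) * equilibriumTransform q₀ ρ ζ) 0 r / 2
        + t * (circleAverage (fun ζ => g (joukowski ζ) * equilibriumTransform q₁ ρ ζ) 0 r / 2))
      = circleAverage (fun ζ => g (joukowski ζ) *
        (joukowskiResolvent M ζ - N - equilibriumTransform q ρ ζ / 2)) 0 r := by
    have hΩ : CircleIntegrable (fun ζ => g (joukowski ζ) * joukowskiResolvent M ζ) 0 r :=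
      ContinuousOn.circleIntegrable hr0 (hgc.mul (continuousOn_joukowskiResolvent hM hr))
    have hNg : CircleIntegrable (fun ζ => (N : ℂ) * g (joukowski ζ)) 0 r :=
      ContinuousOn.circleIntegrable hr0 (continuousOn_const.mul hgc)
    have hhalf : CircleIntegrable
        (fun ζ => (1 / 2 : ℂ) * (g (joukowski ζ) * equilibriumTransform q ρ ζ)) 0 r := by
      simpa using hI.const_fun_smul (a := (1 / 2 : ℂ))
    have e1 : (circleAverage (fun ζ => g (joukowski ζ) * equilibriumTransform q₀ ρ ζ) 0 r / 2
        + t * (circleAverage (fun ζ => g (joukowski ζ) * equilibriumTransform q₁ ρ ζ) 0 r / 2))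
        = (1 / 2 : ℂ) * circleAverage
          (fun ζ => g (joukowski ζ) * equilibriumTransform q ρ ζ) 0 r := by
      rw [hlin]; ring
    have hdiff : CircleIntegrable (fun ζ => g (joukowski ζ) * joukowskiResolvent M ζ
        - (N : ℂ) * g (joukowski ζ)) 0 r := hΩ.sub hNg
    rw [e1, ← hAr, integral_eq_circleAverage hM hU hg hr hrU, ← circleAverage_const_mul',
      ← circleAverage_const_mul', ← Real.circleAverage_fun_sub hΩ hNg,
      ← Real.circleAverage_fun_sub hdiff hhalf]
    congr 1
    ext ζ
    ring
  rw [hmain, mul_div_assoc]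
  refine norm_circleAverage_le (by linarith) fun ζ hζ => ?_
  rw [norm_mul]
  have h1 := hKg ζ (by linarith) hζ.le
  have hKg0 : 0 ≤ Kg := (norm_nonneg _).trans h1
  gcongr
  exact hpt ζ hζ

theorem exists_annulus_subset {U : Set ℂ} (hU : IsOpen U)
    (hseg : ∀ x ∈ Icc (-1 : ℝ) 1, (x : ℂ) ∈ U) :
    ∃ r : ℝ, 1 < r ∧ ∀ ζ : ℂ, 1 ≤ ‖ζ‖ → ‖ζ‖ ≤ r → joukowski ζ ∈ U := by
  have hcont : ContinuousOn (fun y : ℝ × ℝ => joukowski (circleMap 0 y.1 y.2))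
      (Ioi 0 ×ˢ univ) := by
    intro y hy
    have h1 : circleMap 0 y.1 y.2 ≠ 0 := circleMap_ne_center (ne_of_gt hy.1)
    have h2 : ContinuousAt (fun y : ℝ × ℝ => circleMap 0 y.1 y.2) y :=
      Continuous.continuousAt (by fun_prop)
    exact (ContinuousAt.comp (f := fun y : ℝ × ℝ => circleMap 0 y.1 y.2)
      (differentiableAt_joukowski h1).continuousAt h2).continuousWithinAt
  have hopen := hcont.isOpen_inter_preimage (isOpen_Ioi.prod isOpen_univ) hU
  obtain ⟨u, v, hu, -, hu1, hv, huv⟩ := generalized_tube_lemma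
    (isCompact_singleton (x := (1 : ℝ))) (isCompact_Icc (a := (0 : ℝ)) (b := 2 * Real.pi)) hopen
    (by
      rintro ⟨a, θ⟩ ⟨rfl, -⟩
      refine ⟨⟨by simp, mem_univ _⟩, ?_⟩
      rw [mem_preimage, joukowski_circleMap]
      exact hseg _ ⟨Real.neg_one_le_cos θ, Real.cos_le_one θ⟩)
  obtain ⟨ε, hε, hball⟩ := Metric.isOpen_iff.mp hu 1 (hu1 rfl)
  refine ⟨1 + ε / 2, by linarith, fun ζ h1 h2 => ?_⟩
  obtain ⟨θ, hθ, hθζ⟩ : ∃ θ ∈ Icc (0 : ℝ) (2 * Real.pi), circleMap 0 ‖ζ‖ θ = ζ := by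
    have h3 : ζ ∈ Metric.sphere (0 : ℂ) |‖ζ‖| := by simp
    rw [← image_circleMap_Ioc 0 ‖ζ‖] at h3
    obtain ⟨θ, hθ, hh⟩ := h3
    exact ⟨θ, Ioc_subset_Icc_self hθ, hh⟩
  have := huv (mk_mem_prod (hball (by
    rw [Metric.mem_ball, Real.dist_eq, abs_of_nonneg (by linarith)]; linarith)) (hv hθ))
  have h4 := this.2
  rwa [mem_preimage, hθζ] at h4

end

section

open Polynomial

/-- The Hankel determinant of order `N` of a moment functional. -/
def hankelDet (L : ℝ[X] →ₗ[ℝ] ℝ) (N : ℕ) : ℝ :=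
  (Matrix.of fun j k : Fin N => L (X ^ ((j : ℕ) + (k : ℕ)))).det

/-- The matrix of coefficients of the first `N` polynomials of a family. -/
def coeffMatrix (P : ℕ → ℝ[X]) (N : ℕ) : Matrix (Fin N) (Fin N) ℝ :=
  Matrix.of fun i j => (P i).coeff j

theorem coeffMatrix_mul_hankel_mul (L : ℝ[X] →ₗ[ℝ] ℝ) {P : ℕ → ℝ[X]} {N : ℕ}
    (hP : ∀ i < N, (P i).degree ≤ i) :
    coeffMatrix P N * (Matrix.of fun j k : Fin N => L (X ^ ((j : ℕ) + (k : ℕ)))) *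
      (coeffMatrix P N).transpose = Matrix.of fun i l : Fin N => L (P i * P l) := by
  have hsum (i : Fin N) : P i = ∑ j : Fin N, C ((P i).coeff j) * X ^ (j : ℕ) := by
    have h1 : (P i).natDegree < N :=
      (natDegree_le_of_degree_le (hP i i.2)).trans_lt i.2
    conv_lhs => rw [as_sum_range_C_mul_X_pow' (P i) h1]
    rw [Finset.sum_range]
  ext i l
  conv_rhs => rw [Matrix.of_apply, hsum i, hsum l, Finset.sum_mul_sum]
  simp only [Matrix.mul_apply, Matrix.transpose_apply, Matrix.of_apply, coeffMatrix, map_sum,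
    Finset.sum_mul]
  rw [Finset.sum_comm]
  refine Finset.sum_congr rfl fun j _ => Finset.sum_congr rfl fun k _ => ?_
  have h2 : C ((P i).coeff j) * X ^ (j : ℕ) * (C ((P l).coeff k) * X ^ (k : ℕ))
      = ((P i).coeff j * (P l).coeff k) • X ^ ((j : ℕ) + (k : ℕ)) := by
    rw [smul_eq_C_mul, C_mul, pow_add]; ring
  rw [h2, map_smul, smul_eq_mul]
  ring

theorem sq_det_coeffMatrix_mul_hankelDet (L : ℝ[X] →ₗ[ℝ] ℝ) {P : ℕ → ℝ[X]} {N : ℕ}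
    (hP : ∀ i < N, (P i).degree ≤ i) :
    (coeffMatrix P N).det ^ 2 * hankelDet L N
      = (Matrix.of fun i l : Fin N => L (P i * P l)).det := by
  rw [← coeffMatrix_mul_hankel_mul L hP, Matrix.det_mul, Matrix.det_mul, Matrix.det_transpose,
    hankelDet]
  ring

theorem exists_orthonormal (L : ℝ[X] →ₗ[ℝ] ℝ) (hL : ∀ Q : ℝ[X], Q ≠ 0 → 0 < L (Q * Q)) (N : ℕ) :
    ∃ P : ℕ → ℝ[X], (∀ i < N, (P i).degree = i) ∧
      ∀ i < N, ∀ j < N, L (P i * P j) = if i = j then 1 else 0 := by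
  induction N with
  | zero => exact ⟨fun _ => 0, by simp, by simp⟩
  | succ N ih =>
    obtain ⟨P, hdeg, horth⟩ := ih
    set S : ℝ[X] := ∑ i ∈ Finset.range N, C (L (X ^ N * P i)) * P i with hS
    have hSdeg : S.degree < N := by
      rw [hS]
      refine (degree_sum_le _ _).trans_lt ?_
      rw [Finset.sup_lt_iff (WithBot.bot_lt_coe _)]
      intro i hi
      rw [Finset.mem_range] at hi
      rw [← smul_eq_C_mul]
      refine (degree_smul_le _ _).trans_lt ?_
      rw [hdeg i hi]
      exact_mod_cast hi
    set Q : ℝ[X] := X ^ N - S with hQ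
    have hQdeg : Q.degree = N := by
      rw [hQ, degree_sub_eq_left_of_degree_lt (by rwa [degree_X_pow]), degree_X_pow]
    have hQ0 : Q ≠ 0 := by
      intro h; rw [h] at hQdeg; simp at hQdeg
    have hpos := hL Q hQ0
    have hQP : ∀ j < N, L (Q * P j) = 0 := by
      intro j hj
      have h1 : L (S * P j) = L (X ^ N * P j) := by
        rw [hS, Finset.sum_mul, map_sum]
        have h2 : ∀ i ∈ Finset.range N, L (C (L (X ^ N * P i)) * P i * P j)
            = if i = j then L (X ^ N * P j) else 0 := by
          intro i hi
          rw [mul_assoc, ← smul_eq_C_mul, map_smul, horth i (Finset.mem_range.mp hi) j hj]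
          split_ifs with h <;> simp [h]
        rw [Finset.sum_congr rfl h2, Finset.sum_ite_eq' (Finset.range N) j]
        simp [hj]
      rw [hQ, sub_mul, map_sub, h1, sub_self]
    set c := (√(L (Q * Q)))⁻¹ with hc
    have hc0 : c ≠ 0 := inv_ne_zero (Real.sqrt_pos.mpr hpos).ne'
    have hcc : c * c * L (Q * Q) = 1 := by
      rw [hc, ← mul_inv, Real.mul_self_sqrt hpos.le, inv_mul_cancel₀ hpos.ne']
    refine ⟨fun i => if i = N then C c * Q else P i, fun i hi => ?_, fun i hi j hj => ?_⟩
    · by_cases h : i = N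
      · simp only [h, if_true]
        rw [degree_C_mul hc0, hQdeg]
      · simp only [h, if_false]
        exact hdeg i (by omega)
    · by_cases h : i = N <;> by_cases h' : j = N
      · simp only [h, h', if_true]
        rw [show C c * Q * (C c * Q) = (c * c) • (Q * Q) by rw [smul_eq_C_mul, C_mul]; ring,
          map_smul, smul_eq_mul, hcc]
      · simp only [h, h', if_true, if_false]
        rw [if_neg (by omega), mul_assoc, ← smul_eq_C_mul, map_smul, hQP j (by omega), smul_zero]
      · simp only [h, h', if_true, if_false]
        rw [mul_comm (P i), mul_assoc, ← smul_eq_C_mul, map_smul, hQP i (by omega), smul_zero]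
      · simp only [h, h', if_false]
        exact horth i (by omega) j (by omega)

theorem hankelDet_pos (L : ℝ[X] →ₗ[ℝ] ℝ) (hL : ∀ Q : ℝ[X], Q ≠ 0 → 0 < L (Q * Q)) (N : ℕ) :
    0 < hankelDet L N := by
  obtain ⟨P, hdeg, horth⟩ := exists_orthonormal L hL N
  have h1 := sq_det_coeffMatrix_mul_hankelDet L (N := N) fun i hi => (hdeg i hi).le
  have h2 : (Matrix.of fun i l : Fin N => L (P i * P l)) = 1 := by
    ext i l
    simp [horth i i.2 l l.2, Matrix.one_apply, Fin.ext_iff]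
  rw [h2, Matrix.det_one] at h1
  by_contra! h3
  have := mul_nonpos_of_nonneg_of_nonpos (sq_nonneg (coeffMatrix P N).det) h3
  linarith

theorem hasDerivAt_det_of_eq_one {ι : Type*} [Fintype ι] [DecidableEq ι]
    {A : ℝ → Matrix ι ι ℝ} {A' : Matrix ι ι ℝ} {t : ℝ}
    (hA : ∀ i j, HasDerivAt (fun s => A s i j) (A' i j) t) (h1 : A t = 1) :
    HasDerivAt (fun s => (A s).det) A'.trace t := by
  have h2 : HasDerivAt (fun s => (A s).det) (∑ σ : Equiv.Perm ι, (Equiv.Perm.sign σ : ℝ) *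
      ∑ i, (∏ j ∈ Finset.univ.erase i, A t (σ j) j) • A' (σ i) i) t := by
    simp only [Matrix.det_apply']
    exact HasDerivAt.fun_sum fun σ _ => (HasDerivAt.fun_finsetProd
      fun i _ => hA (σ i) i).const_mul _
  convert h2 using 1
  rw [Finset.sum_eq_single 1]
  · simp [h1, Matrix.trace]
  · intro σ _ hσ
    rw [Finset.sum_eq_zero, mul_zero]
    intro i _
    obtain ⟨j, hji, hj⟩ : ∃ j, j ≠ i ∧ σ j ≠ j := by
      by_contra! hcon
      refine hσ (Equiv.ext fun j => ?_)
      by_cases hj : j = i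
      · subst hj
        by_contra hne
        exact hne (σ.injective (by simpa using hcon _ hne))
      · simpa using hcon j hj
    rw [Finset.prod_eq_zero (Finset.mem_erase.mpr ⟨hji, Finset.mem_univ _⟩), zero_smul]
    rw [h1, Matrix.one_apply_ne hj]
  · simp

theorem hasDerivAt_log_hankelDet {L : ℝ → ℝ[X] →ₗ[ℝ] ℝ} {L' : ℝ[X] → ℝ} {t : ℝ}
    (hL : ∀ Q : ℝ[X], Q ≠ 0 → 0 < L t (Q * Q))
    (hL' : ∀ Q, HasDerivAt (fun s => L s Q) (L' Q) t) {N : ℕ} {P : ℕ → ℝ[X]}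
    (hdeg : ∀ i < N, (P i).degree = i)
    (horth : ∀ i < N, ∀ j < N, L t (P i * P j) = if i = j then 1 else 0) :
    HasDerivAt (fun s => Real.log (hankelDet (L s) N))
      (∑ i ∈ Finset.range N, L' (P i * P i)) t := by
  have h1 (s : ℝ) := sq_det_coeffMatrix_mul_hankelDet (L s) (N := N) fun i hi => (hdeg i hi).le
  have hone : (Matrix.of fun i l : Fin N => L t (P i * P l)) = 1 := by
    ext i l
    simp [horth i i.2 l l.2, Matrix.one_apply, Fin.ext_iff]
  have h2 := hasDerivAt_det_of_eq_one
    (A := fun s => Matrix.of fun i l : Fin N => L s (P i * P l))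
    (A' := Matrix.of fun i l : Fin N => L' (P i * P l)) (fun i j => hL' _) hone
  simp only [← h1] at h2
  have h3 := h1 t
  rw [hone, Matrix.det_one] at h3
  have hc : (coeffMatrix P N).det ^ 2 ≠ 0 := by
    intro h; rw [h, zero_mul] at h3; exact zero_ne_one h3
  have h4 : HasDerivAt (fun s => hankelDet (L s) N)
      (hankelDet (L t) N * ∑ i ∈ Finset.range N, L' (P i * P i)) t := by
    have h5 := h2.const_mul (hankelDet (L t) N)
    simp only [← mul_assoc, mul_comm (hankelDet (L t) N) ((coeffMatrix P N).det ^ 2), h3,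
      one_mul] at h5
    simpa [Matrix.trace, Finset.sum_range] using h5
  have h6 := hankelDet_pos (L t) hL N
  have h7 := h4.log h6.ne'
  rwa [mul_div_cancel_left₀ _ h6.ne'] at h7

end

section

open Polynomial

variable {μ : Measure ℝ}

theorem restrict_withDensity_Icc (hμ : μ.restrict (Icc (-1) 1) = μ) (φ : ℝ → ENNReal) :
    (μ.withDensity φ).restrict (Icc (-1) 1) = μ.withDensity φ := by
  rw [restrict_withDensity measurableSet_Icc, hμ]

theorem aemeasurable_of_continuousOn_Icc (hμ : μ.restrict (Icc (-1) 1) = μ) {φ : ℝ → ℝ}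
    (hφ : ContinuousOn φ (Icc (-1) 1)) : AEMeasurable φ μ := by
  rw [← hμ]
  exact hφ.aemeasurable measurableSet_Icc

theorem isFiniteMeasure_withDensity_of_continuousOn [IsFiniteMeasure μ]
    (hμ : μ.restrict (Icc (-1) 1) = μ) {φ : ℝ → ℝ} (hφ : ContinuousOn φ (Icc (-1) 1)) :
    IsFiniteMeasure (μ.withDensity fun x => ENNReal.ofReal (φ x)) :=
  isFiniteMeasure_withDensity_ofReal (integrable_of_continuousOn_Icc hμ hφ).2

theorem integral_withDensity_of_continuousOn {E : Type*} [NormedAddCommGroup E]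
    [NormedSpace ℝ E] (hμ : μ.restrict (Icc (-1) 1) = μ) {φ : ℝ → ℝ}
    (hφ : ContinuousOn φ (Icc (-1) 1)) (hφ0 : ∀ x ∈ Icc (-1 : ℝ) 1, 0 ≤ φ x) (f : ℝ → E) :
    ∫ x, f x ∂(μ.withDensity fun x => ENNReal.ofReal (φ x)) = ∫ x, φ x • f x ∂μ := by
  rw [integral_withDensity_eq_integral_toReal_smul₀
    (aemeasurable_of_continuousOn_Icc hμ hφ).ennreal_ofReal (by simp)]
  refine integral_congr_Icc hμ fun x hx => ?_
  rw [ENNReal.toReal_ofReal (hφ0 x hx)]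

/-- Integration of polynomials against a finite measure carried by `[-1,1]`. -/
def momentFunctional (μ : Measure ℝ) [IsFiniteMeasure μ] (hμ : μ.restrict (Icc (-1) 1) = μ) :
    ℝ[X] →ₗ[ℝ] ℝ where
  toFun Q := ∫ x, Q.eval x ∂μ
  map_add' P Q := by
    simp only [eval_add]
    exact integral_add (integrable_of_continuousOn_Icc hμ P.continuousOn)
      (integrable_of_continuousOn_Icc hμ Q.continuousOn)
  map_smul' c Q := by
    simp only [eval_smul, smul_eq_mul, RingHom.id_apply]
    exact integral_const_mul _ _

/-- The exponential deformation of a measure. -/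
def expTilt (μ : Measure ℝ) (g : ℝ → ℝ) (t : ℝ) : Measure ℝ :=
  μ.withDensity fun x => ENNReal.ofReal (Real.exp (t * g x))

variable {g : ℝ → ℝ}

theorem continuousOn_exp_mul (hg : ContinuousOn g (Icc (-1) 1)) (t : ℝ) :
    ContinuousOn (fun x => Real.exp (t * g x)) (Icc (-1) 1) := by fun_prop

theorem isFiniteMeasure_expTilt [IsFiniteMeasure μ] (hμ : μ.restrict (Icc (-1) 1) = μ)
    (hg : ContinuousOn g (Icc (-1) 1)) (t : ℝ) : IsFiniteMeasure (expTilt μ g t) :=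
  isFiniteMeasure_withDensity_of_continuousOn hμ (continuousOn_exp_mul hg t)

theorem expTilt_restrict (hμ : μ.restrict (Icc (-1) 1) = μ) (t : ℝ) :
    (expTilt μ g t).restrict (Icc (-1) 1) = expTilt μ g t :=
  restrict_withDensity_Icc hμ _

theorem integral_expTilt {E : Type*} [NormedAddCommGroup E] [NormedSpace ℝ E]
    (hμ : μ.restrict (Icc (-1) 1) = μ) (hg : ContinuousOn g (Icc (-1) 1)) (t : ℝ) (f : ℝ → E) :
    ∫ x, f x ∂(expTilt μ g t) = ∫ x, Real.exp (t * g x) • f x ∂μ :=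
  integral_withDensity_of_continuousOn hμ (continuousOn_exp_mul hg t)
    (fun _ _ => (Real.exp_pos _).le) f

/-- The moment functional of the exponential deformation of a measure. -/
def tiltedFunctional (μ : Measure ℝ) [IsFiniteMeasure μ] (hμ : μ.restrict (Icc (-1) 1) = μ)
    (g : ℝ → ℝ) (hg : ContinuousOn g (Icc (-1) 1)) (t : ℝ) : ℝ[X] →ₗ[ℝ] ℝ :=
  haveI := isFiniteMeasure_expTilt hμ hg t
  momentFunctional (expTilt μ g t) (expTilt_restrict hμ t)

variable [IsFiniteMeasure μ]

theorem tiltedFunctional_apply (hμ : μ.restrict (Icc (-1) 1) = μ)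
    (hg : ContinuousOn g (Icc (-1) 1)) (t : ℝ) (Q : ℝ[X]) :
    tiltedFunctional μ hμ g hg t Q = ∫ x, Real.exp (t * g x) * Q.eval x ∂μ :=
  integral_expTilt hμ hg t _

theorem tiltedFunctional_mul_self_pos (hμ : μ.restrict (Icc (-1) 1) = μ)
    (hg : ContinuousOn g (Icc (-1) 1)) (hpos : ∀ Q : ℝ[X], Q ≠ 0 → 0 < ∫ x, (Q * Q).eval x ∂μ)
    (t : ℝ) {Q : ℝ[X]} (hQ : Q ≠ 0) : 0 < tiltedFunctional μ hμ g hg t (Q * Q) := by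
  rw [tiltedFunctional_apply]
  have hc := continuousOn_exp_mul hg t
  obtain ⟨x₀, -, hx₀⟩ := isCompact_Icc.exists_isMinOn (by simp) hc
  have h1 := mul_pos (Real.exp_pos (t * g x₀)) (hpos Q hQ)
  rw [← integral_const_mul] at h1
  refine h1.trans_le (integral_mono_ae ?_ ?_ ?_)
  · exact (integrable_of_continuousOn_Icc hμ (Q * Q).continuousOn).const_mul _
  · exact integrable_of_continuousOn_Icc hμ (hc.mul (Q * Q).continuousOn)
  · filter_upwards [ae_mem_Icc hμ] with x hx
    have h2 : 0 ≤ (Q * Q).eval x := by rw [eval_mul]; exact mul_self_nonneg _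
    exact mul_le_mul_of_nonneg_right (hx₀ hx) h2

theorem hasDerivAt_tiltedFunctional (hμ : μ.restrict (Icc (-1) 1) = μ)
    (hg : ContinuousOn g (Icc (-1) 1)) (t : ℝ) (Q : ℝ[X]) :
    HasDerivAt (fun s => tiltedFunctional μ hμ g hg s Q)
      (∫ x, Real.exp (t * g x) * (g x * Q.eval x) ∂μ) t := by
  simp only [tiltedFunctional_apply]
  obtain ⟨K, hK⟩ := isCompact_Icc.exists_bound_of_continuousOn hg
  have hmeas (s : ℝ) : ContinuousOn (fun x => Real.exp (s * g x) * Q.eval x) (Icc (-1) 1) :=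
    (continuousOn_exp_mul hg s).mul Q.continuousOn
  have hgQ : ContinuousOn (fun x => g x * Q.eval x) (Icc (-1) 1) := hg.mul Q.continuousOn
  refine (hasDerivAt_integral_of_dominated_loc_of_deriv_le
    (F := fun s x => Real.exp (s * g x) * Q.eval x)
    (F' := fun s x => Real.exp (s * g x) * (g x * Q.eval x))
    (bound := fun x => Real.exp ((|t| + 1) * K) * |g x * Q.eval x|)
    (Metric.ball_mem_nhds t one_pos) ?_ ?_ ?_ ?_ ?_ ?_).2
  · exact Eventually.of_forall fun s =>
      (integrable_of_continuousOn_Icc hμ (hmeas s)).aestronglyMeasurable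
  · exact integrable_of_continuousOn_Icc hμ (hmeas t)
  · exact (integrable_of_continuousOn_Icc hμ
      ((continuousOn_exp_mul hg t).mul hgQ)).aestronglyMeasurable
  · filter_upwards [ae_mem_Icc hμ] with x hx s hs
    rw [norm_mul, Real.norm_eq_abs, Real.norm_eq_abs, abs_of_pos (Real.exp_pos _)]
    refine mul_le_mul_of_nonneg_right (Real.exp_le_exp.mpr ?_) (abs_nonneg _)
    have h1 : |s| ≤ |t| + 1 := by
      rw [Metric.mem_ball, Real.dist_eq] at hs
      have := abs_sub_abs_le_abs_sub s t
      linarith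
    calc s * g x ≤ |s * g x| := le_abs_self _
      _ = |s| * |g x| := abs_mul _ _
      _ ≤ (|t| + 1) * K := by
        gcongr
        exact hK x hx
  · exact (integrable_of_continuousOn_Icc hμ hgQ).abs.const_mul _
  · refine Eventually.of_forall fun x s _ => ?_
    have h1 : HasDerivAt (fun s : ℝ => Real.exp (s * g x)) (Real.exp (s * g x) * g x) s := by
      simpa using ((hasDerivAt_id s).mul_const (g x)).exp
    have h2 := h1.mul_const (Q.eval x)
    rwa [mul_assoc] at h2

theorem eval_map_ofReal (P : ℝ[X]) (x : ℝ) :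
    (P.map (algebraMap ℝ ℂ)).eval (x : ℂ) = ((P.eval x : ℝ) : ℂ) := by
  rw [eval_map, ← Complex.coe_algebraMap, eval₂_at_apply]

theorem exists_one_point_measure (hμ : μ.restrict (Icc (-1) 1) = μ)
    (hpos : ∀ Q : ℝ[X], Q ≠ 0 → 0 < ∫ x, (Q * Q).eval x ∂μ)
    (hg : ContinuousOn g (Icc (-1) 1)) (t : ℝ) (N : ℕ) :
    ∃ M : Measure ℝ, IsFiniteMeasure M ∧ M.restrict (Icc (-1) 1) = M ∧ M.real univ = N ∧
      HasDerivAt (fun s => Real.log (hankelDet (tiltedFunctional μ hμ g hg s) N))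
        (∫ x, g x ∂M) t ∧
      ∀ q : ℂ → ℂ, ContinuousOn (fun x : ℝ => q x) (Icc (-1) 1) →
        IsOrthoSystem.HasPearson (expTilt μ g t) (fun x => q x) → LoopBound M N q := by
  have := isFiniteMeasure_expTilt hμ hg t
  have hν := expTilt_restrict (g := g) hμ t
  set ν := expTilt μ g t with hνdef
  have hLpos : ∀ Q : ℝ[X], Q ≠ 0 → 0 < tiltedFunctional μ hμ g hg t (Q * Q) :=
    fun Q hQ => tiltedFunctional_mul_self_pos hμ hg hpos t hQ
  obtain ⟨P, hdeg, horth⟩ := exists_orthonormal _ hLpos N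
  have hL (Q : ℝ[X]) : tiltedFunctional μ hμ g hg t Q = ∫ x, Q.eval x ∂ν := rfl
  set φ : ℝ → ℝ := fun x => ∑ i ∈ Finset.range N, (P i).eval x ^ 2 with hφdef
  have hφ : ContinuousOn φ (Icc (-1) 1) := Continuous.continuousOn
    (continuous_finsetSum _ fun i _ => (P i).continuous.pow 2)
  have hφ0 : ∀ x ∈ Icc (-1 : ℝ) 1, 0 ≤ φ x :=
    fun x _ => Finset.sum_nonneg fun i _ => sq_nonneg _
  have hsys : IsOrthoSystem ν N fun i => (P i).map (algebraMap ℝ ℂ) := by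
    refine ⟨hν, fun i hi => ?_, fun i _ x => ?_, fun i hi j hj => ?_⟩
    · rw [degree_map, hdeg i hi]
    · rw [eval_map_ofReal, conj_ofReal]
    · simp only [eval_map_ofReal]
      have h1 := horth i hi j hj
      rw [hL] at h1
      simp only [eval_mul] at h1
      have h2 : ∫ x, (((P i).eval x * (P j).eval x : ℝ) : ℂ) ∂ν
          = ((if i = j then 1 else 0 : ℝ) : ℂ) := by
        rw [integral_complex_ofReal, h1]
      push_cast at h2
      rw [h2, apply_ite Complex.ofReal, ofReal_one, ofReal_zero]
  set M := ν.withDensity fun x => ENNReal.ofReal (φ x) with hMdef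
  have hMint {E : Type} [NormedAddCommGroup E] [NormedSpace ℝ E] (f : ℝ → E) :
      ∫ x, f x ∂M = ∫ x, φ x • f x ∂ν := integral_withDensity_of_continuousOn hν hφ hφ0 f
  have hMfin : IsFiniteMeasure M := isFiniteMeasure_withDensity_of_continuousOn hν hφ
  have hMC (f : ℝ → ℂ) (hf : ContinuousOn f (Icc (-1) 1)) : ∫ x, f x ∂M
      = ∑ i ∈ Finset.range N, ∫ x : ℝ, ((P i).map (algebraMap ℝ ℂ)).eval (x : ℂ) ^ 2 * f x ∂ν := by
    rw [hMint, ← integral_finsetSum]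
    · congr 1
      ext x
      simp only [hφdef, eval_map_ofReal, real_smul]
      push_cast
      rw [Finset.sum_mul]
    · intro i _
      simp only [eval_map_ofReal]
      refine integrable_of_continuousOn_Icc hν (ContinuousOn.mul ?_ hf)
      exact Continuous.continuousOn (by fun_prop)
  refine ⟨M, hMfin, restrict_withDensity_Icc hν _, ?_, ?_, ?_⟩
  · have h1 : M.real univ = ∫ x, (1 : ℝ) ∂M := by simp
    rw [h1, hMint]
    simp only [smul_eq_mul, mul_one, hφdef]
    rw [integral_finsetSum _ fun i _ => integrable_of_continuousOn_Icc hν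
      (Continuous.continuousOn (by fun_prop))]
    have h2 : ∀ i ∈ Finset.range N, ∫ x, (P i).eval x ^ 2 ∂ν = 1 := by
      intro i hi
      have h3 := horth i (Finset.mem_range.mp hi) i (Finset.mem_range.mp hi)
      rw [hL] at h3
      simpa [sq] using h3
    rw [Finset.sum_congr rfl h2]
    simp
  · have h1 := hasDerivAt_log_hankelDet hLpos (fun Q => hasDerivAt_tiltedFunctional hμ hg t Q)
      hdeg horth
    convert h1 using 1
    rw [hMint]
    have h2 : ∀ i ∈ Finset.range N, ∫ x, Real.exp (t * g x) * (g x * (P i * P i).eval x) ∂μ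
        = ∫ x, g x * (P i).eval x ^ 2 ∂ν := by
      intro i _
      rw [hνdef, integral_expTilt hμ hg t]
      simp [sq]
    rw [Finset.sum_congr rfl h2, ← integral_finsetSum _ fun i _ => ?_]
    · congr 1
      ext x
      simp only [hφdef, smul_eq_mul, Finset.sum_mul]
      exact Finset.sum_congr rfl fun i _ => mul_comm _ _
    · exact integrable_of_continuousOn_Icc hν (hg.mul
        (Continuous.continuousOn (by fun_prop)))
  · intro q hq hpear z d hd hz
    have hne : ∀ x ∈ Icc (-1 : ℝ) 1, z - (x : ℂ) ≠ 0 := fun x hx h => by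
      have := hz x hx
      rw [h, norm_zero] at this
      linarith
    have hinv := IsOrthoSystem.continuousOn_inv_sub hne
    have h1 := hsys.norm_loop_le hq hpear hd hz
    have hq' : ContinuousOn (fun x : ℝ => q x * (z - x)⁻¹) (Icc (-1) 1) := hq.mul hinv
    rw [hMC _ hinv, hMC _ hq']
    refine le_of_eq_of_le ?_ h1
    congr 2
    refine Finset.sum_congr rfl fun i _ => integral_congr_ae (Eventually.of_forall fun x => ?_)
    ring

end

section

open Real (circleAverage)
open Polynomial

variable {α β : ℝ}

/-- The Jacobi weight on `(-1,1)`. -/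
def jacobiWeight (α β x : ℝ) : ℝ := (1 - x) ^ α * (1 + x) ^ β

/-- The measure on `[-1,1]` whose density is the Jacobi weight. -/
def jacobiMeasure (α β : ℝ) : Measure ℝ :=
  (volume.restrict (Ioo (-1) 1)).withDensity fun x => ENNReal.ofReal (jacobiWeight α β x)

theorem jacobiWeight_pos {x : ℝ} (hx : x ∈ Ioo (-1 : ℝ) 1) : 0 < jacobiWeight α β x :=
  mul_pos (Real.rpow_pos_of_pos (by linarith [hx.2]) _) (Real.rpow_pos_of_pos (by linarith [hx.1]) _)

theorem intervalIntegrable_jacobiWeight (hα : -1 < α) (hβ : -1 < β) :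
    IntervalIntegrable (jacobiWeight α β) volume (-1) 1 := by
  have h1 : IntervalIntegrable (fun x : ℝ => (1 - x) ^ α) volume 0 1 := by
    have := (intervalIntegral.intervalIntegrable_rpow' (a := 1) (b := 0) hα).comp_sub_left 1
    simpa using this
  have h2 : IntervalIntegrable (fun x : ℝ => (1 + x) ^ β) volume (-1) 0 := by
    have := (intervalIntegral.intervalIntegrable_rpow' (a := 0) (b := 1) hβ).comp_add_left 1
    simpa using this
  refine IntervalIntegrable.trans (b := 0) ?_ ?_
  · refine h2.continuousOn_mul ?_
    rw [uIcc_of_le (by norm_num)]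
    exact ContinuousOn.rpow_const (by fun_prop) fun x hx => Or.inl (by linarith [hx.2])
  · refine h1.mul_continuousOn ?_
    rw [uIcc_of_le (by norm_num)]
    exact ContinuousOn.rpow_const (by fun_prop) fun x hx => Or.inl (by linarith [hx.1])

theorem integrableOn_jacobiWeight (hα : -1 < α) (hβ : -1 < β) :
    IntegrableOn (jacobiWeight α β) (Ioo (-1) 1) volume :=
  (intervalIntegrable_iff_integrableOn_Ioo_of_le (by norm_num)).mp
    (intervalIntegrable_jacobiWeight hα hβ)

theorem isFiniteMeasure_jacobiMeasure (hα : -1 < α) (hβ : -1 < β) :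
    IsFiniteMeasure (jacobiMeasure α β) :=
  isFiniteMeasure_withDensity_ofReal (integrableOn_jacobiWeight hα hβ).2

theorem jacobiMeasure_restrict :
    (jacobiMeasure α β).restrict (Icc (-1) 1) = jacobiMeasure α β := by
  rw [jacobiMeasure, restrict_withDensity measurableSet_Icc, Measure.restrict_restrict
    measurableSet_Icc, inter_eq_self_of_subset_right Ioo_subset_Icc_self]

theorem integral_jacobiMeasure {E : Type*} [NormedAddCommGroup E] [NormedSpace ℝ E] (f : ℝ → E) :
    ∫ x, f x ∂(jacobiMeasure α β) = ∫ x in (-1 : ℝ)..1, jacobiWeight α β x • f x := by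
  have hm : Measurable (jacobiWeight α β) := by unfold jacobiWeight; fun_prop
  rw [jacobiMeasure, integral_withDensity_eq_integral_toReal_smul hm.ennreal_ofReal (by simp),
    intervalIntegral.integral_of_le (by norm_num), integral_Ioc_eq_integral_Ioo]
  refine setIntegral_congr_fun measurableSet_Ioo fun x hx => ?_
  simp only [ENNReal.toReal_ofReal (jacobiWeight_pos hx).le]

theorem integral_mul_self_jacobiMeasure_pos (hα : -1 < α) (hβ : -1 < β) {Q : ℝ[X]} (hQ : Q ≠ 0) :
    0 < ∫ x, (Q * Q).eval x ∂(jacobiMeasure α β) := by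
  rw [integral_jacobiMeasure]
  simp only [smul_eq_mul]
  rw [intervalIntegral.integral_of_le (by norm_num), integral_Ioc_eq_integral_Ioo,
    setIntegral_pos_iff_support_of_nonneg_ae]
  · have h1 : Ioo (-1 : ℝ) 1 \ (Q.roots.toFinset : Set ℝ) ⊆
        (Function.support fun x => jacobiWeight α β x * (Q * Q).eval x) ∩ Ioo (-1) 1 := by
      intro x hx
      refine ⟨?_, hx.1⟩
      have h2 : Q.eval x ≠ 0 := fun h => hx.2 (by simp [hQ, h])
      simp only [Function.mem_support, eval_mul]
      exact mul_ne_zero (jacobiWeight_pos hx.1).ne' (mul_ne_zero h2 h2)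
    refine lt_of_lt_of_le ?_ (measure_mono h1)
    rw [measure_sdiff_null (Finset.measure_zero _ _), Real.volume_Ioo]
    norm_num
  · filter_upwards [ae_restrict_mem measurableSet_Ioo] with x hx
    simp only [eval_mul]
    exact mul_nonneg (jacobiWeight_pos hx).le (mul_self_nonneg _)
  · refine (intervalIntegrable_iff_integrableOn_Ioo_of_le (by norm_num)).mp ?_
    exact (intervalIntegrable_jacobiWeight hα hβ).mul_continuousOn (Q * Q).continuousOn

theorem hasPearson_expTilt_jacobiMeasure (hα : -1 < α) (hβ : -1 < β) {U : Set ℂ} (hU : IsOpen U)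
    (hseg : ∀ x ∈ Icc (-1 : ℝ) 1, (x : ℂ) ∈ U) {G : ℂ → ℂ} (hG : DifferentiableOn ℂ G U)
    {g : ℝ → ℝ} (hg : ContinuousOn g (Icc (-1) 1))
    (hgG : ∀ x ∈ Icc (-1 : ℝ) 1, G x = (g x : ℂ)) (t : ℝ) :
    IsOrthoSystem.HasPearson (expTilt (jacobiMeasure α β) g t)
      (fun x => -α * (1 + (x : ℂ)) + β * (1 - x) + t * ((1 - (x : ℂ) ^ 2) * deriv G x)) := by
  intro f f' hf hf'
  have hfin := isFiniteMeasure_jacobiMeasure hα hβ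
  rw [integral_expTilt jacobiMeasure_restrict hg, integral_jacobiMeasure]
  have hcoe : Continuous fun x : ℝ => (x : ℂ) := continuous_ofReal
  have hGc : ContinuousOn (fun x : ℝ => G x) (Icc (-1) 1) :=
    hG.continuousOn.comp hcoe.continuousOn hseg
  have hG'c : ContinuousOn (fun x : ℝ => deriv G x) (Icc (-1) 1) :=
    (hG.deriv hU).continuousOn.comp hcoe.continuousOn hseg
  have hfc : ContinuousOn f (Icc (-1) 1) :=
    fun x hx => (hf x hx).continuousAt.continuousWithinAt
  set R : ℝ → ℂ := fun x => (1 - (x : ℂ) ^ 2) * f' x - 2 * x * f x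
    + (-α * (1 + (x : ℂ)) + β * (1 - x) + t * ((1 - (x : ℂ) ^ 2) * deriv G x)) * f x with hR
  have hRc : ContinuousOn R (Icc (-1) 1) := by
    simp only [hR]
    fun_prop
  set F : ℝ → ℂ := fun x => (((1 - x) ^ (α + 1) * (1 + x) ^ (β + 1) : ℝ) : ℂ) *
    (cexp (t * G x) * f x) with hF
  have hFc : ContinuousOn F (Icc (-1) 1) := by
    refine ContinuousOn.mul ?_ ?_
    · refine hcoe.comp_continuousOn (ContinuousOn.mul ?_ ?_)
      · exact ContinuousOn.rpow_const (by fun_prop) fun x _ => Or.inr (by linarith)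
      · exact ContinuousOn.rpow_const (by fun_prop) fun x _ => Or.inr (by linarith)
    · exact (continuousOn_const.mul hGc).cexp.mul hfc
  have hderiv : ∀ x ∈ Ioo (-1 : ℝ) 1,
      HasDerivAt F (jacobiWeight α β x • (Real.exp (t * g x) • R x)) x := by
    intro x hx
    have hx' := Ioo_subset_Icc_self hx
    have hm : 0 < 1 - x := by linarith [hx.2]
    have hp : 0 < 1 + x := by linarith [hx.1]
    have h1 : HasDerivAt (fun y : ℝ => (1 - y) ^ (α + 1)) (-1 * (α + 1) * (1 - x) ^ α) x := by
      have := ((hasDerivAt_id x).const_sub 1).rpow_const (p := α + 1) (Or.inl hm.ne')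
      simpa using this
    have h2 : HasDerivAt (fun y : ℝ => (1 + y) ^ (β + 1)) (1 * (β + 1) * (1 + x) ^ β) x := by
      have := ((hasDerivAt_id x).const_add 1).rpow_const (p := β + 1) (Or.inl hp.ne')
      simpa using this
    have h3 : HasDerivAt (fun y : ℝ => G y) (deriv G x) x := by
      have := ((hG x (hseg x hx')).differentiableAt (hU.mem_nhds (hseg x hx'))).hasDerivAt
      exact this.comp_ofReal
    have h4 := ((h1.mul h2).ofReal_comp).mul (((h3.const_mul (t : ℂ)).cexp).mul (hf x hx'))
    refine h4.congr_deriv ?_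
    simp only [hR, real_smul, hgG x hx', jacobiWeight]
    rw [Real.rpow_add_one hm.ne', Real.rpow_add_one hp.ne']
    push_cast
    simp only [Pi.mul_apply, hgG x hx']
    push_cast
    rw [Real.rpow_add_one hm.ne', Real.rpow_add_one hp.ne']
    push_cast
    ring
  have hInt : IntervalIntegrable (fun x => jacobiWeight α β x • (Real.exp (t * g x) • R x))
      volume (-1) 1 := by
    refine IntervalIntegrable.smul_continuousOn (intervalIntegrable_jacobiWeight hα hβ) ?_
    rw [uIcc_of_le (by norm_num)]
    exact (continuousOn_exp_mul hg t).smul hRc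
  rw [intervalIntegral.integral_eq_sub_of_hasDerivAt_of_le (by norm_num) hFc hderiv hInt]
  have e1 : (0 : ℝ) ^ (α + 1) = 0 := Real.zero_rpow (by linarith)
  have e2 : (0 : ℝ) ^ (β + 1) = 0 := Real.zero_rpow (by linarith)
  simp [hF, e1, e2]

theorem exists_log_hankelDet_sub_asymptotics (hα : -1 < α) (hβ : -1 < β)
    {U : Set ℂ} (hU : IsOpen U)
    (hseg : ∀ x ∈ Icc (-1 : ℝ) 1, (x : ℂ) ∈ U) {G : ℂ → ℂ} (hG : DifferentiableOn ℂ G U)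
    {g : ℝ → ℝ} (hg : ContinuousOn g (Icc (-1) 1))
    (hgG : ∀ x ∈ Icc (-1 : ℝ) 1, G x = (g x : ℂ)) [IsFiniteMeasure (jacobiMeasure α β)] :
    ∃ B C : ℝ, ∀ N : ℕ, 1 ≤ N →
      |Real.log (hankelDet (tiltedFunctional (jacobiMeasure α β) jacobiMeasure_restrict g hg 1) N)
        - Real.log (hankelDet
            (tiltedFunctional (jacobiMeasure α β) jacobiMeasure_restrict g hg 0) N)
        - N * (circleAverage (fun ζ => G (joukowski ζ)) 0 1).re - B| ≤ C / N := by
  obtain ⟨r, hr, hrU⟩ := exists_annulus_subset hU hseg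
  obtain ⟨b₀, b₁, C, hC⟩ := exists_linear_statistic_expansion hU hr hrU hG
    (q₀ := fun z => -α * (1 + z) + β * (1 - z)) (q₁ := fun z => (1 - z ^ 2) * deriv G z)
    (by fun_prop) (DifferentiableOn.mul (by fun_prop) (hG.deriv hU))
  refine ⟨b₀.re + b₁.re / 2, C, fun N hN => ?_⟩
  set A := circleAverage (fun ζ => G (joukowski ζ)) 0 1
  set Φ : ℝ → ℝ := fun t => Real.log (hankelDet
    (tiltedFunctional (jacobiMeasure α β) jacobiMeasure_restrict g hg t) N)
  have key : ∀ t ∈ Icc (0 : ℝ) 1, ∃ d : ℝ, HasDerivAt Φ d t ∧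
      |d - N * A.re - (b₀.re + t * b₁.re)| ≤ C / N := by
    intro t ht
    obtain ⟨M, hMfin, hMsupp, hMN, hMd, hML⟩ := exists_one_point_measure
      (jacobiMeasure_restrict (α := α) (β := β))
      (fun Q hQ => integral_mul_self_jacobiMeasure_pos hα hβ hQ) hg t N
    refine ⟨_, hMd, ?_⟩
    have hcoe : Continuous fun x : ℝ => (x : ℂ) := continuous_ofReal
    have hG'c : ContinuousOn (fun x : ℝ => deriv G x) (Icc (-1) 1) :=
      (hG.deriv hU).continuousOn.comp hcoe.continuousOn hseg
    have hL := hML (fun z => -α * (1 + z) + β * (1 - z) + t * ((1 - z ^ 2) * deriv G z))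
      (by fun_prop) (hasPearson_expTilt_jacobiMeasure hα hβ hU hseg hG hg hgG t)
    have h1 := hC N hN t ht M hMfin hMsupp hMN hL
    have h2 : ∫ x : ℝ, G x ∂M = ((∫ x, g x ∂M : ℝ) : ℂ) := by
      rw [← integral_complex_ofReal]
      exact integral_congr_Icc hMsupp hgG
    rw [h2] at h1
    refine le_trans ?_ ((abs_re_le_norm _).trans h1)
    simp
  choose! d hd hdb using key
  have h2 : ∀ t ∈ Icc (0 : ℝ) 1, HasDerivWithinAt
      (fun t => Φ t - (N * A.re * t + b₀.re * t + b₁.re / 2 * t ^ 2))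
      (d t - N * A.re - (b₀.re + t * b₁.re)) (Icc 0 1) t := by
    intro t ht
    have h3 := (hd t ht).sub ((((hasDerivAt_id t).const_mul (N * A.re)).add
      ((hasDerivAt_id t).const_mul b₀.re)).add ((hasDerivAt_pow 2 t).const_mul (b₁.re / 2)))
    refine (h3.congr_deriv ?_).hasDerivWithinAt
    push_cast
    ring
  have h3 := (convex_Icc (0 : ℝ) 1).norm_image_sub_le_of_norm_hasDerivWithin_le h2 hdb
    (left_mem_Icc.mpr zero_le_one) (right_mem_Icc.mpr zero_le_one)
  rw [sub_zero, norm_one, mul_one (C / (N : ℝ)), Real.norm_eq_abs] at h3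
  refine le_of_eq_of_le ?_ h3
  congr 1
  ring

end

section

open Polynomial

theorem sum_neg_one_pow_mul_choose_mul_eval {P : ℝ[X]} {n : ℕ} (hP : P.natDegree < n) :
    ∑ k ∈ Finset.range (n + 1), (-1 : ℝ) ^ (n - k) * n.choose k * P.eval (k : ℝ) = 0 := by
  have h1 := congrFun (Polynomial.fwdDiff_iter_eq_zero_of_degree_lt hP) 0
  rw [fwdDiff_iter_eq_sum_shift] at h1
  simpa using h1

theorem fwdDiff_iter_inv_add {σ : ℝ} (hσ : 0 < σ) (n : ℕ) : ∀ m : ℕ,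
    (fwdDiff 1)^[n] (fun k : ℕ => ((k : ℝ) + σ)⁻¹) m
      = (-1) ^ n * n.factorial / ∏ i ∈ Finset.range (n + 1), (m + σ + i) := by
  induction n with
  | zero => intro m; simp
  | succ n ih =>
    intro m
    rw [Function.iterate_succ_apply', fwdDiff, ih, ih]
    have hm (i : ℕ) : (m : ℝ) + σ + i ≠ 0 := by positivity
    have e1 : ∏ i ∈ Finset.range (n + 1 + 1), ((m : ℝ) + σ + i)
        = (m + σ) * ∏ i ∈ Finset.range (n + 1), (((m + 1 : ℕ) : ℝ) + σ + i) := by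
      rw [Finset.prod_range_succ', mul_comm]
      push_cast
      rw [add_zero]
      congr 1
      exact Finset.prod_congr rfl fun i _ => by ring
    have e2 := Finset.prod_range_succ (fun i : ℕ => (m : ℝ) + σ + i) (n + 1)
    have e3 : ∏ i ∈ Finset.range (n + 1), (((m + 1 : ℕ) : ℝ) + σ + i) ≠ 0 :=
      Finset.prod_ne_zero_iff.mpr fun i _ => by positivity
    have e4 : ∏ i ∈ Finset.range (n + 1), ((m : ℝ) + σ + i) ≠ 0 :=
      Finset.prod_ne_zero_iff.mpr fun i _ => hm i
    have e5 : (m : ℝ) + σ ≠ 0 := by positivity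
    have e6 := hm (n + 1)
    rw [e1] at e2 ⊢
    have e7 : (∏ i ∈ Finset.range (n + 1), (((m + 1 : ℕ) : ℝ) + σ + i))
      = (∏ i ∈ Finset.range (n + 1), ((m : ℝ) + σ + i)) * (m + σ + (n + 1 : ℕ)) / (m + σ) := by
      rw [eq_div_iff e5, ← e2]; ring
    rw [e7, Nat.factorial_succ]
    push_cast at e6 ⊢
    field_simp
    ring

theorem sum_neg_one_pow_mul_choose_mul_inv_add {σ : ℝ} (hσ : 0 < σ) (n : ℕ) :
    ∑ k ∈ Finset.range (n + 1), (-1 : ℝ) ^ (n - k) * n.choose k * ((k : ℝ) + σ)⁻¹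
      = (-1) ^ n * n.factorial / ∏ i ∈ Finset.range (n + 1), (σ + i) := by
  have h1 := fwdDiff_iter_inv_add hσ n 0
  rw [fwdDiff_iter_eq_sum_shift] at h1
  simpa using h1

theorem sum_neg_one_pow_mul_choose_mul_eval_div_add {P : ℝ[X]} {n : ℕ} (hn : 1 ≤ n)
    (hP : P.natDegree ≤ n) {σ : ℝ} (hσ : 0 < σ) :
    ∑ k ∈ Finset.range (n + 1), (-1 : ℝ) ^ (n - k) * n.choose k * (P.eval (k : ℝ) / (k + σ))
      = P.eval (-σ) * ((-1) ^ n * n.factorial / ∏ i ∈ Finset.range (n + 1), (σ + i)) := by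
  set R := P /ₘ (X - C (-σ)) with hR
  have hRdeg : R.natDegree < n := by
    rw [hR, natDegree_divByMonic _ (monic_X_sub_C _), natDegree_X_sub_C]
    omega
  have hdecomp (x : ℝ) : P.eval x = P.eval (-σ) + (x + σ) * R.eval x := by
    have h := congrArg (eval x) (modByMonic_add_div P (X - C (-σ)))
    rw [modByMonic_X_sub_C_eq_C_eval, eval_add, eval_mul, ← hR, eval_C, eval_sub,
      eval_X, eval_C, sub_neg_eq_add] at h
    exact h.symm
  rw [← sum_neg_one_pow_mul_choose_mul_inv_add hσ, Finset.mul_sum,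
    ← add_zero (∑ k ∈ Finset.range (n + 1), _ * (_ * _)),
    ← sum_neg_one_pow_mul_choose_mul_eval hRdeg, ← Finset.sum_add_distrib]
  refine Finset.sum_congr rfl fun k _ => ?_
  have hk : (k : ℝ) + σ ≠ 0 := by positivity
  rw [hdecomp k]
  field_simp

theorem hankelDet_eq_prod (L : ℝ[X] →ₗ[ℝ] ℝ) {c : ℕ → ℕ → ℝ} (hc : ∀ n, c n n ≠ 0)
    (horth : ∀ n, ∀ j < n, ∑ k ∈ Finset.range (n + 1),
      c n k * L ((C (1 / 2) * (X + 1)) ^ (k + j)) = 0) (N : ℕ) :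
    hankelDet L N = ∏ n ∈ Finset.range N, 4 ^ n * (∑ k ∈ Finset.range (n + 1),
      c n k * L ((C (1 / 2) * (X + 1)) ^ (k + n))) / c n n := by
  set Y : ℝ[X] := C (1 / 2) * (X + 1) with hY
  set p : ℕ → ℝ[X] := fun n => ∑ k ∈ Finset.range (n + 1), C (c n k) * Y ^ k with hp
  have hYdeg : Y.natDegree ≤ 1 := by rw [hY]; compute_degree
  have hY1 : Y.coeff 1 = 1 / 2 := by
    rw [hY, coeff_C_mul, coeff_add, coeff_X_one, coeff_one]; norm_num
  have hYpow (k : ℕ) : (Y ^ k).natDegree ≤ k := by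
    simpa using natDegree_pow_le_of_le k hYdeg
  have hpdeg (n : ℕ) : (p n).natDegree ≤ n := by
    refine natDegree_sum_le_of_forall_le _ _ fun k hk => ?_
    refine (natDegree_C_mul_le _ _).trans ((hYpow k).trans ?_)
    rw [Finset.mem_range] at hk; omega
  have hpcoeff (n : ℕ) : (p n).coeff n = c n n * (1 / 2) ^ n := by
    rw [hp]
    simp only [finsetSum_coeff, coeff_C_mul]
    rw [Finset.sum_range_succ, Finset.sum_eq_zero, zero_add]
    · have := coeff_pow_of_natDegree_le (m := n) hYdeg
      rw [mul_one, hY1] at this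
      rw [this]
    · intro k hk
      rw [Finset.mem_range] at hk
      rw [coeff_eq_zero_of_natDegree_lt ((hYpow k).trans_lt hk), mul_zero]
  have hLp (n j : ℕ) : L (p n * Y ^ j) = ∑ k ∈ Finset.range (n + 1), c n k * L (Y ^ (k + j)) := by
    rw [hp, Finset.sum_mul, map_sum]
    refine Finset.sum_congr rfl fun k _ => ?_
    rw [mul_assoc, ← pow_add, ← smul_eq_C_mul, map_smul, smul_eq_mul]
  have hLpp (n l : ℕ) : L (p n * p l) = ∑ j ∈ Finset.range (l + 1), c l j * L (p n * Y ^ j) := by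
    conv_lhs => rw [hp]; simp only
    rw [Finset.mul_sum, map_sum]
    refine Finset.sum_congr rfl fun k _ => ?_
    rw [mul_left_comm, ← smul_eq_C_mul, map_smul, smul_eq_mul]
  have horth' (n l : ℕ) (hl : l < n) : L (p n * p l) = 0 := by
    rw [hLpp]
    refine Finset.sum_eq_zero fun j hj => ?_
    rw [Finset.mem_range] at hj
    rw [hLp, horth n j (by omega), mul_zero]
  have hdiag (n : ℕ) : L (p n * p n) = c n n * L (p n * Y ^ n) := by
    rw [hLpp, Finset.sum_range_succ, Finset.sum_eq_zero, zero_add]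
    intro j hj
    rw [Finset.mem_range] at hj
    rw [hLp, horth n j hj, mul_zero]
  have h1 := sq_det_coeffMatrix_mul_hankelDet L (P := p) (N := N)
    fun i _ => degree_le_of_natDegree_le (hpdeg i)
  have h2 : (coeffMatrix p N).det = ∏ n ∈ Finset.range N, c n n * (1 / 2) ^ n := by
    rw [Matrix.det_of_isLowerTriangular, Finset.prod_range]
    · simp [coeffMatrix, hpcoeff]
    · intro i j hij
      exact coeff_eq_zero_of_natDegree_lt ((hpdeg i).trans_lt (by simpa using hij))
  have h3 : (Matrix.of fun i l : Fin N => L (p i * p l))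
      = Matrix.diagonal fun i : Fin N => c i i * L (p i * Y ^ (i : ℕ)) := by
    ext i l
    rw [Matrix.of_apply, Matrix.diagonal_apply]
    split_ifs with h
    · rw [← h, hdiag]
    · rcases lt_or_gt_of_ne h with h' | h'
      · rw [mul_comm]; exact horth' _ _ h'
      · exact horth' _ _ h'
  rw [h2, h3, Matrix.det_diagonal, ← Finset.prod_range
    (fun i => c i i * L (p i * Y ^ i)), ← Finset.prod_pow] at h1
  have h4 : ∏ n ∈ Finset.range N, (c n n * (1 / 2) ^ n) ^ 2 ≠ 0 :=
    Finset.prod_ne_zero_iff.mpr fun n _ => by have := hc n; positivity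
  rw [← mul_right_inj' h4, h1, ← Finset.prod_mul_distrib]
  refine Finset.prod_congr rfl fun n _ => ?_
  have h5 := hc n
  rw [← hLp, show (4 : ℝ) ^ n = 2 ^ n * 2 ^ n by rw [← mul_pow]; norm_num, one_div, inv_pow]
  field_simp

end

section

open Polynomial

variable {α β : ℝ}

theorem integral_rpow_mul_one_sub_rpow {a b : ℝ} (ha : -1 < a) (hb : -1 < b) :
    ∫ y in (0 : ℝ)..1, y ^ a * (1 - y) ^ b
      = Real.Gamma (a + 1) * Real.Gamma (b + 1) / Real.Gamma (a + b + 2) := by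
  have h1 := ProbabilityTheory.beta_eq_betaIntegralReal (a + 1) (b + 1) (by linarith) (by linarith)
  have h2 : betaIntegral ((a + 1 : ℝ) : ℂ) ((b + 1 : ℝ) : ℂ)
      = ((∫ y in (0 : ℝ)..1, y ^ a * (1 - y) ^ b : ℝ) : ℂ) := by
    rw [betaIntegral, ← intervalIntegral.integral_ofReal]
    refine intervalIntegral.integral_congr fun y hy => ?_
    rw [uIcc_of_le zero_le_one] at hy
    simp only [ofReal_mul]
    rw [ofReal_cpow hy.1, ofReal_cpow (by linarith [hy.2])]
    push_cast
    simp
  rw [h2, ofReal_re, ProbabilityTheory.beta] at h1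
  rw [← h1]
  ring_nf

theorem momentFunctional_jacobiMeasure_pow (hα : -1 < α) (hβ : -1 < β)
    [IsFiniteMeasure (jacobiMeasure α β)] (m : ℕ) :
    momentFunctional (jacobiMeasure α β) jacobiMeasure_restrict ((C (1 / 2) * (X + 1)) ^ m)
      = 2 ^ (α + β + 1) * Real.Gamma (α + 1) *
        (Real.Gamma (β + 1 + m) / Real.Gamma (α + β + 1 + 1 + m)) := by
  change ∫ x, _ ∂_ = _
  rw [integral_jacobiMeasure]
  have h1 := intervalIntegral.integral_comp_mul_sub (a := 0) (b := 1)
    (f := fun x => jacobiWeight α β x • ((C (1 / 2) * (X + 1) : ℝ[X]) ^ m).eval x)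
    (two_ne_zero : (2 : ℝ) ≠ 0) 1
  norm_num at h1
  have h2 : ∫ y in (0 : ℝ)..1, jacobiWeight α β (2 * y - 1) * ((1 / 2) * (2 * y)) ^ m
      = ∫ y in (0 : ℝ)..1, 2 ^ (α + β) * (y ^ (β + m) * (1 - y) ^ α) := by
    rw [intervalIntegral.integral_of_le zero_le_one, intervalIntegral.integral_of_le zero_le_one,
      integral_Ioc_eq_integral_Ioo, integral_Ioc_eq_integral_Ioo]
    refine setIntegral_congr_fun measurableSet_Ioo fun y hy => ?_
    have hy0 : 0 < y := hy.1
    have hy1 : 0 < 1 - y := by linarith [hy.2]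
    simp only [jacobiWeight]
    rw [show 1 - (2 * y - 1) = 2 * (1 - y) by ring, show 1 + (2 * y - 1) = 2 * y by ring,
      Real.mul_rpow zero_le_two hy1.le, Real.mul_rpow zero_le_two hy0.le, Real.rpow_add two_pos,
      Real.rpow_add hy0, Real.rpow_natCast]
    ring
  norm_num at h2
  rw [h2, integral_rpow_mul_one_sub_rpow (by have := m.cast_nonneg (α := ℝ); linarith) hα] at h1
  have h3 : ∫ x in (-1 : ℝ)..1, jacobiWeight α β x • ((C (1 / 2) * (X + 1) : ℝ[X]) ^ m).eval x
      = 2 * (2 ^ (α + β) * (Real.Gamma (β + m + 1) * Real.Gamma (α + 1)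
        / Real.Gamma (β + m + α + 2))) := by
    simp only [smul_eq_mul, eval_pow, eval_mul, eval_C, eval_add, eval_X, eval_one]
    norm_num
    linarith
  rw [h3, Real.rpow_add_one two_ne_zero, show β + m + 1 = β + 1 + m by ring,
    show β + m + α + 2 = α + β + 1 + 1 + m by ring]
  ring

theorem Gamma_add_nat_eq_mul_prod {x : ℝ} (hx : 0 < x) (j : ℕ) :
    Real.Gamma (x + j) = Real.Gamma x * ∏ i ∈ Finset.range j, (x + i) := by
  induction j with
  | zero => simp
  | succ j ih =>
    rw [Finset.prod_range_succ, ← mul_assoc, ← ih, Nat.cast_succ, ← add_assoc,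
      Real.Gamma_add_one (by positivity), mul_comm]

/-- The squared norm of the monic Jacobi polynomial of positive degree `n`. -/
def jacobiNorm (α β : ℝ) (n : ℕ) : ℝ :=
  4 ^ n * 2 ^ (α + β + 1) * n.factorial * Real.Gamma (α + 1 + n) * Real.Gamma (β + 1 + n)
    * Real.Gamma (α + β + 1 + n) / (Real.Gamma (α + β + 1 + n + n)
      * Real.Gamma (α + β + 1 + n + n + 1))

/-- The coefficients of a multiple of the Jacobi polynomial of degree `n` in powers of
`(1 + x) / 2`. -/
def jacobiCoeff (α β : ℝ) (n k : ℕ) : ℝ :=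
  if n = 0 then 1 else (-1) ^ (n - k) * n.choose k *
    (Real.Gamma (α + β + 1 + n + k) / Real.Gamma (β + 1 + k))

theorem natDegree_prod_X_add_C_le (a : ℝ) (j : ℕ) :
    (∏ i ∈ Finset.range j, (X + C (a + i)) : ℝ[X]).natDegree ≤ j := by
  refine (natDegree_prod_le _ _).trans ?_
  simp only [natDegree_X_add_C]
  simp

theorem eval_prod_X_add_C (a : ℝ) (j : ℕ) (x : ℝ) :
    (∏ i ∈ Finset.range j, (X + C (a + i)) : ℝ[X]).eval x
      = ∏ i ∈ Finset.range j, (a + x + i) := by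
  rw [eval_prod]
  refine Finset.prod_congr rfl fun i _ => ?_
  simp only [eval_add, eval_X, eval_C]
  ring

theorem jacobiCoeff_self_ne_zero (hα : -1 < α) (hβ : -1 < β) (n : ℕ) :
    jacobiCoeff α β n n ≠ 0 := by
  rw [jacobiCoeff]
  split_ifs with h
  · exact one_ne_zero
  · have hn : (1 : ℝ) ≤ n := by exact_mod_cast Nat.one_le_iff_ne_zero.mpr h
    have h1 : 0 < Real.Gamma (α + β + 1 + n + n) := Real.Gamma_pos_of_pos (by linarith)
    have h2 : 0 < Real.Gamma (β + 1 + n) := Real.Gamma_pos_of_pos (by linarith)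
    simp only [Nat.sub_self, pow_zero, Nat.choose_self, Nat.cast_one, one_mul]
    positivity

theorem sum_jacobiCoeff_mul_eq_zero (hα : -1 < α) (hβ : -1 < β) {n j : ℕ} (hj : j < n) :
    ∑ k ∈ Finset.range (n + 1), jacobiCoeff α β n k *
      (Real.Gamma (β + 1 + (k + j : ℕ)) / Real.Gamma (α + β + 1 + 1 + (k + j : ℕ))) = 0 := by
  have hdeg : ((∏ i ∈ Finset.range j, (X + C (β + 1 + i)) : ℝ[X]) *
      ∏ i ∈ Finset.range (n - 1 - j), (X + C (α + β + 1 + 1 + j + i))).natDegree < n := by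
    have h1 := natDegree_prod_X_add_C_le (β + 1) j
    have h2 := natDegree_prod_X_add_C_le (α + β + 1 + 1 + j) (n - 1 - j)
    have h3 := natDegree_mul_le (p := (∏ i ∈ Finset.range j, (X + C (β + 1 + i)) : ℝ[X]))
      (q := ∏ i ∈ Finset.range (n - 1 - j), (X + C (α + β + 1 + 1 + j + i)))
    omega
  rw [← sum_neg_one_pow_mul_choose_mul_eval hdeg]
  refine Finset.sum_congr rfl fun k _ => ?_
  rw [eval_mul, eval_prod_X_add_C, eval_prod_X_add_C, jacobiCoeff, if_neg (by omega)]
  have hk : (0 : ℝ) ≤ k := k.cast_nonneg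
  have hj0 : (0 : ℝ) ≤ j := j.cast_nonneg
  have p1 : 0 < β + 1 + k := by linarith
  have p2 : 0 < α + β + 1 + 1 + j + k := by linarith
  have e1 := Gamma_add_nat_eq_mul_prod p1 j
  have e2 := Gamma_add_nat_eq_mul_prod p2 (n - 1 - j)
  have e3 : α + β + 1 + 1 + j + k + (n - 1 - j : ℕ) = α + β + 1 + n + k := by
    rw [Nat.cast_sub (by omega), Nat.cast_sub (by omega)]
    push_cast
    ring
  have g1 := (Real.Gamma_pos_of_pos p1).ne'
  have g2 := (Real.Gamma_pos_of_pos p2).ne'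
  rw [e3] at e2
  rw [e2, Nat.cast_add, ← add_assoc, e1,
    show α + β + 1 + 1 + ((k : ℝ) + j) = α + β + 1 + 1 + j + k by ring]
  field_simp

theorem sum_jacobiCoeff_mul (hα : -1 < α) (hβ : -1 < β) {n : ℕ} (hn : 1 ≤ n) :
    ∑ k ∈ Finset.range (n + 1), jacobiCoeff α β n k *
      (Real.Gamma (β + 1 + (k + n : ℕ)) / Real.Gamma (α + β + 1 + 1 + (k + n : ℕ)))
      = n.factorial * Real.Gamma (α + 1 + n) * Real.Gamma (α + β + 1 + n) /
        (Real.Gamma (α + 1) * Real.Gamma (α + β + 1 + n + n + 1)) := by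
  have hn' : (1 : ℝ) ≤ n := by exact_mod_cast hn
  have hσ : 0 < α + β + 1 + n := by linarith
  have h1 := sum_neg_one_pow_mul_choose_mul_eval_div_add hn
    (natDegree_prod_X_add_C_le (β + 1) n) hσ
  have h2 : ∏ i ∈ Finset.range n, (β + 1 + -(α + β + 1 + n) + i)
      = (-1) ^ n * ∏ i ∈ Finset.range n, (α + 1 + i) := by
    rw [← Finset.prod_range_reflect, ← Finset.card_range n, ← Finset.prod_const,
      Finset.card_range, ← Finset.prod_mul_distrib]
    refine Finset.prod_congr rfl fun i hi => ?_
    rw [Finset.mem_range] at hi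
    rw [Nat.cast_sub (by omega), Nat.cast_sub (by omega)]
    push_cast
    ring
  have e1 := Gamma_add_nat_eq_mul_prod (show 0 < α + 1 by linarith) n
  have e2 := Gamma_add_nat_eq_mul_prod hσ (n + 1)
  have g1 := (Real.Gamma_pos_of_pos (show 0 < α + 1 by linarith)).ne'
  have g2 := (Real.Gamma_pos_of_pos hσ).ne'
  have g3 : ∏ i ∈ Finset.range (n + 1), (α + β + 1 + n + i) ≠ 0 :=
    Finset.prod_ne_zero_iff.mpr fun i _ => by positivity
  rw [Nat.cast_succ, ← add_assoc] at e2
  have h4 : ((-1 : ℝ) ^ n) * (-1) ^ n = 1 := by rw [← mul_pow]; norm_num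
  rw [eval_prod_X_add_C, h2] at h1
  calc _ = ∑ k ∈ Finset.range (n + 1), (-1 : ℝ) ^ (n - k) * n.choose k *
        ((∏ i ∈ Finset.range n, (X + C (β + 1 + i)) : ℝ[X]).eval (k : ℝ)
          / (k + (α + β + 1 + n))) := by
        refine Finset.sum_congr rfl fun k _ => ?_
        rw [eval_prod_X_add_C, jacobiCoeff, if_neg (by omega)]
        have hk : (0 : ℝ) ≤ k := k.cast_nonneg
        have p1 : 0 < β + 1 + k := by linarith
        have p2 : 0 < α + β + 1 + n + k := by linarith
        have f1 := Gamma_add_nat_eq_mul_prod p1 n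
        have f2 := Real.Gamma_add_one p2.ne'
        have g1 := (Real.Gamma_pos_of_pos p1).ne'
        have g2 := (Real.Gamma_pos_of_pos p2).ne'
        rw [Nat.cast_add, ← add_assoc, f1,
          show α + β + 1 + 1 + ((k : ℝ) + n) = α + β + 1 + n + k + 1 by ring, f2,
          show (k : ℝ) + (α + β + 1 + n) = α + β + 1 + n + k by ring]
        field_simp
    _ = _ := by
        rw [h1, e1, e2]
        field_simp
        linear_combination (∏ i ∈ Finset.range n, (α + 1 + i)) * h4

theorem hankelDet_jacobi (hα : -1 < α) (hβ : -1 < β) [IsFiniteMeasure (jacobiMeasure α β)]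
    (n : ℕ) :
    hankelDet (momentFunctional (jacobiMeasure α β) jacobiMeasure_restrict) (n + 1)
      = momentFunctional (jacobiMeasure α β) jacobiMeasure_restrict 1 *
        ∏ i ∈ Finset.range n, jacobiNorm α β (i + 1) := by
  have hsum (n j : ℕ) : ∑ k ∈ Finset.range (n + 1), jacobiCoeff α β n k *
      momentFunctional (jacobiMeasure α β) jacobiMeasure_restrict
        ((C (1 / 2) * (X + 1)) ^ (k + j)) = 2 ^ (α + β + 1) * Real.Gamma (α + 1) *
      ∑ k ∈ Finset.range (n + 1), jacobiCoeff α β n k *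
      (Real.Gamma (β + 1 + (k + j : ℕ)) / Real.Gamma (α + β + 1 + 1 + (k + j : ℕ))) := by
    rw [Finset.mul_sum]
    refine Finset.sum_congr rfl fun k _ => ?_
    rw [momentFunctional_jacobiMeasure_pow hα hβ]
    ring
  rw [hankelDet_eq_prod _ (jacobiCoeff_self_ne_zero hα hβ), Finset.prod_range_succ', mul_comm]
  · congr 1
    · simp [jacobiCoeff]
    · refine Finset.prod_congr rfl fun i _ => ?_
      rw [hsum, sum_jacobiCoeff_mul hα hβ (by omega), jacobiNorm, jacobiCoeff,
        if_neg (by omega)]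
      have hi : (0 : ℝ) ≤ i := i.cast_nonneg
      have g1 := (Real.Gamma_pos_of_pos (show 0 < α + 1 by linarith)).ne'
      have g2 := (Real.Gamma_pos_of_pos
        (show 0 < β + 1 + (i + 1 : ℕ) by push_cast; linarith)).ne'
      have g3 := (Real.Gamma_pos_of_pos
        (show 0 < α + β + 1 + (i + 1 : ℕ) + (i + 1 : ℕ) by push_cast; linarith)).ne'
      simp only [Nat.sub_self, pow_zero, Nat.choose_self, Nat.cast_one, one_mul]
      field_simp
  · intro n j hj
    rw [hsum, sum_jacobiCoeff_mul_eq_zero hα hβ hj, mul_zero]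

end

section

open Asymptotics Topology

/-- A sequence whose increments are `O(n^{-(k+1)})` converges at speed `O(n^{-k})`. -/
theorem exists_abs_sub_le_of_abs_sub_succ_le {a : ℕ → ℝ} {C : ℝ} {k : ℕ} (hk : 1 ≤ k)
    (h : ∀ n : ℕ, 1 ≤ n → |a (n + 1) - a n| ≤ C / (n : ℝ) ^ (k + 1)) :
    ∃ l C' : ℝ, Tendsto a atTop (𝓝 l) ∧ ∀ n : ℕ, 1 ≤ n → |a n - l| ≤ C' / (n : ℝ) ^ k := by
  have hC : 0 ≤ C := by simpa using (abs_nonneg _).trans (h 1 le_rfl)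
  set b : ℕ → ℝ := fun n => C * 2 ^ k / (n : ℝ) ^ k with hb
  have hb0 (n : ℕ) : 0 ≤ b n := by positivity
  have hstep : ∀ n : ℕ, 1 ≤ n → |a (n + 1) - a n| ≤ b n - b (n + 1) := by
    intro n hn
    have hn' : (1 : ℝ) ≤ n := by exact_mod_cast hn
    have hn0 : (0 : ℝ) < n := by linarith
    obtain ⟨m, rfl⟩ : ∃ m, k = m + 1 := ⟨k - 1, by omega⟩
    refine (h n hn).trans ?_
    have h1 : ((n : ℝ) + 1) ^ (m + 1) - (n : ℝ) ^ (m + 1) ≥ (n : ℝ) ^ m := by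
      have h2 : (n : ℝ) ^ m ≤ ((n : ℝ) + 1) ^ m := pow_le_pow_left₀ hn0.le (by linarith) m
      rw [pow_succ, pow_succ]
      nlinarith
    have h3 : ((n : ℝ) + 1) ^ (m + 1) ≤ 2 ^ (m + 1) * (n : ℝ) ^ (m + 1) := by
      rw [← mul_pow]
      exact pow_le_pow_left₀ (by linarith) (by linarith) _
    have h4 : b n - b (n + 1) = C * 2 ^ (m + 1) * (((n : ℝ) + 1) ^ (m + 1) - (n : ℝ) ^ (m + 1))
        / ((n : ℝ) ^ (m + 1) * ((n : ℝ) + 1) ^ (m + 1)) := by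
      simp only [hb]
      push_cast
      field_simp
    rw [h4, div_le_div_iff₀ (by positivity) (by positivity)]
    calc C * ((n : ℝ) ^ (m + 1) * ((n : ℝ) + 1) ^ (m + 1))
        ≤ C * ((n : ℝ) ^ (m + 1) * (2 ^ (m + 1) * (n : ℝ) ^ (m + 1))) := by gcongr
      _ = C * 2 ^ (m + 1) * (n : ℝ) ^ m * (n : ℝ) ^ (m + 1 + 1) := by ring
      _ ≤ _ := by gcongr
  have hlong : ∀ n : ℕ, 1 ≤ n → ∀ m : ℕ, |a (n + m) - a n| ≤ b n - b (n + m) := by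
    intro n hn m
    induction m with
    | zero => simp
    | succ m ih =>
      have h1 := hstep (n + m) (by omega)
      have h2 := abs_sub_le (a (n + m + 1)) (a (n + m)) (a n)
      rw [← add_assoc]
      linarith
  have hbt : Tendsto b atTop (𝓝 0) :=
    Tendsto.div_atTop tendsto_const_nhds
      ((tendsto_pow_atTop (by omega)).comp tendsto_natCast_atTop_atTop)
  have hcau : CauchySeq fun n => a (n + 1) := by
    refine cauchySeq_of_le_tendsto_0 (fun n => 2 * b (n + 1)) (fun n m N hn hm => ?_) ?_
    · obtain ⟨i, rfl⟩ := Nat.exists_eq_add_of_le hn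
      obtain ⟨j, rfl⟩ := Nat.exists_eq_add_of_le hm
      have h1 := hlong (N + 1) (by omega) i
      have h2 := hlong (N + 1) (by omega) j
      have h3 := hb0 (N + 1 + i)
      have h4 := hb0 (N + 1 + j)
      rw [Real.dist_eq, show N + i + 1 = N + 1 + i by ring, show N + j + 1 = N + 1 + j by ring]
      have h5 := abs_sub_le (a (N + 1 + i)) (a (N + 1)) (a (N + 1 + j))
      rw [abs_sub_comm (a (N + 1)) (a (N + 1 + j))] at h5
      linarith
    · simpa using ((tendsto_add_atTop_iff_nat 1).mpr hbt).const_mul 2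
  obtain ⟨l, hl⟩ := cauchySeq_tendsto_of_complete hcau
  rw [tendsto_add_atTop_iff_nat] at hl
  refine ⟨l, C * 2 ^ k, hl, fun n hn => ?_⟩
  have h1 : Tendsto (fun m => |a n - a (n + m)|) atTop (𝓝 |a n - l|) := by
    have : Tendsto (fun m => a (n + m)) atTop (𝓝 l) := by
      simpa only [add_comm] using (tendsto_add_atTop_iff_nat n).mpr hl
    exact (this.const_sub _).abs
  refine le_of_tendsto' h1 fun m => ?_
  rw [abs_sub_comm]
  linarith [hlong n hn m, hb0 (n + m)]

theorem isBigO_log_one_add_div_sub (c : ℝ) :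
    (fun n : ℕ => Real.log (1 + c / n) - c / n + c ^ 2 / 2 / (n : ℝ) ^ 2)
      =O[atTop] fun n : ℕ => ((n : ℝ) ^ 3)⁻¹ := by
  refine IsBigO.of_bound (2 * |c| ^ 3) ?_
  filter_upwards [eventually_ge_atTop (⌈2 * |c|⌉₊ + 1)] with n hn
  have hn0 : (0 : ℝ) < n := by exact_mod_cast (by omega : 0 < n)
  have h1 : 2 * |c| ≤ n := (Nat.le_ceil _).trans (by exact_mod_cast (by omega))
  have h2 : |-(c / n)| ≤ 1 / 2 := by
    rw [abs_neg, abs_div, abs_of_pos hn0, div_le_iff₀ hn0]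
    linarith
  have h3 := Real.abs_log_sub_add_sum_range_le (x := -(c / n)) (by linarith) 2
  norm_num [Finset.sum_range_succ] at h3
  rw [norm_inv, norm_pow, Real.norm_natCast, Real.norm_eq_abs]
  rw [abs_neg] at h2
  calc |Real.log (1 + c / n) - c / n + c ^ 2 / 2 / (n : ℝ) ^ 2|
      = |-(c / n) + (c / n) ^ 2 / 2 + Real.log (1 + c / n)| := by congr 1; ring
    _ ≤ |c / n| ^ 3 / (1 - |c / n|) := h3
    _ ≤ |c / n| ^ 3 / (1 / 2) := by gcongr; linarith
    _ = _ := by rw [abs_div, abs_of_pos hn0]; field_simp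

theorem tendsto_Gamma_add_nat_of_succ {y : ℝ}
    (h : Tendsto (fun n : ℕ => Real.Gamma (y + 1 + n) / ((n : ℝ) ^ y * n.factorial)) atTop (𝓝 1)) :
    Tendsto (fun n : ℕ => Real.Gamma (y + n) / ((n : ℝ) ^ (y - 1) * n.factorial)) atTop (𝓝 1) := by
  have h1 : Tendsto (fun n : ℕ => 1 + y / (n : ℝ)) atTop (𝓝 1) := by
    simpa using (tendsto_const_nhds (x := y)).div_atTop tendsto_natCast_atTop_atTop |>.const_add 1
  have h2 := h.div h1 one_ne_zero
  rw [div_one] at h2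
  refine h2.congr' ?_
  filter_upwards [eventually_ge_atTop (⌈|y|⌉₊ + 1)] with n hn
  have hn0 : (0 : ℝ) < n := by exact_mod_cast (by omega : 0 < n)
  have h3 : |y| < n := (Nat.le_ceil _).trans_lt (by exact_mod_cast (by omega))
  have h4 : 0 < y + n := by linarith [neg_abs_le y]
  have h5 : 1 + y / n ≠ 0 := by
    rw [one_add_div hn0.ne']; exact (div_pos (by linarith) hn0).ne'
  simp only [Pi.div_apply]
  rw [show y + 1 + n = y + n + 1 by ring, Real.Gamma_add_one h4.ne', Real.rpow_sub_one hn0.ne']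
  have h6 : (n : ℝ) ^ y ≠ 0 := (Real.rpow_pos_of_pos hn0 _).ne'
  rw [one_add_div hn0.ne']
  have h7 : (n : ℝ) + y ≠ 0 := by linarith
  field_simp
  ring

theorem tendsto_Gamma_add_nat {y : ℝ} (hy : -1 < y) :
    Tendsto (fun n : ℕ => Real.Gamma (y + n) / ((n : ℝ) ^ (y - 1) * n.factorial)) atTop (𝓝 1) := by
  have key {x : ℝ} (hx : 0 < x) : Tendsto
      (fun n : ℕ => Real.Gamma (x + 1 + n) / ((n : ℝ) ^ x * n.factorial)) atTop (𝓝 1) := by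
    have h1 := (tendsto_const_nhds (x := Real.Gamma x)).div (Real.GammaSeq_tendsto_Gamma x)
      (Real.Gamma_pos_of_pos hx).ne'
    rw [div_self (Real.Gamma_pos_of_pos hx).ne'] at h1
    refine h1.congr fun n => ?_
    simp only [Pi.div_apply]
    rw [Real.GammaSeq, show x + 1 + (n : ℝ) = x + (n + 1 : ℕ) by push_cast; ring,
      Gamma_add_nat_eq_mul_prod hx, div_div_eq_mul_div]
  refine tendsto_Gamma_add_nat_of_succ ?_
  have h2 := tendsto_Gamma_add_nat_of_succ (key (show 0 < y + 1 by linarith))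
  simpa using h2

end

section

open Asymptotics Topology Polynomial

variable {α β : ℝ}

/-- The squared norm of the monic Jacobi polynomial of degree `n` divided by its leading
asymptotics. -/
def normalizedJacobiNorm (α β : ℝ) (n : ℕ) : ℝ :=
  jacobiNorm α β n * (4 ^ n * 2 ^ (α + β) / Real.pi)

theorem jacobiNorm_pos (hα : -1 < α) (hβ : -1 < β) {n : ℕ} (hn : 1 ≤ n) :
    0 < jacobiNorm α β n := by
  have hn' : (1 : ℝ) ≤ n := by exact_mod_cast hn
  have g1 := Real.Gamma_pos_of_pos (show 0 < α + 1 + n by linarith)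
  have g2 := Real.Gamma_pos_of_pos (show 0 < β + 1 + n by linarith)
  have g3 := Real.Gamma_pos_of_pos (show 0 < α + β + 1 + n by linarith)
  have g4 := Real.Gamma_pos_of_pos (show 0 < α + β + 1 + n + n by linarith)
  have g5 := Real.Gamma_pos_of_pos (show 0 < α + β + 1 + n + n + 1 by linarith)
  rw [jacobiNorm]
  positivity

theorem normalizedJacobiNorm_pos (hα : -1 < α) (hβ : -1 < β) {n : ℕ} (hn : 1 ≤ n) :
    0 < normalizedJacobiNorm α β n := by
  have h1 := jacobiNorm_pos hα hβ hn
  rw [normalizedJacobiNorm]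
  positivity

theorem normalizedJacobiNorm_succ (hα : -1 < α) (hβ : -1 < β) {n : ℕ} (hn : 1 ≤ n) :
    normalizedJacobiNorm α β (n + 1) = normalizedJacobiNorm α β n *
      ((1 + 1 / n) * (1 + (α + 1) / n) * (1 + (β + 1) / n) * (1 + (α + β + 1) / n) /
      ((1 + (α + β + 1) / 2 / n) * (1 + (α + β + 2) / 2 / n) ^ 2 *
        (1 + (α + β + 3) / 2 / n))) := by
  have hn' : (1 : ℝ) ≤ n := by exact_mod_cast hn
  have p1 : 0 < α + 1 + n := by linarith
  have p2 : 0 < β + 1 + n := by linarith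
  have p3 : 0 < α + β + 1 + n := by linarith
  have p4 : 0 < α + β + 1 + n + n := by linarith
  have p5 : 0 < α + β + 1 + n + n + 1 := by linarith
  have p6 : 0 < α + β + 1 + n + n + 1 + 1 := by linarith
  have g1 := (Real.Gamma_pos_of_pos p1).ne'
  have g2 := (Real.Gamma_pos_of_pos p2).ne'
  have g3 := (Real.Gamma_pos_of_pos p3).ne'
  have g4 := (Real.Gamma_pos_of_pos p4).ne'
  rw [normalizedJacobiNorm, normalizedJacobiNorm, jacobiNorm, jacobiNorm, Nat.factorial_succ]
  push_cast
  rw [show α + β + 1 + ((n : ℝ) + 1) + (n + 1) = α + β + 1 + n + n + 1 + 1 by ring]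
  simp only [← add_assoc]
  rw [Real.Gamma_add_one p6.ne', Real.Gamma_add_one p5.ne', Real.Gamma_add_one p4.ne',
    Real.Gamma_add_one p1.ne', Real.Gamma_add_one p2.ne', Real.Gamma_add_one p3.ne']
  have q1 : (1 : ℝ) + (α + β + 1) / 2 / n = (α + β + 1 + n + n) / (2 * n) := by field_simp; ring
  have q2 : (1 : ℝ) + (α + β + 2) / 2 / n = (α + β + 1 + n + n + 1) / (2 * n) := by
    field_simp; ring
  have q3 : (1 : ℝ) + (α + β + 3) / 2 / n = (α + β + 1 + n + n + 1 + 1) / (2 * n) := by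
    field_simp; ring
  have q4 : (1 : ℝ) + (α + 1) / n = (α + 1 + n) / n := by field_simp; ring
  have q5 : (1 : ℝ) + (β + 1) / n = (β + 1 + n) / n := by field_simp; ring
  have q6 : (1 : ℝ) + (α + β + 1) / n = (α + β + 1 + n) / n := by field_simp; ring
  have q7 : (1 : ℝ) + 1 / n = (n + 1) / n := by field_simp
  rw [q1, q2, q3, q4, q5, q6, q7, pow_succ (4 : ℝ) n]
  field_simp
  norm_num

theorem tendsto_normalizedJacobiNorm (hα : -1 < α) (hβ : -1 < β) :
    Tendsto (normalizedJacobiNorm α β) atTop (𝓝 1) := by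
  have hd : Tendsto (fun n : ℕ => 2 * n) atTop atTop := tendsto_id.const_mul_atTop' two_pos
  have a1 := tendsto_Gamma_add_nat (show -1 < α + 1 by linarith)
  have a2 := tendsto_Gamma_add_nat (show -1 < β + 1 by linarith)
  have a3 := tendsto_Gamma_add_nat (show -1 < α + β + 1 by linarith)
  have b1 := (tendsto_Gamma_add_nat (show -1 < α + β + 1 by linarith)).comp hd
  have b2 := (tendsto_Gamma_add_nat (show -1 < α + β + 1 + 1 by linarith)).comp hd
  have hw : Tendsto (fun n : ℕ => Real.Wallis.W n * ((2 + 1 / n) / Real.pi)) atTop (𝓝 1) := by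
    have h1 : Tendsto (fun n : ℕ => (2 + 1 / (n : ℝ)) / Real.pi) atTop (𝓝 (2 / Real.pi)) := by
      simpa using (tendsto_one_div_atTop_nhds_zero_nat (𝕜 := ℝ)).const_add 2 |>.div_const Real.pi
    have h2 := Real.Wallis.tendsto_W_nhds_pi_div_two.mul h1
    rwa [div_mul_div_cancel₀ two_ne_zero, div_self Real.pi_ne_zero] at h2
  have h := (((a1.mul a2).mul a3).div (b1.mul b2) (by norm_num)).mul hw
  norm_num at h
  refine h.congr' ?_
  filter_upwards [eventually_ge_atTop 1] with n hn
  have hn' : (1 : ℝ) ≤ n := by exact_mod_cast hn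
  have hn0 : (0 : ℝ) < n := by linarith
  have g4 := (Real.Gamma_pos_of_pos (show 0 < α + β + 1 + n + n by linarith)).ne'
  have g5 := (Real.Gamma_pos_of_pos (show 0 < α + β + 1 + n + n + 1 by linarith)).ne'
  have f1 : ((2 * n).factorial : ℝ) ≠ 0 := by positivity
  rw [Real.Wallis.W_eq_factorial_ratio, normalizedJacobiNorm, jacobiNorm]
  have e1 : α + β + 1 + 2 * (n : ℝ) = α + β + 1 + n + n := by ring
  have e2 : α + β + 1 + 1 + 2 * (n : ℝ) = α + β + 1 + n + n + 1 := by ring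
  rw [e1, e2]
  have r1 : (0 : ℝ) < (n : ℝ) ^ α := Real.rpow_pos_of_pos hn0 _
  have r2 : (0 : ℝ) < (n : ℝ) ^ β := Real.rpow_pos_of_pos hn0 _
  have r3 : (0 : ℝ) < (2 : ℝ) ^ α := Real.rpow_pos_of_pos two_pos _
  have r4 : (0 : ℝ) < (2 : ℝ) ^ β := Real.rpow_pos_of_pos two_pos _
  rw [Real.rpow_add_one (by positivity), Real.rpow_add (by positivity : (0 : ℝ) < 2 * n),
    Real.mul_rpow zero_le_two hn0.le, Real.mul_rpow zero_le_two hn0.le, Real.rpow_add hn0,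
    Real.rpow_add_one two_ne_zero, Real.rpow_add two_pos, pow_mul,
    show (2 : ℝ) ^ 4 = 4 * 4 by norm_num, mul_pow]
  field_simp

theorem exists_log_normalizedJacobiNorm (hα : -1 < α) (hβ : -1 < β) :
    ∃ C : ℝ, ∀ n : ℕ, 1 ≤ n →
      |Real.log (normalizedJacobiNorm α β n) - ((α ^ 2 + β ^ 2) / 2 - 1 / 4) / n|
        ≤ C / (n : ℝ) ^ 2 := by
  set e := (α ^ 2 + β ^ 2) / 2 - 1 / 4 with he
  set a : ℕ → ℝ := fun n => Real.log (normalizedJacobiNorm α β n) - e / n with ha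
  have hlog : ∀ n : ℕ, 1 ≤ n → a (n + 1) - a n =
      Real.log (1 + 1 / n) + Real.log (1 + (α + 1) / n) + Real.log (1 + (β + 1) / n)
        + Real.log (1 + (α + β + 1) / n) - Real.log (1 + (α + β + 1) / 2 / n)
        - 2 * Real.log (1 + (α + β + 2) / 2 / n) - Real.log (1 + (α + β + 3) / 2 / n)
        + (e / n - e / (n + 1)) := by
    intro n hn
    have hn' : (1 : ℝ) ≤ n := by exact_mod_cast hn
    have hn0 : (0 : ℝ) < n := by linarith
    have pos {c : ℝ} (hc : -1 < c) : 0 < 1 + c / n := by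
      rw [one_add_div hn0.ne']
      exact div_pos (by linarith) hn0
    have k1 := (pos (show (-1 : ℝ) < 1 by norm_num)).ne'
    have k2 := (pos (show -1 < α + 1 by linarith)).ne'
    have k3 := (pos (show -1 < β + 1 by linarith)).ne'
    have k4 := (pos (show -1 < α + β + 1 by linarith)).ne'
    have k5 := (pos (show -1 < (α + β + 1) / 2 by linarith)).ne'
    have k6 := (pos (show -1 < (α + β + 2) / 2 by linarith)).ne'
    have k7 := (pos (show -1 < (α + β + 3) / 2 by linarith)).ne'
    have k8 := (normalizedJacobiNorm_pos hα hβ hn).ne'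
    simp only [ha]
    rw [normalizedJacobiNorm_succ hα hβ hn, Real.log_mul k8 (by positivity),
      Real.log_div (by positivity) (by positivity), Real.log_mul (by positivity) k4,
      Real.log_mul (by positivity) k3, Real.log_mul k1 k2, Real.log_mul (by positivity) k7,
      Real.log_mul k5 (by positivity), Real.log_pow]
    push_cast
    ring
  have hO : (fun n : ℕ => a (n + 1) - a n) =O[atTop] fun n : ℕ => ((n : ℝ) ^ 3)⁻¹ := by
    have h1 := ((((((isBigO_log_one_add_div_sub 1).add (isBigO_log_one_add_div_sub (α + 1))).add
      (isBigO_log_one_add_div_sub (β + 1))).add (isBigO_log_one_add_div_sub (α + β + 1))).sub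
      (isBigO_log_one_add_div_sub ((α + β + 1) / 2))).sub
      ((isBigO_log_one_add_div_sub ((α + β + 2) / 2)).const_mul_left 2)).sub
      (isBigO_log_one_add_div_sub ((α + β + 3) / 2))
    have h2 : (fun n : ℕ => e / n - e / (n + 1) - e / (n : ℝ) ^ 2)
        =O[atTop] fun n : ℕ => ((n : ℝ) ^ 3)⁻¹ := by
      refine IsBigO.of_bound |e| ?_
      filter_upwards [eventually_ge_atTop 1] with n hn
      have hn' : (1 : ℝ) ≤ n := by exact_mod_cast hn
      have hn0 : (0 : ℝ) < n := by linarith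
      have h3 : e / n - e / (n + 1) - e / (n : ℝ) ^ 2 = -(e * ((n : ℝ) ^ 2 * (n + 1))⁻¹) := by
        field_simp
        ring
      rw [h3, norm_neg, norm_mul, Real.norm_eq_abs,
        Real.norm_of_nonneg (by positivity : (0 : ℝ) ≤ ((n : ℝ) ^ 2 * (n + 1))⁻¹),
        Real.norm_of_nonneg (by positivity : (0 : ℝ) ≤ ((n : ℝ) ^ 3)⁻¹)]
      gcongr
      nlinarith [sq_nonneg (n : ℝ)]
    refine (h1.add h2).congr' ?_ EventuallyEq.rfl
    filter_upwards [eventually_ge_atTop 1] with n hn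
    have hn0 : (0 : ℝ) < n := by exact_mod_cast hn
    rw [hlog n hn, he]
    field_simp
    ring
  obtain ⟨C, -, hC⟩ := bound_of_isBigO_nat_atTop hO
  obtain ⟨l, C', hl, hC'⟩ := exists_abs_sub_le_of_abs_sub_succ_le (a := a) (k := 2) (C := C)
    one_le_two fun n hn => by
      have hn0 : (0 : ℝ) < n := by exact_mod_cast hn
      have h1 := hC (show ((n : ℝ) ^ 3)⁻¹ ≠ 0 by positivity)
      rw [Real.norm_of_nonneg (by positivity : (0 : ℝ) ≤ ((n : ℝ) ^ 3)⁻¹)] at h1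
      exact h1
  have hlim : Tendsto a atTop (𝓝 0) := by
    have h1 := ((tendsto_normalizedJacobiNorm hα hβ).log one_ne_zero).sub
      ((tendsto_const_nhds (x := e)).div_atTop tendsto_natCast_atTop_atTop)
    simpa using h1
  rw [tendsto_nhds_unique hl hlim] at hC'
  exact ⟨C', by simpa using hC'⟩

theorem exists_sum_log_normalizedJacobiNorm (hα : -1 < α) (hβ : -1 < β) :
    ∃ l C : ℝ, ∀ n : ℕ, 1 ≤ n →
      |∑ i ∈ Finset.range n, Real.log (normalizedJacobiNorm α β (i + 1))
        - ((α ^ 2 + β ^ 2) / 2 - 1 / 4) * Real.log n - l| ≤ C / n := by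
  obtain ⟨C₁, hC₁⟩ := exists_log_normalizedJacobiNorm hα hβ
  set e := (α ^ 2 + β ^ 2) / 2 - 1 / 4 with he
  obtain ⟨C₂, -, hC₂⟩ := bound_of_isBigO_nat_atTop (isBigO_log_one_add_div_sub 1)
  set u : ℕ → ℝ := fun n => ∑ i ∈ Finset.range n, Real.log (normalizedJacobiNorm α β (i + 1))
    - e * Real.log n with hu
  suffices h : ∀ n : ℕ, 1 ≤ n → |u (n + 1) - u n| ≤ (|C₁| + |e| * (C₂ + 2)) / (n : ℝ) ^ (1 + 1) by
    obtain ⟨l, C, -, hC⟩ := exists_abs_sub_le_of_abs_sub_succ_le le_rfl h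
    exact ⟨l, C, fun n hn => by simpa using hC n hn⟩
  intro n hn
  simp only [hu]
  have hn' : (1 : ℝ) ≤ n := by exact_mod_cast hn
  have hn0 : (0 : ℝ) < n := by linarith
  have h1 := hC₁ (n + 1) (by omega)
  have h2 := hC₂ (show ((n : ℝ) ^ 3)⁻¹ ≠ 0 by positivity)
  rw [Real.norm_of_nonneg (by positivity : (0 : ℝ) ≤ ((n : ℝ) ^ 3)⁻¹), Real.norm_eq_abs] at h2
  have h3 : Real.log ((n + 1 : ℕ) : ℝ) = Real.log n + Real.log (1 + 1 / n) := by
    rw [← Real.log_mul hn0.ne' (by positivity)]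
    congr 1
    push_cast
    field_simp
  have hC₂0 : 0 ≤ C₂ := by
    have := (abs_nonneg _).trans h2
    exact nonneg_of_mul_nonneg_left this (by positivity)
  rw [Finset.sum_range_succ, h3]
  have b1 : |Real.log (normalizedJacobiNorm α β (n + 1)) - e / (n + 1 : ℕ)|
      ≤ |C₁| / (n : ℝ) ^ 2 := by
    refine h1.trans ((div_le_div_of_nonneg_right (le_abs_self _) (by positivity)).trans ?_)
    gcongr
    linarith
  have b2 : |Real.log (1 + 1 / n) - 1 / n + 1 ^ 2 / 2 / (n : ℝ) ^ 2| ≤ C₂ / (n : ℝ) ^ 2 := by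
    refine h2.trans ?_
    rw [← div_eq_mul_inv]
    gcongr
    norm_num
  have b3 : |(1 : ℝ) / (n + 1 : ℕ) - 1 / n + 1 ^ 2 / 2 / (n : ℝ) ^ 2| ≤ 2 / (n : ℝ) ^ 2 := by
    have h4 : (1 : ℝ) / (n + 1 : ℕ) - 1 / n + 1 ^ 2 / 2 / (n : ℝ) ^ 2
        = (1 / 2 - n / (n + 1)) / (n : ℝ) ^ 2 := by
      push_cast
      field_simp
      ring
    rw [h4, abs_div, abs_of_pos (by positivity : (0 : ℝ) < (n : ℝ) ^ 2)]
    gcongr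
    have h5 : (n : ℝ) / (n + 1) ≤ 1 := (div_le_one (by positivity)).mpr (by linarith)
    have h6 : 0 ≤ (n : ℝ) / (n + 1) := by positivity
    rw [abs_le]
    constructor <;> linarith
  have h7 : ∑ i ∈ Finset.range n, Real.log (normalizedJacobiNorm α β (i + 1))
      + Real.log (normalizedJacobiNorm α β (n + 1)) - e * (Real.log n + Real.log (1 + 1 / n))
      - (∑ i ∈ Finset.range n, Real.log (normalizedJacobiNorm α β (i + 1)) - e * Real.log n)
      = (Real.log (normalizedJacobiNorm α β (n + 1)) - e / (n + 1 : ℕ))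
        + e * ((1 / (n + 1 : ℕ) - 1 / n + 1 ^ 2 / 2 / (n : ℝ) ^ 2)
          - (Real.log (1 + 1 / n) - 1 / n + 1 ^ 2 / 2 / (n : ℝ) ^ 2)) := by
    ring
  rw [h7]
  refine (abs_add_le _ _).trans ?_
  rw [abs_mul]
  have h8 := (abs_sub _ _).trans (add_le_add b3 b2)
  have h9 := mul_le_mul_of_nonneg_left h8 (abs_nonneg e)
  refine (add_le_add b1 h9).trans (le_of_eq ?_)
  field_simp
  ring

end

section

open Topology Polynomial
open Real (circleAverage)

variable {α β : ℝ}

theorem integral_div_sqrt_one_sub_sq (F : ℝ → ℝ) :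
    ∫ x in (-1 : ℝ)..1, F x / Real.sqrt (1 - x ^ 2)
      = ∫ θ in (0 : ℝ)..Real.pi, F (Real.cos θ) := by
  rw [intervalIntegral.integral_of_le (by norm_num), ← integral_Icc_eq_integral_Ioc,
    ← Real.bijOn_cos.image_eq,
    integral_image_eq_integral_abs_deriv_smul measurableSet_Icc
      (fun x _ => (Real.hasDerivAt_cos x).hasDerivWithinAt) Real.injOn_cos,
    intervalIntegral.integral_of_le Real.pi_pos.le, integral_Icc_eq_integral_Ioo,
    integral_Ioc_eq_integral_Ioo]
  refine setIntegral_congr_fun measurableSet_Ioo fun θ hθ => ?_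
  have hs := Real.sin_pos_of_mem_Ioo hθ
  have h1 : 1 - Real.cos θ ^ 2 = Real.sin θ ^ 2 := by rw [Real.sin_sq]
  simp only [h1, Real.sqrt_sq hs.le, abs_neg, abs_of_pos hs, smul_eq_mul]
  field_simp

theorem intervalIntegrable_log_one_sub_cos :
    IntervalIntegrable (fun θ => Real.log (1 - Real.cos θ)) volume 0 Real.pi := by
  have : MeromorphicOn (fun θ => 1 - Real.cos θ) (uIcc 0 Real.pi) := fun x _ =>
    (analyticAt_const.sub (Real.analyticAt_cos)).meromorphicAt
  exact this.intervalIntegrable_log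

theorem integral_log_one_sub_cos :
    ∫ θ in (0 : ℝ)..Real.pi, Real.log (1 - Real.cos θ) = -(Real.pi * Real.log 2) := by
  have h1 : ∫ θ in (0 : ℝ)..Real.pi, Real.log (1 - Real.cos θ)
      = ∫ θ in (0 : ℝ)..Real.pi, (Real.log 2 + 2 * Real.log (Real.sin (θ / 2))) := by
    rw [intervalIntegral.integral_of_le Real.pi_pos.le,
      intervalIntegral.integral_of_le Real.pi_pos.le, integral_Ioc_eq_integral_Ioo,
      integral_Ioc_eq_integral_Ioo]
    refine setIntegral_congr_fun measurableSet_Ioo fun θ hθ => ?_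
    have hs : 0 < Real.sin (θ / 2) :=
      Real.sin_pos_of_pos_of_lt_pi (by linarith [hθ.1]) (by linarith [hθ.1, hθ.2])
    have h2 : 1 - Real.cos θ = 2 * Real.sin (θ / 2) ^ 2 := by
      rw [Real.sin_sq_eq_half_sub, mul_div_cancel₀ θ two_ne_zero]
      ring
    simp only [h2]
    rw [Real.log_mul two_ne_zero (by positivity), Real.log_pow]
    norm_num
  have hi : IntervalIntegrable (fun θ => Real.log (Real.sin (θ / 2))) volume 0 Real.pi := by
    have : MeromorphicOn (fun θ => Real.sin (θ / 2)) (uIcc 0 Real.pi) := fun x _ =>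
      AnalyticAt.meromorphicAt (by fun_prop)
    exact this.intervalIntegrable_log
  rw [h1, intervalIntegral.integral_add (by simp) (hi.const_mul 2),
    intervalIntegral.integral_const_mul,
    intervalIntegral.integral_comp_div (fun θ => Real.log (Real.sin θ)) two_ne_zero, zero_div,
    integral_log_sin_zero_pi_div_two]
  simp
  ring

theorem intervalIntegrable_log_one_add_cos :
    IntervalIntegrable (fun θ => Real.log (1 + Real.cos θ)) volume 0 Real.pi := by
  have : MeromorphicOn (fun θ => 1 + Real.cos θ) (uIcc 0 Real.pi) := fun x _ =>
    (analyticAt_const.add (Real.analyticAt_cos)).meromorphicAt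
  exact this.intervalIntegrable_log

theorem integral_log_one_add_cos :
    ∫ θ in (0 : ℝ)..Real.pi, Real.log (1 + Real.cos θ) = -(Real.pi * Real.log 2) := by
  have h1 := intervalIntegral.integral_comp_sub_left (a := 0) (b := Real.pi)
    (fun θ => Real.log (1 - Real.cos θ)) Real.pi
  simp only [Real.cos_pi_sub, sub_neg_eq_add, sub_self, sub_zero] at h1
  rw [h1, integral_log_one_sub_cos]

theorem circleAverage_comp_joukowski {G : ℂ → ℂ} {g : ℝ → ℝ}
    (hg : ContinuousOn g (Icc (-1) 1)) (hgG : ∀ x ∈ Icc (-1 : ℝ) 1, G x = (g x : ℂ)) :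
    (circleAverage (fun ζ => G (joukowski ζ)) 0 1).re
      = Real.pi⁻¹ * ∫ θ in (0 : ℝ)..Real.pi, g (Real.cos θ) := by
  have hc : Continuous fun θ => g (Real.cos θ) :=
    hg.comp_continuous Real.continuous_cos fun θ => ⟨Real.neg_one_le_cos θ, Real.cos_le_one θ⟩
  have h1 (θ : ℝ) : G (joukowski (circleMap 0 1 θ)) = (g (Real.cos θ) : ℂ) := by
    rw [joukowski_circleMap, hgG _ ⟨Real.neg_one_le_cos θ, Real.cos_le_one θ⟩]
  have h2 : ∫ θ in Real.pi..(2 * Real.pi), g (Real.cos θ)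
      = ∫ θ in (0 : ℝ)..Real.pi, g (Real.cos θ) := by
    have h3 := intervalIntegral.integral_comp_sub_left (a := 0) (b := Real.pi)
      (fun θ => g (Real.cos θ)) (2 * Real.pi)
    simp only [Real.cos_two_pi_sub, sub_zero] at h3
    rw [h3, show 2 * Real.pi - Real.pi = Real.pi by ring]
  rw [Real.circleAverage_def]
  simp only [h1]
  rw [intervalIntegral.integral_ofReal, Complex.real_smul, ← Complex.ofReal_mul, Complex.ofReal_re,
    ← intervalIntegral.integral_add_adjacent_intervals (b := Real.pi)
      (hc.intervalIntegrable _ _) (hc.intervalIntegrable _ _), h2]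
  ring

theorem integral_log_jacobiWeight_mul_div_sqrt {w g : ℝ → ℝ}
    (hg : ContinuousOn g (Icc (-1) 1))
    (hw : ∀ x ∈ Ioo (-1 : ℝ) 1, w x = jacobiWeight α β x * Real.exp (g x)) :
    ∫ x in (-1 : ℝ)..1, Real.log (w x) / Real.sqrt (1 - x ^ 2)
      = (∫ θ in (0 : ℝ)..Real.pi, g (Real.cos θ)) - (α + β) * (Real.pi * Real.log 2) := by
  have hc : Continuous fun θ => g (Real.cos θ) :=
    hg.comp_continuous Real.continuous_cos fun θ => ⟨Real.neg_one_le_cos θ, Real.cos_le_one θ⟩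
  have h1 : ∫ θ in (0 : ℝ)..Real.pi, Real.log (w (Real.cos θ))
      = ∫ θ in (0 : ℝ)..Real.pi, (α * Real.log (1 - Real.cos θ)
          + β * Real.log (1 + Real.cos θ) + g (Real.cos θ)) := by
    rw [intervalIntegral.integral_of_le Real.pi_pos.le,
      intervalIntegral.integral_of_le Real.pi_pos.le, integral_Ioc_eq_integral_Ioo,
      integral_Ioc_eq_integral_Ioo]
    refine setIntegral_congr_fun measurableSet_Ioo fun θ hθ => ?_
    have hlt : Real.cos θ < 1 := by
      have := Real.cos_lt_cos_of_nonneg_of_le_pi le_rfl hθ.2.le hθ.1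
      rwa [Real.cos_zero] at this
    have hgt : -1 < Real.cos θ := by
      have := Real.cos_lt_cos_of_nonneg_of_le_pi hθ.1.le le_rfl hθ.2
      rwa [Real.cos_pi] at this
    have k1 : 0 < 1 - Real.cos θ := by linarith
    have k2 : 0 < 1 + Real.cos θ := by linarith
    rw [hw _ ⟨hgt, hlt⟩, jacobiWeight, Real.log_mul (by positivity) (by positivity),
      Real.log_mul (by positivity) (by positivity), Real.log_rpow k1, Real.log_rpow k2,
      Real.log_exp]
  have i1 := intervalIntegrable_log_one_sub_cos.const_mul α
  have i2 := intervalIntegrable_log_one_add_cos.const_mul β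
  rw [integral_div_sqrt_one_sub_sq, h1, intervalIntegral.integral_add (i1.add i2)
    (hc.intervalIntegrable _ _), intervalIntegral.integral_add i1 i2,
    intervalIntegral.integral_const_mul, intervalIntegral.integral_const_mul,
    integral_log_one_sub_cos, integral_log_one_add_cos]
  ring

theorem tiltedFunctional_zero {μ : Measure ℝ} [IsFiniteMeasure μ]
    (hμ : μ.restrict (Icc (-1) 1) = μ) {g : ℝ → ℝ} (hg : ContinuousOn g (Icc (-1) 1)) :
    tiltedFunctional μ hμ g hg 0 = momentFunctional μ hμ := by
  refine LinearMap.ext fun Q => ?_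
  rw [tiltedFunctional_apply]
  simp [momentFunctional]

theorem sum_range_succ_mul_two (c d : ℝ) (n : ℕ) :
    ∑ i ∈ Finset.range n, ((i + 1 : ℕ) * (2 * c) + d) = (n ^ 2 + n) * c + n * d := by
  induction n with
  | zero => simp
  | succ n ih =>
    rw [Finset.sum_range_succ, ih]
    push_cast
    ring

theorem exists_log_hankelDet_jacobi (hα : -1 < α) (hβ : -1 < β)
    [IsFiniteMeasure (jacobiMeasure α β)] :
    ∃ l C : ℝ, ∀ n : ℕ, 1 ≤ n →
      |Real.log (hankelDet (momentFunctional (jacobiMeasure α β) jacobiMeasure_restrict) (n + 1))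
        + (n ^ 2 + n) * Real.log 2 + n * ((α + β) * Real.log 2 - Real.log Real.pi)
        - ((α ^ 2 + β ^ 2) / 2 - 1 / 4) * Real.log n - l| ≤ C / n := by
  obtain ⟨l, C, hC⟩ := exists_sum_log_normalizedJacobiNorm hα hβ
  set L := momentFunctional (jacobiMeasure α β) jacobiMeasure_restrict
  have hL : 0 < L 1 := by
    have := integral_mul_self_jacobiMeasure_pos hα hβ (Q := 1) one_ne_zero
    rwa [mul_one] at this
  refine ⟨Real.log (L 1) + l, C, fun n hn => ?_⟩
  have h1 : ∀ i ∈ Finset.range n, Real.log (normalizedJacobiNorm α β (i + 1))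
      = Real.log (jacobiNorm α β (i + 1)) + ((i + 1 : ℕ) * (2 * Real.log 2)
        + ((α + β) * Real.log 2 - Real.log Real.pi)) := by
    intro i _
    have k1 := (jacobiNorm_pos hα hβ (Nat.le_add_left 1 i)).ne'
    have k2 : Real.log 4 = 2 * Real.log 2 := by
      rw [show (4 : ℝ) = 2 ^ 2 by norm_num, Real.log_pow]
      norm_num
    have k3 := Real.pi_pos
    rw [normalizedJacobiNorm, Real.log_mul k1 (by positivity),
      Real.log_div (by positivity) (by positivity), Real.log_mul (by positivity) (by positivity),
      Real.log_pow, Real.log_rpow two_pos, k2]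
    ring
  have h2 := hC n hn
  rw [Finset.sum_congr rfl h1, Finset.sum_add_distrib, sum_range_succ_mul_two] at h2
  rw [hankelDet_jacobi hα hβ, Real.log_mul hL.ne' (Finset.prod_ne_zero_iff.2 fun i _ =>
      (jacobiNorm_pos hα hβ (Nat.le_add_left 1 i)).ne'),
    Real.log_prod fun i _ => (jacobiNorm_pos hα hβ (Nat.le_add_left 1 i)).ne']
  convert h2 using 2
  ring

theorem exists_abs_sub_exp_le_of_abs_log_sub_le {u : ℕ → ℝ} (hu : ∀ n, 1 ≤ n → 0 < u n)
    {K C : ℝ} (h : ∀ n : ℕ, 1 ≤ n → |Real.log (u n) - K| ≤ C / n) :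
    ∃ C' > (0 : ℝ), ∀ n : ℕ, 1 ≤ n → |u n - Real.exp K| ≤ C' / n := by
  have hC : 0 ≤ C := by simpa using (abs_nonneg _).trans (h 1 le_rfl)
  refine ⟨Real.exp K * (C * Real.exp C) + 1, by positivity, fun n hn => ?_⟩
  have hn0 : (1 : ℝ) ≤ n := by exact_mod_cast hn
  have h1 : u n = Real.exp K * Real.exp (Real.log (u n) - K) := by
    rw [← Real.exp_add, add_sub_cancel, Real.exp_log (hu n hn)]
  set y := Real.log (u n) - K
  have h2 : |y| ≤ C := (h n hn).trans (div_le_self hC hn0)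
  have h3 : |Real.exp y - 1| ≤ |y| * Real.exp |y| := by
    have h4 := Real.add_one_le_exp y
    have h5 := Real.add_one_le_exp (-y)
    have h6 : Real.exp y * Real.exp (-y) = 1 := by rw [← Real.exp_add]; simp
    have h7 := Real.exp_pos y
    rw [abs_le]
    rcases le_total 0 y with hy | hy
    · rw [abs_of_nonneg hy]
      constructor <;> nlinarith
    · rw [abs_of_nonpos hy]
      have h8 : 1 ≤ Real.exp (-y) := Real.one_le_exp (by linarith)
      constructor <;> nlinarith
  calc |u n - Real.exp K| = Real.exp K * |Real.exp y - 1| := by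
        rw [h1, ← abs_of_pos (Real.exp_pos K), ← abs_mul, abs_of_pos (Real.exp_pos K)]
        ring_nf
    _ ≤ Real.exp K * (C / n * Real.exp C) := by
        gcongr
        refine h3.trans ?_
        gcongr
        exact h n hn
    _ = Real.exp K * (C * Real.exp C) / n := by ring
    _ ≤ _ := by gcongr; linarith

theorem exists_log_asymptotics (hα : -1 < α) (hβ : -1 < β) {U : Set ℂ} (hU : IsOpen U)
    (hseg : ∀ x ∈ Icc (-1 : ℝ) 1, (x : ℂ) ∈ U) {G : ℂ → ℂ} (hG : DifferentiableOn ℂ G U)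
    {g : ℝ → ℝ} (hg : ContinuousOn g (Icc (-1) 1))
    (hgG : ∀ x ∈ Icc (-1 : ℝ) 1, G x = (g x : ℂ)) [IsFiniteMeasure (jacobiMeasure α β)] :
    ∃ K C : ℝ, ∀ n : ℕ, 1 ≤ n →
      |Real.log (hankelDet (tiltedFunctional (jacobiMeasure α β) jacobiMeasure_restrict g hg 1)
          (n + 1))
        + n ^ 2 * Real.log 2 + n * ((1 + α + β) * Real.log 2 - Real.log Real.pi
          - (circleAverage (fun ζ => G (joukowski ζ)) 0 1).re)
        - ((α ^ 2 + β ^ 2) / 2 - 1 / 4) * Real.log n - K| ≤ C / n := by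
  obtain ⟨B, C₁, h₁⟩ := exists_log_hankelDet_sub_asymptotics hα hβ hU hseg hG hg hgG
  obtain ⟨l, C₂, h₂⟩ := exists_log_hankelDet_jacobi hα hβ
  set A := (circleAverage (fun ζ => G (joukowski ζ)) 0 1).re
  refine ⟨B + l + A, |C₁| + C₂, fun n hn => ?_⟩
  have hn0 : (1 : ℝ) ≤ n := by exact_mod_cast hn
  have e1 := h₁ (n + 1) (by omega)
  have e2 := h₂ n hn
  rw [tiltedFunctional_zero] at e1
  have e3 : C₁ / (n + 1 : ℕ) ≤ |C₁| / n := by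
    refine (div_le_div_of_nonneg_right (le_abs_self _) (by positivity)).trans ?_
    gcongr
    linarith
  rw [add_div |C₁|]
  refine le_trans ?_ (add_le_add (e1.trans e3) e2)
  refine le_trans (le_of_eq ?_) (abs_add_le _ _)
  congr 1
  push_cast
  ring

end

theorem stmt5
    (α β : ℝ) (hα : -1 < α) (hβ : -1 < β)
    (U : Set ℂ) (hUopen : IsOpen U) (hUseg : seg ⊆ U)
    (h : ℂ → ℂ) (hh : AnalyticOn ℂ h U)
    (hhre : ∀ z ∈ U, 0 < (h z).re)
    (hhreal : ∀ x ∈ Set.Icc (-1:ℝ) 1, (h (x:ℂ)).im = 0)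
    (w : ℝ → ℝ)
    (hw : ∀ x ∈ Set.Ioo (-1:ℝ) 1, w x = (1 - x) ^ α * (1 + x) ^ β * (h (x:ℂ)).re)
    (Dinf : ℝ)
    (hDinf : Dinf = Real.exp ((1 / (2 * Real.pi)) *
      ∫ x in (-1:ℝ)..1, Real.log (w x) / Real.sqrt (1 - x ^ 2)))
    (Dn : ℕ → ℝ)
    (hDn : ∀ n, Dn n = Matrix.det
      (Matrix.of fun j k : Fin (n+1) => ∫ x in (-1:ℝ)..1, x ^ ((j:ℕ) + (k:ℕ)) * w x)) :
    ∃ C > (0:ℝ), ∃ C' > (0:ℝ), ∀ n : ℕ, 1 ≤ n →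
      |Dn n * 2 ^ (n ^ 2) * (2 / (Real.pi * Dinf ^ 2)) ^ n
        * (n : ℝ) ^ (-((4 * α ^ 2 - 1) / 8 + (4 * β ^ 2 - 1) / 8))
        - C| ≤ C' / n := by
  have hfin := isFiniteMeasure_jacobiMeasure hα hβ
  have hseg : ∀ x ∈ Icc (-1 : ℝ) 1, (x : ℂ) ∈ U := fun x hx => hUseg ⟨x, hx, rfl⟩
  set G : ℂ → ℂ := fun z => Complex.log (h z) with hGdef
  set g : ℝ → ℝ := fun x => Real.log (h x).re with hgdef
  have hG : DifferentiableOn ℂ G U :=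
    hh.differentiableOn.clog fun z hz => Or.inl (hhre z hz)
  have hgG : ∀ x ∈ Icc (-1 : ℝ) 1, G x = (g x : ℂ) := by
    intro x hx
    have h1 : h x = ((h x).re : ℂ) := Complex.ext rfl (by simpa using hhreal x hx)
    simp only [hGdef, hgdef]
    rw [Complex.ofReal_log (hhre _ (hseg x hx)).le, ← h1]
  have hg : ContinuousOn g (Icc (-1) 1) := by
    have h1 : ContinuousOn (fun x : ℝ => (G x).re) (Icc (-1) 1) :=
      Complex.continuous_re.comp_continuousOn
        (hG.continuousOn.comp Complex.continuous_ofReal.continuousOn hseg)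
    refine h1.congr fun x hx => ?_
    simp only [hgG x hx, Complex.ofReal_re]
  have hwg : ∀ x ∈ Ioo (-1 : ℝ) 1, w x = jacobiWeight α β x * Real.exp (g x) := by
    intro x hx
    rw [hw x hx, jacobiWeight, hgdef, Real.exp_log (hhre _ (hseg x (Ioo_subset_Icc_self hx)))]
  have hD : ∀ n, Dn n = hankelDet
      (tiltedFunctional (jacobiMeasure α β) jacobiMeasure_restrict g hg 1) (n + 1) := by
    intro n
    rw [hDn, hankelDet]
    congr 2
    funext j k
    rw [tiltedFunctional_apply, integral_jacobiMeasure,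
      intervalIntegral.integral_of_le (by norm_num), intervalIntegral.integral_of_le (by norm_num),
      integral_Ioc_eq_integral_Ioo, integral_Ioc_eq_integral_Ioo]
    refine setIntegral_congr_fun measurableSet_Ioo fun x hx => ?_
    simp only [hwg x hx, Polynomial.eval_pow, Polynomial.eval_X, one_mul, smul_eq_mul]
    ring
  have hDpos : ∀ n, 0 < Dn n := fun n => by
    rw [hD]
    exact hankelDet_pos _ (fun Q hQ => tiltedFunctional_mul_self_pos jacobiMeasure_restrict hg
      (fun Q hQ => integral_mul_self_jacobiMeasure_pos hα hβ hQ) 1 hQ) _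
  have hDinf_log : 2 * Real.log Dinf
      = (Real.circleAverage (fun ζ => G (joukowski ζ)) 0 1).re - (α + β) * Real.log 2 := by
    have hpi := Real.pi_ne_zero
    rw [hDinf, Real.log_exp, integral_log_jacobiWeight_mul_div_sqrt hg hwg,
      circleAverage_comp_joukowski hg hgG]
    field_simp
  have hDinf_pos : 0 < Dinf := hDinf ▸ Real.exp_pos _
  obtain ⟨K, C, hC⟩ := exists_log_asymptotics hα hβ hUopen hseg hG hg hgG
  have hpi := Real.pi_pos
  have hpos : ∀ n : ℕ, 1 ≤ n → 0 < Dn n * 2 ^ (n ^ 2) * (2 / (Real.pi * Dinf ^ 2)) ^ n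
        * (n : ℝ) ^ (-((4 * α ^ 2 - 1) / 8 + (4 * β ^ 2 - 1) / 8)) := by
    intro n hn
    have hn0 : (0 : ℝ) < n := by exact_mod_cast hn
    have := hDpos n
    positivity
  refine ⟨Real.exp K, Real.exp_pos K, exists_abs_sub_exp_le_of_abs_log_sub_le hpos (C := C) ?_⟩
  intro n hn
  have hn0 : (0 : ℝ) < n := by exact_mod_cast hn
  have h1 := hDpos n
  rw [Real.log_mul (by positivity) (by positivity), Real.log_mul (by positivity) (by positivity),
    Real.log_mul (by positivity) (by positivity), Real.log_pow, Real.log_pow, Real.log_rpow hn0,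
    Real.log_div (by positivity) (by positivity), Real.log_mul (by positivity) (by positivity),
    Real.log_pow]
  refine le_trans (le_of_eq ?_) (hC n hn)
  rw [← hD n]
  congr 1
  push_cast
  linear_combination (-(n : ℝ)) * hDinf_log
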